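/- arXiv:1903.05187 — 7 statements merged into one kernel-verified Lean document; each statement's English description precedes it below -/
import Mathlib

section
/- Let n ≥ 20 be a natural number, and suppose that either G = Sym(n) with n even or G = Alt(n) with n odd. Then γ(G) ≥ (n/2)·(1 − √(1 − 8ζ₂(n))) − (√17/2)·n^{3/4}, and moreover (n/2)·(1 − √(1 − 8ζ₂(n))) − (√17/2)·n^{3/4} ≥ (n/2)·(1 − √(1 − 4/π²)) − (√17/2)·n^{3/4}. -/
/-- The normal covering number of a group `G`: the least `s` such that there exist
proper subgroups `H₁, …, H_s` of `G` with every element of `G` lying in some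
conjugate of some `Hᵢ`. -/
noncomputable def normalCoveringNumber (G : Type*) [Group G] : ℕ :=
  sInf {s : ℕ | ∃ H : Fin s → Subgroup G, (∀ i, H i ≠ ⊤) ∧
    ∀ g : G, ∃ i : Fin s, ∃ x : G, x * g * x⁻¹ ∈ H i}

/-- `ζ₂(n) = (1/12) ∏_{p ∣ n, p prime} (1 − 1/p²)`. -/
noncomputable def zeta2 (n : ℕ) : ℝ :=
  (1 / 12) * ∏ p ∈ n.primeFactors, (1 - 1 / (p : ℝ) ^ 2)


section Kernel

/-- An invariant equivalence relation of a preprimitive action is trivial. -/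
theorem eq_or_forall_of_isPreprimitive {G X : Type*} [Group G] [MulAction G X]
    (hG : MulAction.IsPreprimitive G X) (r : Setoid X)
    (hr : ∀ (g : G) (x y : X), r x y → r (g • x) (g • y)) :
    (∀ x y, r x y → x = y) ∨ ∀ x y, r x y := by
  by_contra! h
  obtain ⟨⟨x, y, hxy, hne⟩, u, v, huv⟩ := h
  have hr' : ∀ (g : G) (x y : X), r (g • x) (g • y) → r x y := fun g x y h => by
    simpa using hr g⁻¹ _ _ h
  have hB : MulAction.IsBlock G {z | r x z} := by
    rw [MulAction.isBlock_iff_smul_eq_or_disjoint]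
    intro g
    by_cases hg : r x (g • x)
    · left
      ext z
      rw [Set.mem_smul_set_iff_inv_smul_mem]
      constructor
      · intro hz
        have := hr g _ _ hz
        rw [smul_inv_smul] at this
        exact r.trans hg this
      · intro hz
        apply hr' g
        rw [smul_inv_smul]
        exact r.trans (r.symm hg) hz
    · right
      rw [Set.disjoint_left]
      intro z hz hz'
      rw [Set.mem_smul_set_iff_inv_smul_mem] at hz
      have := hr g _ _ hz
      rw [smul_inv_smul] at this
      exact hg (r.trans hz' (r.symm this))
  rcases hG.isTrivialBlock_of_isBlock hB with h | h
  · exact hne (h (r.refl x) hxy)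
  · have hu : u ∈ {z | r x z} := h ▸ Set.mem_univ u
    have hv : v ∈ {z | r x z} := h ▸ Set.mem_univ v
    exact huv (r.trans (r.symm hu) hv)

variable {Ω : Type*} [Fintype Ω]

/-- A subspace of functions that is stable under a group of permutations. -/
def PermInvariant (H : Subgroup (Equiv.Perm Ω)) (R : Submodule ℝ (Ω → ℝ)) : Prop :=
  ∀ h ∈ H, ∀ f ∈ R, (fun x => f (h x)) ∈ R

/-- The reproducing kernel of a subspace of functions. -/
theorem exists_reproducing_kernel (R : Submodule ℝ (Ω → ℝ)) :
    ∃ E : Ω → Ω → ℝ, (∀ y, (fun x => E x y) ∈ R) ∧ ∀ f ∈ R, ∀ y, ∑ x, f x * E x y = f y := by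
  classical
  let B : R →ₗ[ℝ] Module.Dual ℝ R :=
    LinearMap.mk₂ ℝ (fun f g => ∑ x, f.1 x * g.1 x)
      (by intros; simp [add_mul, Finset.sum_add_distrib])
      (by intros; simp [Finset.mul_sum, mul_assoc])
      (by intros; simp [mul_add, Finset.sum_add_distrib])
      (by intros; simp [Finset.mul_sum, mul_left_comm])
  have hinj : Function.Injective B := by
    rw [← LinearMap.ker_eq_bot, LinearMap.ker_eq_bot']
    intro f hf
    have h0 : ∑ x, f.1 x * f.1 x = 0 := by
      have := LinearMap.congr_fun hf f
      simpa [B] using this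
    rw [Finset.sum_eq_zero_iff_of_nonneg (fun x _ => mul_self_nonneg _)] at h0
    ext x
    simpa using h0 x (Finset.mem_univ x)
  have hsurj : Function.Surjective B :=
    (LinearMap.injective_iff_surjective_of_finrank_eq_finrank
      (Subspace.dual_finrank_eq).symm).1 hinj
  choose r hr using fun y : Ω => hsurj ((LinearMap.proj y).comp R.subtype)
  refine ⟨fun x y => (r y).1 x, fun y => (r y).2, fun f hf y => ?_⟩
  have := LinearMap.congr_fun (hr y) ⟨f, hf⟩
  simp only [B, LinearMap.mk₂_apply, LinearMap.comp_apply, Submodule.subtype_apply,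
    LinearMap.proj_apply] at this
  rw [← this]
  exact Finset.sum_congr rfl fun x _ => mul_comm _ _

/-- The orthogonal projection matrix onto an invariant subspace. -/
theorem exists_projection_kernel (H : Subgroup (Equiv.Perm Ω)) (R : Submodule ℝ (Ω → ℝ))
    (hR : PermInvariant H R) :
    ∃ E : Ω → Ω → ℝ, (∀ x y, E x y = E y x) ∧ (∀ x y, ∑ z, E x z * E z y = E x y) ∧
      (∀ h ∈ H, ∀ x y, E (h x) (h y) = E x y) ∧ ∑ x, E x x = Module.finrank ℝ R ∧
      LinearMap.IsProj R (Matrix.mulVecLin (Matrix.of E)) := by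
  classical
  obtain ⟨E, hE, hrep⟩ := exists_reproducing_kernel R
  have hsymm : ∀ x y, E x y = E y x := by
    intro x y
    have h1 := hrep _ (hE y) x
    have h2 := hrep _ (hE x) y
    rw [← h1, ← h2]
    exact Finset.sum_congr rfl fun z _ => mul_comm _ _
  have hproj : LinearMap.IsProj R (Matrix.mulVecLin (Matrix.of E)) := by
    constructor
    · intro f
      have : Matrix.mulVecLin (Matrix.of E) f = ∑ y, f y • (fun x => E x y) := by
        ext x
        simp [Matrix.mulVec, dotProduct, mul_comm]
      rw [this]
      exact R.sum_mem fun y _ => R.smul_mem _ (hE y)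
    · intro f hf
      ext x
      simp only [Matrix.mulVecLin_apply, Matrix.mulVec, dotProduct, Matrix.of_apply]
      rw [← hrep f hf x]
      exact Finset.sum_congr rfl fun y _ => by rw [hsymm x y, mul_comm]
  refine ⟨E, hsymm, ?_, ?_, ?_, hproj⟩
  · intro x y
    rw [← hrep _ (hE y) x]
    refine Finset.sum_congr rfl fun z _ => ?_
    rw [hsymm x z, mul_comm]
  · intro h hh x y
    have key : ∀ f ∈ R, ∑ z, f z * E (h z) (h y) = f y := by
      intro f hf
      have := hrep _ (hR h⁻¹ (H.inv_mem hh) f hf) (h y)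
      rw [← Equiv.sum_comp h] at this
      simpa using this
    have hd : (fun z => E (h z) (h y) - E z y) ∈ R := R.sub_mem (hR h hh _ (hE (h y))) (hE y)
    have h0 : ∑ z, (E (h z) (h y) - E z y) * (E (h z) (h y) - E z y) = 0 := by
      have h1 := key _ hd
      have h2 := hrep _ hd y
      simp only [mul_sub (_ - _), Finset.sum_sub_distrib]
      rw [h1, h2, sub_self]
    rw [Finset.sum_eq_zero_iff_of_nonneg (fun x _ => mul_self_nonneg _)] at h0
    have := h0 x (Finset.mem_univ x)
    rw [mul_self_eq_zero] at this
    linarith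
  · rw [← hproj.trace, ← Matrix.toLin'_apply', Matrix.trace_toLin'_eq]
    simp [Matrix.trace]

/-- Columns of a projection matrix that are constant on a set `O` are small off `O`. -/
theorem sum_sq_le_of_constant {E : Ω → Ω → ℝ} (hsymm : ∀ x y, E x y = E y x)
    (hid : ∀ x y, ∑ z, E x z * E z y = E x y) {O C : Finset Ω} (hOC : Disjoint O C)
    {y₀ : Ω} (hy₀ : y₀ ∈ O) (hconst : ∀ x ∈ C, ∀ y ∈ O, E x y = E x y₀) :
    O.card * ∑ x ∈ C, E x y₀ ^ 2 ≤ 1 / 4 := by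
  classical
  have hcard : (0 : ℝ) < O.card := by exact_mod_cast Finset.card_pos.2 ⟨y₀, hy₀⟩
  set S : Ω → ℝ := fun x => ∑ y ∈ O, E x y with hS
  set τ := ∑ x ∈ O, S x with hτ
  have htot : ∑ x, S x ^ 2 = τ := by
    have : ∀ x, S x ^ 2 = ∑ y ∈ O, ∑ y' ∈ O, E y x * E x y' := by
      intro x
      rw [pow_two, hS, Finset.sum_mul_sum]
      exact Finset.sum_congr rfl fun y _ => Finset.sum_congr rfl fun y' _ => by
        rw [hsymm x y]
    simp_rw [this]
    rw [Finset.sum_comm]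
    refine Finset.sum_congr rfl fun y _ => ?_
    rw [Finset.sum_comm]
    exact Finset.sum_congr rfl fun y' _ => hid y y'
  have hsub : ∑ x ∈ O, S x ^ 2 + ∑ x ∈ C, S x ^ 2 ≤ τ := by
    rw [← htot, ← Finset.sum_union hOC]
    exact Finset.sum_le_sum_of_subset_of_nonneg (Finset.subset_univ _)
      fun x _ _ => sq_nonneg _
  have hcs : τ ^ 2 ≤ O.card * ∑ x ∈ O, S x ^ 2 := sq_sum_le_card_mul_sum_sq
  have hC : ∑ x ∈ C, S x ^ 2 = O.card ^ 2 * ∑ x ∈ C, E x y₀ ^ 2 := by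
    rw [Finset.mul_sum]
    refine Finset.sum_congr rfl fun x hx => ?_
    have : S x = O.card * E x y₀ := by
      simp only [hS]
      rw [Finset.sum_congr rfl (hconst x hx)]
      simp
    rw [this, mul_pow]
  rw [hC] at hsub
  have h1 := mul_le_mul_of_nonneg_left hsub hcard.le
  have : (O.card : ℝ) ^ 2 * (O.card * ∑ x ∈ C, E x y₀ ^ 2) ≤ (O.card : ℝ) ^ 2 * (1 / 4) := by
    nlinarith [sq_nonneg (τ - O.card / 2)]
  exact le_of_mul_le_mul_left this (by positivity)

end Kernel

section Cycles

variable {Ω : Type*}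

theorem isCycleOn_pow_mem {g : Equiv.Perm Ω} {A : Finset Ω} (hA : g.IsCycleOn A) (k : ℕ) {y : Ω} :
    (g ^ k) y ∈ A ↔ y ∈ A := by
  induction k with
  | zero => simp
  | succ k ih =>
    rw [pow_succ', Equiv.Perm.mul_apply, ← ih]
    exact_mod_cast hA.apply_mem_iff

/-- The orbit of a point of a cycle under a power of that cycle. -/
theorem exists_pow_orbit [DecidableEq Ω] {g : Equiv.Perm Ω} {A : Finset Ω} (hA : g.IsCycleOn A)
    {y : Ω} (hy : y ∈ A) (c : ℕ) :
    ∃ O : Finset Ω, O ⊆ A ∧ y ∈ O ∧ O.card * A.card.gcd c = A.card ∧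
      ∀ z ∈ O, ∃ i, z = (g ^ (c * i)) y := by
  have hpos : 0 < A.card := Finset.card_pos.2 ⟨y, hy⟩
  have hd : 0 < A.card.gcd c := Nat.gcd_pos_of_pos_left _ hpos
  refine ⟨(Finset.range (A.card / A.card.gcd c)).image fun i => (g ^ (c * i)) y, ?_, ?_, ?_, ?_⟩
  · intro z hz
    obtain ⟨i, -, rfl⟩ := Finset.mem_image.1 hz
    exact (isCycleOn_pow_mem hA _).2 hy
  · refine Finset.mem_image.2 ⟨0, ?_, by simp⟩
    exact Finset.mem_range.2 (Nat.div_pos (Nat.gcd_le_left _ hpos) hd)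
  · rw [Finset.card_image_of_injOn, Finset.card_range, Nat.div_mul_cancel (Nat.gcd_dvd_left _ _)]
    intro i hi j hj hij
    rw [Finset.coe_range, Set.mem_Iio] at hi hj
    have h1 : c * i ≡ c * j [MOD A.card] := (hA.pow_apply_eq_pow_apply hy).1 hij
    have h2 := Nat.ModEq.cancel_left_div_gcd hpos h1
    exact Nat.ModEq.eq_of_lt_of_lt h2 hi hj
  · intro z hz
    obtain ⟨i, -, rfl⟩ := Finset.mem_image.1 hz
    exact ⟨i, rfl⟩

variable [Fintype Ω]

section Bounds

variable {H : Subgroup (Equiv.Perm Ω)} {E : Ω → Ω → ℝ}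
  (hsymm : ∀ x y, E x y = E y x) (hid : ∀ x y, ∑ z, E x z * E z y = E x y)
  (hinv : ∀ h ∈ H, ∀ x y, E (h x) (h y) = E x y)
  {g : Equiv.Perm Ω} (hg : g ∈ H) {A C : Finset Ω} (hA : g.IsCycleOn A) (hC : g.IsCycleOn C)
include hinv hg hC

omit [Fintype Ω] in
theorem kernel_pow_apply {x y : Ω} (hx : x ∈ C) (i : ℕ) :
    E x ((g ^ (C.card * i)) y) = E x y := by
  have h1 := hinv (g ^ (C.card * i)) (H.pow_mem hg _) x y
  rwa [(hC.pow_apply_eq hx).2 (dvd_mul_right _ _)] at h1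

include hsymm hid hA

theorem card_mul_sum_kernel_sq_le (hAC : Disjoint A C) {y : Ω} (hy : y ∈ A) :
    A.card * ∑ x ∈ C, E x y ^ 2 ≤ A.card.gcd C.card / 4 := by
  classical
  obtain ⟨O, hOA, hyO, hcard, hO⟩ := exists_pow_orbit hA hy C.card
  have h := sum_sq_le_of_constant hsymm hid (hAC.mono_left hOA) hyO (fun x hx z hz => by
    obtain ⟨i, rfl⟩ := hO z hz
    exact kernel_pow_apply hinv hg hC hx i)
  have : (A.card : ℝ) = O.card * A.card.gcd C.card := by exact_mod_cast hcard.symm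
  rw [this]
  have hd : (0 : ℝ) ≤ A.card.gcd C.card := Nat.cast_nonneg _
  nlinarith

theorem card_mul_card_mul_kernel_sq_le (hAC : Disjoint A C) {x y : Ω} (hx : x ∈ C) (hy : y ∈ A) :
    A.card * C.card * E x y ^ 2 ≤ (A.card.gcd C.card) ^ 2 / 4 := by
  classical
  obtain ⟨O, hOC, hxO, hcard, hO⟩ := exists_pow_orbit hC hx A.card
  have h1 := card_mul_sum_kernel_sq_le hsymm hid hinv hg hA hC hAC hy
  have h2 : O.card * E x y ^ 2 ≤ ∑ x ∈ C, E x y ^ 2 := by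
    have : ∑ z ∈ O, E z y ^ 2 = O.card * E x y ^ 2 := by
      rw [Finset.sum_congr rfl (g := fun _ => E x y ^ 2), Finset.sum_const, nsmul_eq_mul]
      intro z hz
      obtain ⟨i, rfl⟩ := hO z hz
      rw [hsymm, kernel_pow_apply hinv hg hA hy i, hsymm]
    rw [← this]
    exact Finset.sum_le_sum_of_subset_of_nonneg hOC fun x _ _ => sq_nonneg _
  have h3 : (C.card : ℝ) = O.card * A.card.gcd C.card := by
    rw [Nat.gcd_comm]; exact_mod_cast hcard.symm
  have hd : (0 : ℝ) ≤ A.card.gcd C.card := Nat.cast_nonneg _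
  have ha : (0 : ℝ) ≤ A.card := Nat.cast_nonneg _
  calc (A.card * C.card * E x y ^ 2 : ℝ)
      = A.card.gcd C.card * (A.card * (O.card * E x y ^ 2)) := by rw [h3]; ring
    _ ≤ A.card.gcd C.card * (A.card * ∑ x ∈ C, E x y ^ 2) := by gcongr
    _ ≤ A.card.gcd C.card * (A.card.gcd C.card / 4) := by gcongr
    _ = _ := by ring

end Bounds

/-- The permutation `g` consists of the three cycles `A`, `B`, `C`. -/
structure ThreeCycles (g : Equiv.Perm Ω) (A B C : Finset Ω) : Prop where
  left : g.IsCycleOn A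
  mid : g.IsCycleOn B
  right : g.IsCycleOn C
  disj_left_mid : Disjoint A B
  disj_left_right : Disjoint A C
  disj_mid_right : Disjoint B C
  left_nonempty : A.Nonempty
  mid_nonempty : B.Nonempty
  right_nonempty : C.Nonempty
  cover : ∀ x, x ∈ A ∨ x ∈ B ∨ x ∈ C

namespace ThreeCycles

variable {g : Equiv.Perm Ω} {A B C : Finset Ω}

omit [Fintype Ω] in
theorem swap_left (h : ThreeCycles g A B C) : ThreeCycles g B A C :=
  ⟨h.2, h.1, h.3, h.4.symm, h.6, h.5, h.8, h.7, h.9, fun x => by have := h.10 x; tauto⟩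

omit [Fintype Ω] in
theorem swap_right (h : ThreeCycles g A B C) : ThreeCycles g A C B :=
  ⟨h.1, h.3, h.2, h.5, h.4, h.6.symm, h.7, h.9, h.8, fun x => by have := h.10 x; tauto⟩

theorem univ_eq [DecidableEq Ω] (h : ThreeCycles g A B C) : Finset.univ = A ∪ B ∪ C := by
  ext x; simpa [or_assoc] using h.cover x

theorem sum_eq {M : Type*} [AddCommMonoid M] (h : ThreeCycles g A B C) (f : Ω → M) :
    ∑ x, f x = ∑ x ∈ A, f x + ∑ x ∈ B, f x + ∑ x ∈ C, f x := by
  classical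
  rw [h.univ_eq, Finset.sum_union, Finset.sum_union h.disj_left_mid]
  exact Finset.disjoint_union_left.2 ⟨h.disj_left_right, h.disj_mid_right⟩

theorem card_add (h : ThreeCycles g A B C) : A.card + B.card + C.card = Fintype.card Ω := by
  have := h.sum_eq (fun _ => 1)
  simp only [Finset.sum_const, smul_eq_mul, mul_one] at this
  rw [← this, Finset.card_univ]

end ThreeCycles

omit [Fintype Ω] in
/-- A primitive group separates two points by a proper nonempty subset. -/
theorem exists_separating {H : Subgroup (Equiv.Perm Ω)} (hH : MulAction.IsPreprimitive H Ω)
    {C : Finset Ω} (hC : C.Nonempty) (hC' : ∃ z, z ∉ C) {x y : Ω} (hxy : x ≠ y) :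
    ∃ h ∈ H, (h x ∈ C ∧ h y ∉ C) ∨ (h x ∉ C ∧ h y ∈ C) := by
  let r : Setoid Ω := ⟨fun u v => ∀ h ∈ H, h u ∈ C ↔ h v ∈ C,
    ⟨fun _ _ _ => Iff.rfl, fun k h hh => (k h hh).symm,
      fun k l h hh => (k h hh).trans (l h hh)⟩⟩
  rcases eq_or_forall_of_isPreprimitive hH r (fun k u v huv h hh =>
      huv (h * k.1) (H.mul_mem hh k.2)) with hr | hr
  · by_contra! hcon
    refine hxy (hr x y fun h hh => ?_)
    have := hcon h hh
    tauto
  · obtain ⟨u, hu⟩ := hC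
    obtain ⟨v, hv⟩ := hC'
    exact absurd ((hr u v 1 H.one_mem).1 hu) hv

/-- The spectral inequality for a primitive group containing a permutation with three cycles. -/
theorem ThreeCycles.finrank_mul_le {H : Subgroup (Equiv.Perm Ω)}
    (hH : MulAction.IsPreprimitive H Ω) {g : Equiv.Perm Ω} (hg : g ∈ H) {A B C : Finset Ω}
    (h : ThreeCycles g A B C) {R : Submodule ℝ (Ω → ℝ)} (hR : PermInvariant H R) {q : ℝ}
    (hqA : ((A.card.gcd C.card : ℕ) : ℝ) ^ 2 ≤ 4 * q * A.card)
    (hqB : ((B.card.gcd C.card : ℕ) : ℝ) ^ 2 ≤ 4 * q * B.card) :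
    (Module.finrank ℝ R : ℝ) * (Fintype.card Ω - Module.finrank ℝ R) ≤
      (Fintype.card Ω) ^ 2 *
        (q + ((A.card.gcd C.card : ℕ) + (B.card.gcd C.card : ℕ)) / (4 * C.card)) := by
  classical
  obtain ⟨E, hsymm, hid, hinv, htr, -⟩ := exists_projection_kernel H R hR
  have hApos : (0 : ℝ) < A.card := by exact_mod_cast Finset.card_pos.2 h.left_nonempty
  have hBpos : (0 : ℝ) < B.card := by exact_mod_cast Finset.card_pos.2 h.mid_nonempty
  have hCpos : (0 : ℝ) < C.card := by exact_mod_cast Finset.card_pos.2 h.right_nonempty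
  have hq : 0 ≤ q := by
    have := (sq_nonneg _).trans hqA
    by_contra hq
    nlinarith
  obtain ⟨x, hx⟩ := h.right_nonempty
  have htrans := hH.toIsPretransitive
  have hdiag : ∀ y, E y y = E x x := by
    intro y
    obtain ⟨k, hk⟩ := htrans.exists_smul_eq x y
    have := hinv k.1 k.2 x x
    rw [← hk]
    exact this
  have hδ : (Fintype.card Ω : ℝ) * E x x = Module.finrank ℝ R := by
    rw [← htr, Finset.sum_congr rfl fun y _ => hdiag y]
    simp
  have hoffA : ∀ u ∈ C, ∀ v ∈ A, E u v ^ 2 ≤ q / C.card := by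
    intro u hu v hv
    have h1 := card_mul_card_mul_kernel_sq_le hsymm hid hinv hg h.left h.right
      h.disj_left_right hu hv
    rw [le_div_iff₀ hCpos]
    have : (A.card : ℝ) * (E u v ^ 2 * C.card) ≤ A.card * q := by nlinarith
    exact le_of_mul_le_mul_left this hApos
  have hoffB : ∀ u ∈ C, ∀ v ∈ B, E u v ^ 2 ≤ q / C.card := by
    intro u hu v hv
    have h1 := card_mul_card_mul_kernel_sq_le hsymm hid hinv hg h.mid h.right
      h.disj_mid_right hu hv
    rw [le_div_iff₀ hCpos]
    have : (B.card : ℝ) * (E u v ^ 2 * C.card) ≤ B.card * q := by nlinarith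
    exact le_of_mul_le_mul_left this hBpos
  have hoff : ∀ u ∈ C, ∀ v ∉ C, E u v ^ 2 ≤ q / C.card := by
    intro u hu v hv
    rcases h.cover v with hv' | hv' | hv'
    · exact hoffA u hu v hv'
    · exact hoffB u hu v hv'
    · exact absurd hv' hv
  have hCC : ∀ z ∈ C.erase x, E x z ^ 2 ≤ q / C.card := by
    intro z hz
    obtain ⟨a, ha⟩ := h.left_nonempty
    obtain ⟨k, hk, hk'⟩ := exists_separating hH h.right_nonempty
      ⟨a, Finset.disjoint_left.1 h.disj_left_right ha⟩ (Finset.ne_of_mem_erase hz).symm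
    rw [← hinv k hk]
    rcases hk' with ⟨h1, h2⟩ | ⟨h1, h2⟩
    · exact hoff _ h1 _ h2
    · rw [hsymm]; exact hoff _ h2 _ h1
  have hsumA : ∑ z ∈ A, E x z ^ 2 ≤ (A.card.gcd C.card : ℕ) / (4 * C.card) := by
    have := card_mul_sum_kernel_sq_le hsymm hid hinv hg h.right h.left h.disj_left_right.symm hx
    rw [Nat.gcd_comm] at this
    rw [le_div_iff₀ (by positivity), Finset.sum_congr rfl fun z _ => by rw [hsymm x z]]
    linarith
  have hsumB : ∑ z ∈ B, E x z ^ 2 ≤ (B.card.gcd C.card : ℕ) / (4 * C.card) := by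
    have := card_mul_sum_kernel_sq_le hsymm hid hinv hg h.right h.mid h.disj_mid_right.symm hx
    rw [Nat.gcd_comm] at this
    rw [le_div_iff₀ (by positivity), Finset.sum_congr rfl fun z _ => by rw [hsymm x z]]
    linarith
  have hsumC : ∑ z ∈ C, E x z ^ 2 ≤ E x x ^ 2 + q := by
    rw [← Finset.add_sum_erase _ _ hx]
    have h1 := Finset.sum_le_card_nsmul _ _ _ hCC
    rw [nsmul_eq_mul] at h1
    have h2 : ((C.erase x).card : ℝ) ≤ C.card := by exact_mod_cast Finset.card_erase_le
    have h3 : ((C.erase x).card : ℝ) * (q / C.card) ≤ C.card * (q / C.card) := by gcongr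
    rw [mul_div_cancel₀ _ hCpos.ne'] at h3
    linarith
  have hsum : ∑ z, E x z ^ 2 = E x x := by
    rw [← hid x x]
    exact Finset.sum_congr rfl fun z _ => by rw [hsymm z x, pow_two]
  rw [h.sum_eq] at hsum
  have hfin : E x x - E x x ^ 2 ≤
      q + ((A.card.gcd C.card : ℕ) + (B.card.gcd C.card : ℕ)) / (4 * C.card) := by
    rw [add_div]; linarith
  rw [← hδ]
  calc _ = (Fintype.card Ω : ℝ) ^ 2 * (E x x - E x x ^ 2) := by ring
    _ ≤ _ := by gcongr

end Cycles

section Association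

variable {Ω : Type*} [Fintype Ω]

theorem finrank_mul_self_le (R : Submodule ℝ (Ω → ℝ)) :
    Module.finrank ℝ (R * R : Submodule ℝ (Ω → ℝ)) ≤ (Module.finrank ℝ R + 1).choose 2 := by
  classical
  let b := Module.finBasis ℝ R
  let v : Fin (Module.finrank ℝ R) → Ω → ℝ := fun i => (b i : Ω → ℝ)
  have hspan : Submodule.span ℝ (Set.range v) = R := by
    have := congrArg (Submodule.map R.subtype) b.span_eq
    rw [Submodule.map_span, ← Set.range_comp, Submodule.map_top, Submodule.range_subtype] at this
    exact this
  let p : Sym2 (Fin (Module.finrank ℝ R)) → Ω → ℝ :=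
    Sym2.lift ⟨fun i j => v i * v j, fun i j => mul_comm _ _⟩
  have hRR : R * R = Submodule.span ℝ (Set.range p) := by
    conv_lhs => rw [← hspan, Submodule.span_mul_span]
    congr 1
    ext f
    constructor
    · rintro ⟨_, ⟨i, rfl⟩, _, ⟨j, rfl⟩, rfl⟩
      exact ⟨s(i, j), rfl⟩
    · rintro ⟨z, rfl⟩
      induction z with
      | _ i j => exact ⟨_, ⟨i, rfl⟩, _, ⟨j, rfl⟩, rfl⟩
  rw [hRR]
  have := finrank_range_le_card (R := ℝ) p
  rwa [Sym2.card, Fintype.card_fin] at this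

omit [Fintype Ω] in
theorem le_mul_self_of_one_mem {R : Submodule ℝ (Ω → ℝ)} (h1 : (1 : Ω → ℝ) ∈ R) : R ≤ R * R :=
  fun f hf => by simpa using Submodule.mul_mem_mul hf h1

omit [Fintype Ω] in
theorem PermInvariant.mul_self {H : Subgroup (Equiv.Perm Ω)} {R : Submodule ℝ (Ω → ℝ)}
    (hR : PermInvariant H R) : PermInvariant H (R * R) := by
  intro h hh f hf
  induction hf using Submodule.mul_induction_on' with
  | mem_mul_mem a ha b hb => exact Submodule.mul_mem_mul (hR h hh a ha) (hR h hh b hb)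
  | add a _ b _ iha ihb => exact Submodule.add_mem _ iha ihb

omit [Fintype Ω] in
theorem permInvariant_span_one (H : Subgroup (Equiv.Perm Ω)) :
    PermInvariant H (Submodule.span ℝ {(1 : Ω → ℝ)}) := by
  intro h _ f hf
  obtain ⟨a, rfl⟩ := Submodule.mem_span_singleton.1 hf
  exact Submodule.mem_span_singleton.2 ⟨a, by ext; simp⟩

omit [Fintype Ω] in
theorem PermInvariant.sup {H : Subgroup (Equiv.Perm Ω)} {R S : Submodule ℝ (Ω → ℝ)}
    (hR : PermInvariant H R) (hS : PermInvariant H S) : PermInvariant H (R ⊔ S) := by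
  intro h hh f hf
  obtain ⟨a, ha, b, hb, rfl⟩ := Submodule.mem_sup.1 hf
  exact Submodule.add_mem_sup (hR h hh a ha) (hS h hh b hb)

/-- An invariant function algebra of a primitive group is trivial. -/
theorem eq_span_one_or_top_of_mul_self {H : Subgroup (Equiv.Perm Ω)}
    (hH : MulAction.IsPreprimitive H Ω) {R : Submodule ℝ (Ω → ℝ)} (hR : PermInvariant H R)
    (h1 : (1 : Ω → ℝ) ∈ R) (hmul : R * R ≤ R) :
    R = Submodule.span ℝ {(1 : Ω → ℝ)} ∨ R = ⊤ := by
  classical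
  let r : Setoid Ω := ⟨fun u v => ∀ f ∈ R, f u = f v,
    ⟨fun _ _ _ => rfl, fun k f hf => (k f hf).symm, fun k l f hf => (k f hf).trans (l f hf)⟩⟩
  rcases eq_or_forall_of_isPreprimitive hH r
    (fun k u v huv f hf => huv _ (hR k.1 k.2 f hf)) with hr | hr
  · right
    have hsep : ∀ x y, x ≠ y → ∃ f ∈ R, f x = 1 ∧ f y = 0 := by
      intro x y hxy
      have : ¬ r x y := fun h => hxy (hr x y h)
      change ¬ ∀ f ∈ R, f x = f y at this
      push Not at this
      obtain ⟨f, hf, hne⟩ := this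
      refine ⟨(f x - f y)⁻¹ • (f - f y • 1),
        R.smul_mem _ (R.sub_mem hf (R.smul_mem _ h1)), ?_, ?_⟩
      · simp [inv_mul_cancel₀ (sub_ne_zero.2 hne)]
      · simp
    choose! F hF hF1 hF0 using hsep
    have hprod : ∀ (x : Ω) (s : Finset Ω), x ∉ s → ∏ y ∈ s, F x y ∈ R := by
      intro x s
      induction s using Finset.induction_on with
      | empty => simpa using h1
      | insert a s ha ih =>
        intro hx
        rw [Finset.mem_insert, not_or] at hx
        rw [Finset.prod_insert ha]
        exact hmul (Submodule.mul_mem_mul (hF x a hx.1) (ih hx.2))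
    have hsingle : ∀ x, Pi.single x (1 : ℝ) ∈ R := by
      intro x
      convert hprod x (Finset.univ.erase x) (Finset.notMem_erase _ _) using 1
      ext z
      rw [Finset.prod_apply]
      by_cases hz : z = x
      · subst hz
        rw [Pi.single_eq_same, Finset.prod_eq_one]
        intro y hy
        exact hF1 _ _ (Finset.ne_of_mem_erase hy).symm
      · rw [Pi.single_eq_of_ne hz, eq_comm]
        exact Finset.prod_eq_zero (Finset.mem_erase.2 ⟨hz, Finset.mem_univ z⟩)
          (hF0 _ _ (Ne.symm hz))
    rw [eq_top_iff]
    intro f _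
    have : f = ∑ x, f x • Pi.single x (1 : ℝ) := by
      ext z
      simp [Finset.sum_apply, Pi.single_apply]
    rw [this]
    exact R.sum_mem fun x _ => R.smul_mem _ (hsingle x)
  · left
    refine le_antisymm (fun f hf => ?_) ((Submodule.span_singleton_le_iff_mem _ _).2 h1)
    rcases isEmpty_or_nonempty Ω with hΩ | ⟨⟨x⟩⟩
    · rw [Subsingleton.elim f 0]; exact zero_mem _
    · exact Submodule.mem_span_singleton.2 ⟨f x, by ext y; simpa using hr x y f hf⟩

/-- Every invariant subspace has dimension or codimension at most `1.2522 √N`. -/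
def SmallSpectrum (H : Subgroup (Equiv.Perm Ω)) : Prop :=
  ∀ R : Submodule ℝ (Ω → ℝ), PermInvariant H R →
    (Module.finrank ℝ R : ℝ) ≤ 1.2522 * Real.sqrt (Fintype.card Ω) ∨
    (Fintype.card Ω : ℝ) - Module.finrank ℝ R ≤ 1.2522 * Real.sqrt (Fintype.card Ω)

theorem SmallSpectrum.eq_span_one {H : Subgroup (Equiv.Perm Ω)}
    (hH : MulAction.IsPreprimitive H Ω) (hs : SmallSpectrum H)
    (hN : 95 ≤ Real.sqrt (Fintype.card Ω)) {R : Submodule ℝ (Ω → ℝ)} (hR : PermInvariant H R)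
    (h1 : (1 : Ω → ℝ) ∈ R) (hdim : (Module.finrank ℝ R : ℝ) ≤ Fintype.card Ω / 2) :
    R = Submodule.span ℝ {(1 : Ω → ℝ)} := by
  induction hk : Fintype.card Ω - Module.finrank ℝ R using Nat.strong_induction_on
    generalizing R with
  | _ k ih =>
    set w := Real.sqrt (Fintype.card Ω) with hw
    have hww : (Fintype.card Ω : ℝ) = w * w := (Real.mul_self_sqrt (Nat.cast_nonneg _)).symm
    have hm : (Module.finrank ℝ R : ℝ) ≤ 1.2522 * w := by
      rcases hs R hR with h | h
      · exact h
      · nlinarith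
    have hle := le_mul_self_of_one_mem h1
    have hdim' : (Module.finrank ℝ (R * R : Submodule ℝ (Ω → ℝ)) : ℝ) ≤ Fintype.card Ω / 2 := by
      have h2 : (Module.finrank ℝ (R * R : Submodule ℝ (Ω → ℝ)) : ℝ) ≤
          (Module.finrank ℝ R + 1) * Module.finrank ℝ R / 2 := by
        have h3 := finrank_mul_self_le R
        have h4 : (Module.finrank ℝ (R * R : Submodule ℝ (Ω → ℝ)) : ℝ) ≤
          ((Module.finrank ℝ R + 1).choose 2 : ℕ) := by exact_mod_cast h3
        rw [Nat.cast_choose_two] at h4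
        push_cast at h4
        linarith
      rcases hs _ hR.mul_self with h | h
      · nlinarith
      · have : (0 : ℝ) ≤ Module.finrank ℝ R := Nat.cast_nonneg _
        nlinarith
    by_cases heq : R * R = R
    · rcases eq_span_one_or_top_of_mul_self hH hR h1 heq.le with h | h
      · exact h
      · rw [h, finrank_top, Module.finrank_fintype_fun_eq_card] at hdim
        nlinarith
    · have hlt : R < R * R := lt_of_le_of_ne hle (Ne.symm heq)
      have hfr := Submodule.finrank_lt_finrank_of_lt hlt
      have hfr' := Submodule.finrank_le (R * R)
      rw [Module.finrank_fintype_fun_eq_card] at hfr'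
      have := ih (Fintype.card Ω - Module.finrank ℝ (R * R : Submodule ℝ (Ω → ℝ))) (by omega)
        hR.mul_self (hle h1) hdim' rfl
      refine le_antisymm (this ▸ hle) ((Submodule.span_singleton_le_iff_mem _ _).2 h1)

theorem SmallSpectrum.eq_top {H : Subgroup (Equiv.Perm Ω)}
    (hH : MulAction.IsPreprimitive H Ω) (hs : SmallSpectrum H)
    (hN : 95 ≤ Real.sqrt (Fintype.card Ω)) {R : Submodule ℝ (Ω → ℝ)} (hR : PermInvariant H R)
    (h1 : (1 : Ω → ℝ) ∈ R) (hne : R ≠ Submodule.span ℝ {(1 : Ω → ℝ)}) : R = ⊤ := by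
  classical
  have hbig : (Fintype.card Ω : ℝ) / 2 < Module.finrank ℝ R := by
    by_contra! h
    exact hne (hs.eq_span_one hH hN hR h1 h)
  set w := Real.sqrt (Fintype.card Ω) with hw
  have hww : (Fintype.card Ω : ℝ) = w * w := (Real.mul_self_sqrt (Nat.cast_nonneg _)).symm
  have hco : (Fintype.card Ω : ℝ) - Module.finrank ℝ R ≤ 1.2522 * w := by
    rcases hs R hR with h | h
    · nlinarith
    · exact h
  obtain ⟨E, hsymm, hid, hinv, -, hproj⟩ := exists_projection_kernel H R hR
  set P := Matrix.mulVecLin (Matrix.of E)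
  have hrange : LinearMap.range P = R := by
    ext f
    constructor
    · rintro ⟨u, rfl⟩; exact hproj.1 u
    · intro hf; exact ⟨f, hproj.2 f hf⟩
  have hrn := P.finrank_range_add_finrank_ker
  rw [hrange, Module.finrank_fintype_fun_eq_card] at hrn
  have hkerinv : PermInvariant H (LinearMap.ker P) := by
    intro h hh f hf
    rw [LinearMap.mem_ker] at hf ⊢
    ext x
    have := congrFun hf (h x)
    simp only [P, Matrix.mulVecLin_apply, Matrix.mulVec, dotProduct, Matrix.of_apply,
      Pi.zero_apply] at this ⊢
    rw [← this, ← Equiv.sum_comp h fun y => E (h x) y * f y]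
    exact Finset.sum_congr rfl fun y _ => by rw [hinv h hh]
  have hdim := Submodule.finrank_add_le_finrank_add_finrank (LinearMap.ker P)
    (Submodule.span ℝ {(1 : Ω → ℝ)})
  have hone : Module.finrank ℝ (Submodule.span ℝ {(1 : Ω → ℝ)}) ≤ 1 :=
    (finrank_span_le_card _).trans (by simp)
  have hle : (Module.finrank ℝ (LinearMap.ker P ⊔ Submodule.span ℝ {(1 : Ω → ℝ)} :
      Submodule ℝ (Ω → ℝ)) : ℝ) ≤ Module.finrank ℝ (LinearMap.ker P) + 1 := by
    exact_mod_cast hdim.trans (by omega)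
  have hrn' : (Module.finrank ℝ R : ℝ) + Module.finrank ℝ (LinearMap.ker P) = Fintype.card Ω := by
    exact_mod_cast hrn
  have := hs.eq_span_one hH hN (hkerinv.sup (permInvariant_span_one H))
    (Submodule.mem_sup_right (Submodule.mem_span_singleton_self _)) (by nlinarith)
  have hker : LinearMap.ker P = ⊥ := by
    rw [eq_bot_iff]
    intro f hf
    have hf' : f ∈ Submodule.span ℝ {(1 : Ω → ℝ)} := this ▸ Submodule.mem_sup_left hf
    obtain ⟨a, rfl⟩ := Submodule.mem_span_singleton.1 hf'
    rw [LinearMap.mem_ker, hproj.2 _ (R.smul_mem _ h1)] at hf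
    exact hf
  rw [hker, finrank_bot, add_zero] at hrn
  exact Submodule.eq_top_of_finrank_eq (by rw [hrn, Module.finrank_fintype_fun_eq_card])

/-- Symmetric invariant kernels are constant off the diagonal. -/
theorem SmallSpectrum.kernel_constant {H : Subgroup (Equiv.Perm Ω)}
    (hH : MulAction.IsPreprimitive H Ω) (hs : SmallSpectrum H)
    (hN : 95 ≤ Real.sqrt (Fintype.card Ω)) {K : Ω → Ω → ℝ} (hsymm : ∀ x y, K x y = K y x)
    (hinv : ∀ h ∈ H, ∀ x y, K (h x) (h y) = K x y) :
    ∃ k₀ k, ∀ x y, (x = y → K x y = k₀) ∧ (x ≠ y → K x y = k) := by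
  classical
  have htrans := hH.toIsPretransitive
  have hcard : (0 : ℝ) < Fintype.card Ω := Real.sqrt_pos.1 (by linarith)
  have hne : Nonempty Ω := Fintype.card_pos_iff.1 (by exact_mod_cast hcard)
  obtain ⟨o⟩ := hne
  have hrow : ∀ x, ∑ y, K x y = ∑ y, K o y := by
    intro x
    obtain ⟨h, hh⟩ := htrans.exists_smul_eq o x
    have hh' : h.1 o = x := hh
    rw [← hh', ← Equiv.sum_comp h.1]
    exact Finset.sum_congr rfl fun y _ => hinv _ h.2 _ _
  set c := (∑ y, K o y) / Fintype.card Ω with hc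
  set A : Matrix Ω Ω ℝ := Matrix.of fun x y => K x y - c with hA
  have hA1 : A.mulVec 1 = 0 := by
    ext x
    simp only [hA, Matrix.mulVec, dotProduct, Matrix.of_apply, Pi.one_apply, mul_one,
      Finset.sum_sub_distrib, hrow x, Finset.sum_const, Finset.card_univ, nsmul_eq_mul,
      Pi.zero_apply]
    rw [hc, mul_div_cancel₀ _ hcard.ne', sub_self]
  have hherm : A.IsHermitian := by
    ext x y
    simp [hA, hsymm x y]
  by_cases hA0 : A = 0
  · refine ⟨c, c, fun x y => ?_⟩
    have := congrFun (congrFun hA0 x) y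
    simp only [hA, Matrix.of_apply, Matrix.zero_apply] at this
    exact ⟨fun _ => by linarith, fun _ => by linarith⟩
  have heig : hherm.eigenvalues ≠ 0 := fun h => hA0 (hherm.eigenvalues_eq_zero_iff.1 h)
  obtain ⟨i, hi⟩ := Function.ne_iff.1 heig
  set l := hherm.eigenvalues i with hl
  set v : Ω → ℝ := (hherm.eigenvectorBasis i).ofLp with hv
  have hAv : A.mulVec v = l • v := hherm.mulVec_eigenvectorBasis i
  have hl0 : l ≠ 0 := hi
  have hv0 : v ≠ 0 := by
    intro h
    have h1 := hherm.eigenvectorBasis.orthonormal.ne_zero i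
    exact h1 (by ext x; exact congrFun h x)
  let V : Submodule ℝ (Ω → ℝ) := LinearMap.ker (A.mulVecLin - l • LinearMap.id)
  have hV : ∀ f, f ∈ V ↔ A.mulVec f = l • f := by
    intro f
    simp [V, sub_eq_zero]
  have hVinv : PermInvariant H V := by
    intro h hh f hf
    rw [hV] at hf ⊢
    ext x
    have := congrFun hf (h x)
    simp only [hA, Matrix.mulVec, dotProduct, Matrix.of_apply, Pi.smul_apply] at this ⊢
    rw [← this, ← Equiv.sum_comp h fun y => (K (h x) y - c) * f y]
    exact Finset.sum_congr rfl fun y _ => by rw [hinv h hh]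
  have htop := hs.eq_top hH hN (hVinv.sup (permInvariant_span_one H))
    (Submodule.mem_sup_right (Submodule.mem_span_singleton_self _)) (by
      intro h
      have hv' : v ∈ Submodule.span ℝ {(1 : Ω → ℝ)} := by
        rw [← h]; exact Submodule.mem_sup_left ((hV v).2 hAv)
      obtain ⟨a, ha⟩ := Submodule.mem_span_singleton.1 hv'
      rw [← ha, Matrix.mulVec_smul, hA1, smul_zero, eq_comm, smul_eq_zero] at hAv
      rcases hAv with h | h
      · exact hl0 h
      · exact hv0 (ha ▸ h))
  have hcol : ∀ y, ∃ b, ∀ x, x ≠ y → A x y = b := by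
    intro y
    have : Pi.single y (1 : ℝ) ∈ V ⊔ Submodule.span ℝ {(1 : Ω → ℝ)} := htop ▸ Submodule.mem_top
    obtain ⟨f, hf, u, hu, hfu⟩ := Submodule.mem_sup.1 this
    obtain ⟨a, rfl⟩ := Submodule.mem_span_singleton.1 hu
    refine ⟨-(l * a), fun x hx => ?_⟩
    have h1 : A.mulVec (Pi.single y 1) = l • f := by
      rw [← hfu, Matrix.mulVec_add, Matrix.mulVec_smul, hA1, smul_zero, add_zero, (hV f).1 hf]
    have h2 := congrFun h1 x
    have h3 := congrFun hfu x
    rw [Matrix.mulVec_single_one] at h2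
    simp only [Matrix.col_apply, Pi.smul_apply, smul_eq_mul] at h2
    simp only [Pi.add_apply, Pi.smul_apply, Pi.one_apply, smul_eq_mul, mul_one,
      Pi.single_eq_of_ne hx] at h3
    rw [h2, show f x = -a by linarith]
    ring
  choose b hb using hcol
  have hbb : ∀ y y', y ≠ y' → b y = b y' := by
    intro y y' hy
    rw [← hb y y' hy.symm, ← hb y' y hy]
    simp [hA, hsymm y y']
  refine ⟨K o o, b o + c, fun x y => ⟨?_, fun hxy => ?_⟩⟩
  · rintro rfl
    obtain ⟨h, hh⟩ := htrans.exists_smul_eq o x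
    rw [← hh]
    exact hinv _ h.2 _ _
  · have h1 := hb y x hxy
    have h2 : b y = b o := by
      by_cases h : y = o
      · rw [h]
      · exact hbb _ _ h
    simp only [hA, Matrix.of_apply] at h1
    linarith

end Association

section Bochert

variable {Ω : Type*} [Fintype Ω] [DecidableEq Ω]

theorem card_support_commutator_le (x y : Equiv.Perm Ω) :
    (x * y * x⁻¹ * y⁻¹).support.card ≤ 3 * (x.support ∩ y.support).card := by
  set I := x.support ∩ y.support with hI
  have hsub : (x * y * x⁻¹ * y⁻¹).support ⊆ I ∪ (I.image x ∪ I.image y) := by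
    intro z hz
    by_contra hcon
    simp only [Finset.mem_union, not_or] at hcon
    obtain ⟨h1, h2, h3⟩ := hcon
    rw [Equiv.Perm.mem_support] at hz
    apply hz
    simp only [Equiv.Perm.mul_apply]
    have hx' : x (x⁻¹ z) = z := x.apply_symm_apply z
    have hy' : y (y⁻¹ z) = z := y.apply_symm_apply z
    by_cases hy : y z = z
    · have hyi : y⁻¹ z = z := by rw [Equiv.Perm.inv_eq_iff_eq]; exact hy.symm
      rw [hyi]
      have : y (x⁻¹ z) = x⁻¹ z := by
        by_cases hx : x z = z
        · have hxi : x⁻¹ z = z := by rw [Equiv.Perm.inv_eq_iff_eq]; exact hx.symm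
          rw [hxi, hy]
        · by_contra hne
          refine h2 (Finset.mem_image.2 ⟨x⁻¹ z, ?_, hx'⟩)
          rw [hI, Finset.mem_inter, Equiv.Perm.mem_support, Equiv.Perm.mem_support]
          refine ⟨fun h => hx ?_, hne⟩
          rw [hx'] at h
          rw [Eq.comm, ← Equiv.Perm.inv_eq_iff_eq]
          exact h.symm
      rw [this, hx']
    · have hx : x z = z := by
        by_contra hne
        exact h1 (by simp [hI, hne, hy])
      have : x (y⁻¹ z) = y⁻¹ z := by
        by_contra hne
        refine h3 (Finset.mem_image.2 ⟨y⁻¹ z, ?_, hy'⟩)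
        rw [hI, Finset.mem_inter, Equiv.Perm.mem_support, Equiv.Perm.mem_support]
        refine ⟨hne, fun h => hy ?_⟩
        rw [hy'] at h
        rw [Eq.comm, ← Equiv.Perm.inv_eq_iff_eq]
        exact h.symm
      have hxi : x⁻¹ (y⁻¹ z) = y⁻¹ z := by rw [Equiv.Perm.inv_eq_iff_eq]; exact this.symm
      rw [hxi, hy', hx]
  calc _ ≤ (I ∪ (I.image x ∪ I.image y)).card := Finset.card_le_card hsub
    _ ≤ I.card + ((I.image x).card + (I.image y).card) :=
      (Finset.card_union_le _ _).trans (by gcongr; exact Finset.card_union_le _ _)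
    _ ≤ I.card + (I.card + I.card) := by
      have h1 := Finset.card_image_le (s := I) (f := x)
      have h2 := Finset.card_image_le (s := I) (f := y)
      omega
    _ = _ := by ring

/-- The two moment inequalities for an element of minimal support, in numerical form. -/
theorem minimal_support_numeric {N m h k₀ k sI sI2 sZ : ℝ} (hN : 1 < N) (hm : 4 ≤ m)
    (hmN : m < N / 3 - 3 * Real.sqrt N) (hw : 95 ≤ Real.sqrt N)
    (hh : 0 < h) (hk₀ : N * k₀ = h * m)
    (hk : h * m ^ 2 = h * m + N * (N - 1) * k) (hI : sI = m * k₀)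
    (hI2 : sI2 = m * k₀ + m * (m - 1) * k) (hZ : sZ = m * (k₀ - k))
    (h1 : m * sZ ≤ 3 * sI2)
    (h2 : (m / 3 - m ^ 2 / N) ^ 2 * sZ ≤ m * (sI2 - 2 * (m ^ 2 / N) * sI + h * (m ^ 2 / N) ^ 2)) :
    False := by
  have hN0 : 0 < N := by linarith
  have hN1 : 0 < N - 1 := by linarith
  set w := Real.sqrt N with hwdef
  have hww : N = w * w := (Real.mul_self_sqrt hN0.le).symm
  have ek₀ : k₀ = h * m / N := by field_simp; linarith
  have ek : k = h * m * (m - 1) / (N * (N - 1)) := by field_simp; linarith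
  have hNm : 0 < N - m := by linarith
  have first : N * (m - 3) ≤ 4 * m ^ 2 - 6 * m := by
    rw [hZ, hI2, ek₀, ek] at h1
    have e1 : m * (m * (h * m / N - h * m * (m - 1) / (N * (N - 1)))) =
        (h * m ^ 2 / (N * (N - 1))) * (m * (N - m)) := by field_simp; ring
    have e2 : 3 * (m * (h * m / N) + m * (m - 1) * (h * m * (m - 1) / (N * (N - 1)))) =
        (h * m ^ 2 / (N * (N - 1))) * (3 * (N - 1) + 3 * (m - 1) ^ 2) := by field_simp
    rw [e1, e2] at h1
    have := le_of_mul_le_mul_left h1 (by positivity)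
    linarith
  have hlow : N ≤ 4 * m + 24 := by
    by_contra! hcon
    have := mul_lt_mul_of_pos_right hcon (show 0 < m - 3 by linarith)
    linarith
  have second : (m / 3 - m ^ 2 / N) ^ 2 ≤ m * (N - m) / N := by
    rw [hZ, hI, hI2, ek₀, ek] at h2
    have e1 : m * (h * m / N - h * m * (m - 1) / (N * (N - 1))) =
        h * m ^ 2 * (N - m) / (N * (N - 1)) := by field_simp; ring
    have e2 : m * (m * (h * m / N) + m * (m - 1) * (h * m * (m - 1) / (N * (N - 1))) -
        2 * (m ^ 2 / N) * (m * (h * m / N)) + h * (m ^ 2 / N) ^ 2) =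
        (m * (N - m) / N) * (h * m ^ 2 * (N - m) / (N * (N - 1))) := by field_simp; ring
    rw [e1, e2] at h2
    exact le_of_mul_le_mul_right h2 (by positivity)
  have e3 : (m / 3 - m ^ 2 / N) ^ 2 = m ^ 2 * (N / 3 - m) ^ 2 / N ^ 2 := by field_simp
  rw [e3, div_le_div_iff₀ (by positivity) hN0] at second
  have h3 : (m * N) * (m * (N / 3 - m) ^ 2) ≤ (m * N) * (N * (N - m)) := by linarith
  have h4 := le_of_mul_le_mul_left h3 (by positivity)
  have h5 : (3 * w) ^ 2 ≤ (N / 3 - m) ^ 2 := pow_le_pow_left₀ (by linarith) (by linarith) 2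
  have h6 : m * (9 * N) ≤ N * (N - m) := by
    refine le_trans ?_ h4
    gcongr
    linarith
  have h7 : m * 9 ≤ N - m := le_of_mul_le_mul_left (by linarith) hN0
  have h8 : 95 * w ≤ w * w := by gcongr
  linarith

/-- A primitive group whose symmetric invariant kernels are constant off the diagonal and which
contains an element of small support contains the alternating group. -/
theorem alternatingGroup_le_of_small_support {H : Subgroup (Equiv.Perm Ω)}
    (hH : MulAction.IsPreprimitive H Ω) (hs : SmallSpectrum H)
    (hw : 95 ≤ Real.sqrt (Fintype.card Ω)) {g : Equiv.Perm Ω} (hg : g ∈ H) (hg1 : g ≠ 1)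
    (hsupp : (g.support.card : ℝ) <
      Fintype.card Ω / 3 - 3 * Real.sqrt (Fintype.card Ω)) :
    alternatingGroup Ω ≤ H := by
  classical
  obtain ⟨x, hx, hmin⟩ := Finset.exists_min_image
    (Finset.univ.filter fun x : Equiv.Perm Ω => x ∈ H ∧ x ≠ 1) (fun x => x.support.card)
    ⟨g, by simp [hg, hg1]⟩
  simp only [Finset.mem_filter, Finset.mem_univ, true_and, and_imp] at hx hmin
  obtain ⟨hxH, hx1⟩ := hx
  set M := x.support with hM
  have h2 : 2 ≤ M.card := Equiv.Perm.two_le_card_support_of_ne_one hx1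
  rcases h2.eq_or_lt with h2 | h3
  · rw [Equiv.Perm.subgroup_eq_top_of_isPreprimitive_of_isSwap_mem hH x
      (Equiv.Perm.card_support_eq_two.1 h2.symm) hxH]
    exact le_top
  rcases (Nat.succ_le_of_lt h3).eq_or_lt with h3 | h4
  · exact Equiv.Perm.alternatingGroup_le_of_isPreprimitive_of_isThreeCycle_mem hH
      (card_support_eq_three_iff.1 h3.symm) hxH
  exfalso
  let ι : Ω → ℝ := fun z => if z ∈ M then 1 else 0
  have hιι : ∀ z, ι z * ι z = ι z := fun z => by simp only [ι]; split_ifs <;> simp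
  have hι0 : ∀ z, 0 ≤ ι z := fun z => by simp only [ι]; split_ifs <;> simp
  have hι1 : ∀ z, ι z ≤ 1 := fun z => by simp only [ι]; split_ifs <;> simp
  have hιsum : ∀ t : H, ∑ z, ι (t.1 z) = M.card := by
    intro t
    rw [Equiv.sum_comp t.1 ι]
    simp [ι]
  let K : Ω → Ω → ℝ := fun u v => ∑ t : H, ι (t.1 u) * ι (t.1 v)
  obtain ⟨k₀, k, hK⟩ := hs.kernel_constant hH hw (K := K)
    (fun u v => Finset.sum_congr rfl fun t _ => mul_comm _ _)
    (fun h hh u v => by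
      refine Fintype.sum_equiv (Equiv.mulRight (⟨h, hh⟩ : H)) _ _ fun t => ?_
      simp)
  have hKd : ∀ u, K u u = k₀ := fun u => (hK u u).1 rfl
  have hKo : ∀ u v, u ≠ v → K u v = k := fun u v => (hK u v).2
  have hKsum : ∀ S : Finset Ω, ∑ u ∈ S, ∑ v ∈ S, K u v = S.card * k₀ + S.card * (S.card - 1) * k := by
    intro S
    have : ∀ u ∈ S, ∑ v ∈ S, K u v = k₀ + (S.card - 1) * k := by
      intro u hu
      rw [← Finset.add_sum_erase _ _ hu, hKd,
        Finset.sum_congr rfl fun v hv => hKo u v (Finset.ne_of_mem_erase hv).symm,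
        Finset.sum_const, Finset.card_erase_of_mem hu, nsmul_eq_mul,
        Nat.cast_sub (Finset.card_pos.2 ⟨u, hu⟩), Nat.cast_one]
    rw [Finset.sum_congr rfl this, Finset.sum_const, nsmul_eq_mul]
    ring
  let I : H → ℝ := fun t => ∑ z ∈ M, ι (t.1 z)
  let Z : H → ℝ := fun t => ∑ z ∈ M, ι (t.1 z) * (1 - ι (t.1 (x z)))
  have hsq : ∀ S : Finset Ω, ∑ t : H, (∑ z ∈ S, ι (t.1 z)) ^ 2 = ∑ u ∈ S, ∑ v ∈ S, K u v := by
    intro S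
    simp_rw [pow_two, Finset.sum_mul_sum, K]
    rw [Finset.sum_comm]
    exact Finset.sum_congr rfl fun u _ => Finset.sum_comm
  have hdiag : ∀ u, ∑ t : H, ι (t.1 u) = k₀ := by
    intro u
    rw [← hKd u]
    exact Finset.sum_congr rfl fun t _ => (hιι _).symm
  have hh : (0 : ℝ) < Fintype.card H := by exact_mod_cast Fintype.card_pos
  have hZle : ∀ t, Z t ≤ I t := fun t => Finset.sum_le_sum fun z _ => by
    nlinarith [hι0 (t.1 z), hι0 (t.1 (x z))]
  have hIle : ∀ t, I t ≤ M.card := fun t => by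
    have := Finset.sum_le_card_nsmul M (fun z => ι (t.1 z)) 1 fun z _ => hι1 _
    simpa using this
  have hZ0 : ∀ t, 0 ≤ Z t := fun t => Finset.sum_nonneg fun z _ =>
    mul_nonneg (hι0 _) (by linarith [hι1 (t.1 (x z))])
  have hI0 : ∀ t, 0 ≤ I t := fun t => Finset.sum_nonneg fun z _ => hι0 _
  have hIZ : ∀ t, Z t ≠ 0 → (M.card : ℝ) ≤ 3 * I t := by
    intro t ht
    obtain ⟨z, hz, hzne⟩ := Finset.exists_ne_zero_of_sum_ne_zero ht
    have hz1 : t.1 z ∈ M := by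
      by_contra h
      simp [ι, h] at hzne
    have hz2 : t.1 (x z) ∉ M := by
      by_contra h
      simp [ι, h] at hzne
    set y : Equiv.Perm Ω := t.1⁻¹ * x * t.1 with hy
    have hyH : y ∈ H := H.mul_mem (H.mul_mem (H.inv_mem t.2) hxH) t.2
    have hysupp : ∀ u, u ∈ y.support ↔ t.1 u ∈ M := by
      intro u
      rw [hM, Equiv.Perm.mem_support, Equiv.Perm.mem_support, hy]
      simp only [Equiv.Perm.mul_apply, ne_eq, Equiv.Perm.inv_eq_iff_eq]
    have hne : x * y * x⁻¹ * y⁻¹ ≠ 1 := by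
      intro h
      rw [mul_inv_eq_one, mul_inv_eq_iff_eq_mul] at h
      have h1 := congrArg (fun p : Equiv.Perm Ω => p z) h
      simp only [Equiv.Perm.mul_apply] at h1
      have h2 : y (x z) = x z := by
        by_contra hc
        exact hz2 ((hysupp _).1 (Equiv.Perm.mem_support.2 hc))
      rw [h2] at h1
      exact Equiv.Perm.mem_support.1 ((hysupp z).2 hz1) (x.injective h1)
    have h1 := hmin _ (H.mul_mem (H.mul_mem (H.mul_mem hxH hyH) (H.inv_mem hxH))
      (H.inv_mem hyH)) hne
    have h2 := h1.trans (card_support_commutator_le x y)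
    have h3 : ((x.support ∩ y.support).card : ℝ) = I t := by
      simp only [I, ι]
      rw [Finset.sum_boole]
      congr 2
      ext u
      simp [hysupp, hM]
    rw [← h3]
    exact_mod_cast h2
  have hN1 : (1 : ℝ) < Fintype.card Ω := by
    by_contra! h
    have := Real.sqrt_le_sqrt h
    rw [Real.sqrt_one] at this
    linarith
  refine minimal_support_numeric (N := Fintype.card Ω) (m := M.card) (h := Fintype.card H)
    (k₀ := k₀) (k := k) (sI := ∑ t, I t) (sI2 := ∑ t, I t ^ 2) (sZ := ∑ t, Z t) hN1
    (by exact_mod_cast h4) (lt_of_le_of_lt ?_ hsupp) hw hh ?_ ?_ ?_ ?_ ?_ ?_ ?_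
  · exact_mod_cast hmin g hg hg1
  · have : ∑ u, ∑ t : H, ι (t.1 u) = Fintype.card Ω * k₀ := by
      rw [Finset.sum_congr rfl fun u _ => hdiag u]
      simp
    rw [← this, Finset.sum_comm, Finset.sum_congr rfl fun t _ => hιsum t]
    simp
  · have e1 := hKsum Finset.univ
    rw [← hsq, Finset.sum_congr rfl fun t _ => by rw [hιsum t]] at e1
    have e2 : ∑ u, ∑ t : H, ι (t.1 u) = Fintype.card Ω * k₀ := by
      rw [Finset.sum_congr rfl fun u _ => hdiag u]
      simp
    rw [Finset.sum_comm, Finset.sum_congr rfl fun t _ => hιsum t] at e2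
    simp only [Finset.sum_const, Finset.card_univ, nsmul_eq_mul] at e1 e2
    linarith
  · simp only [I]
    rw [Finset.sum_comm, Finset.sum_congr rfl fun u _ => hdiag u]
    simp
  · rw [← hKsum, ← hsq]
  · simp only [Z]
    rw [Finset.sum_comm]
    have : ∀ u ∈ M, ∑ t : H, ι (t.1 u) * (1 - ι (t.1 (x u))) = k₀ - k := by
      intro u hu
      have hne : u ≠ x u := (Equiv.Perm.mem_support.1 hu).symm
      simp only [mul_sub, mul_one, Finset.sum_sub_distrib]
      rw [hdiag, ← hKo _ _ hne]
    rw [Finset.sum_congr rfl this, Finset.sum_const, nsmul_eq_mul]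
  · rw [Finset.mul_sum, Finset.mul_sum]
    refine Finset.sum_le_sum fun t _ => ?_
    by_cases hz : Z t = 0
    · rw [hz, mul_zero]; positivity
    · have := hIZ t hz
      nlinarith [hZle t, hI0 t, hZ0 t]
  · have e : ∑ t, I t ^ 2 - 2 * ((M.card : ℝ) ^ 2 / Fintype.card Ω) * ∑ t, I t +
        Fintype.card H * ((M.card : ℝ) ^ 2 / Fintype.card Ω) ^ 2 =
        ∑ t, (I t - (M.card : ℝ) ^ 2 / Fintype.card Ω) ^ 2 := by
      simp only [sub_sq, Finset.sum_add_distrib, Finset.sum_sub_distrib, Finset.sum_const,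
        Finset.card_univ, nsmul_eq_mul, Finset.mul_sum]
      congr 2
      exact Finset.sum_congr rfl fun t _ => by ring
    rw [e, Finset.mul_sum, Finset.mul_sum]
    refine Finset.sum_le_sum fun t _ => ?_
    have hm0 : (0 : ℝ) ≤ M.card := Nat.cast_nonneg _
    by_cases hz : Z t = 0
    · rw [hz, mul_zero]; positivity
    · have h1 := hIZ t hz
      have hmw : (M.card : ℝ) ≤ Fintype.card Ω / 3 := by
        have : (M.card : ℝ) ≤ g.support.card := by exact_mod_cast hmin g hg hg1
        linarith
      have h2 : (0 : ℝ) ≤ M.card / 3 - M.card ^ 2 / Fintype.card Ω := by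
        rw [sub_nonneg, div_le_div_iff₀ (by linarith) (by norm_num)]
        nlinarith
      have h3 : ((M.card : ℝ) / 3 - M.card ^ 2 / Fintype.card Ω) ^ 2 ≤
          (I t - M.card ^ 2 / Fintype.card Ω) ^ 2 := by
        apply pow_le_pow_left₀ h2
        linarith
      rw [mul_comm]
      exact mul_le_mul ((hZle t).trans (hIle t)) h3 (sq_nonneg _) hm0

end Bochert

section Primitive

/-- The common divisor of `a` and `b` is small compared with `a`, `b` and `n`. -/
def LowGcd (n a b : ℕ) : Prop :=
  ((a.gcd b : ℕ) : ℝ) ^ 2 * Real.sqrt n ≤ 4 * a ∧ ((a.gcd b : ℕ) : ℝ) ^ 2 * Real.sqrt n ≤ 4 * b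

theorem LowGcd.symm {n a b : ℕ} (h : LowGcd n a b) : LowGcd n b a := by
  unfold LowGcd at *
  rw [Nat.gcd_comm]
  exact h.symm

theorem LowGcd.gcd_le {n a c : ℕ} (h : LowGcd n a c) (hw : 95 ≤ Real.sqrt n)
    (hc : (n : ℝ) ≤ 3 * c) : ((a.gcd c : ℕ) : ℝ) * Real.sqrt n ≤ 0.44 * c := by
  set w := Real.sqrt n
  have hww : (n : ℝ) = w * w := (Real.mul_self_sqrt (Nat.cast_nonneg _)).symm
  have h1 : 95 * w ≤ w * w := by gcongr
  have h2 : 0 ≤ (c : ℝ) := Nat.cast_nonneg _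
  refine le_of_sq_le_sq ?_ (by positivity)
  calc (((a.gcd c : ℕ) : ℝ) * w) ^ 2 = (((a.gcd c : ℕ) : ℝ) ^ 2 * w) * w := by ring
    _ ≤ (4 * c) * w := mul_le_mul_of_nonneg_right h.2 (by linarith)
    _ ≤ (0.44 * c) ^ 2 := by nlinarith

theorem not_dvd_lcm_of_lowGcd {n a b c : ℕ} (ha : 0 < a) (hab : LowGcd n a b)
    (hac : LowGcd n a c) (hw : 95 ≤ Real.sqrt n) : ¬ a ∣ b.lcm c := by
  intro h
  have h1 : a ∣ b * c := h.trans (Nat.lcm_dvd_mul b c)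
  have h2 : a ∣ a.gcd b * a.gcd c := by
    have := Nat.gcd_mul_right_dvd_mul_gcd a b c
    rwa [Nat.gcd_eq_left h1] at this
  have hpos : 0 < a.gcd b * a.gcd c :=
    Nat.mul_pos (Nat.gcd_pos_of_pos_left _ ha) (Nat.gcd_pos_of_pos_left _ ha)
  have h3 : (a : ℝ) ≤ (a.gcd b : ℕ) * (a.gcd c : ℕ) := by exact_mod_cast Nat.le_of_dvd hpos h2
  set w := Real.sqrt n
  have ha' : (0 : ℝ) < a := by exact_mod_cast ha
  have h4 : (((a.gcd b : ℕ) : ℝ) ^ 2 * w) * (((a.gcd c : ℕ) : ℝ) ^ 2 * w) ≤ (4 * a) * (4 * a) :=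
    mul_le_mul hab.1 hac.1 (by positivity) (by positivity)
  have h5 : (a : ℝ) ^ 2 ≤ (((a.gcd b : ℕ) : ℝ) * (a.gcd c : ℕ)) ^ 2 :=
    pow_le_pow_left₀ ha'.le h3 2
  have h6 : (95 : ℝ) ^ 2 ≤ w ^ 2 := pow_le_pow_left₀ (by norm_num) hw 2
  have h7 : (a : ℝ) ^ 2 * 95 ^ 2 ≤ (((a.gcd b : ℕ) : ℝ) * (a.gcd c : ℕ)) ^ 2 * w ^ 2 := by
    gcongr
  nlinarith [pow_pos ha' 2]

variable {Ω : Type*} [Fintype Ω]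

theorem ThreeCycles.smallSpectrum {H : Subgroup (Equiv.Perm Ω)}
    (hH : MulAction.IsPreprimitive H Ω) {g : Equiv.Perm Ω} (hg : g ∈ H) {A B C : Finset Ω}
    (h : ThreeCycles g A B C) (hw : 95 ≤ Real.sqrt (Fintype.card Ω))
    (hAC : A.card ≤ C.card) (hBC : B.card ≤ C.card) (gAC : LowGcd (Fintype.card Ω) A.card C.card)
    (gBC : LowGcd (Fintype.card Ω) B.card C.card) : SmallSpectrum H := by
  intro R hR
  have hcard : (Fintype.card Ω : ℝ) ≤ 3 * C.card := by
    have := h.card_add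
    exact_mod_cast (by omega : Fintype.card Ω ≤ 3 * C.card)
  have dA := gAC.gcd_le hw hcard
  have dB := gBC.gcd_le hw hcard
  set w := Real.sqrt (Fintype.card Ω) with hwdef
  have hw0 : 0 < w := by linarith
  have hww : (Fintype.card Ω : ℝ) = w * w := (Real.mul_self_sqrt (Nat.cast_nonneg _)).symm
  have hC : (0 : ℝ) < C.card := by exact_mod_cast Finset.card_pos.2 h.right_nonempty
  have h1 := h.finrank_mul_le hH hg hR (q := 1 / w)
    (by have := gAC.1
        rw [mul_one_div, div_mul_eq_mul_div, le_div_iff₀ hw0]; exact this)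
    (by have := gBC.1
        rw [mul_one_div, div_mul_eq_mul_div, le_div_iff₀ hw0]; exact this)
  have h2 : (((A.card.gcd C.card : ℕ) : ℝ) + (B.card.gcd C.card : ℕ)) / (4 * C.card) ≤
      0.22 / w := by
    rw [div_le_div_iff₀ (mul_pos (by norm_num) hC) hw0]
    linarith
  obtain ⟨m, hm⟩ : ∃ m : ℝ, (Module.finrank ℝ R : ℝ) = m := ⟨_, rfl⟩
  rw [hm] at h1 ⊢
  have hm0 : 0 ≤ m := hm ▸ Nat.cast_nonneg _
  have hmN : m ≤ w * w := by
    rw [← hww, ← hm, ← Module.finrank_fintype_fun_eq_card ℝ]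
    exact_mod_cast Submodule.finrank_le R
  have h3 : m * (w * w - m) ≤ 1.22 * (w * w * w) := by
    rw [hww] at h1
    calc m * (w * w - m) ≤ _ := h1
      _ ≤ (w * w) ^ 2 * (1 / w + 0.22 / w) := by gcongr
      _ = 1.22 * (w * w * w) := by field_simp; norm_num
  have key : ∀ t : ℝ, 0 ≤ t → t ≤ w * w / 2 → t * (w * w - t) ≤ 1.22 * (w * w * w) →
      t ≤ 1.2522 * w := by
    intro t ht0 ht h
    have ha : t ≤ 2.44 * w := by
      have : (w * w) * t ≤ (w * w) * (2.44 * w) := by nlinarith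
      exact le_of_mul_le_mul_left this (by positivity)
    have hb : 95 * w ≤ w * w := by gcongr
    have hc : (0.9743 * (w * w)) ≤ w * w - t := by linarith
    have hd : t * (0.9743 * (w * w)) ≤ 1.22 * (w * w * w) :=
      (mul_le_mul_of_nonneg_left hc ht0).trans h
    have he : (w * w) * t ≤ (w * w) * (1.2522 * w) := by
      have : 0 ≤ w * w * w := by positivity
      linarith
    exact le_of_mul_le_mul_left he (by positivity)
  rw [hww]
  rcases le_total m (w * w / 2) with hm2 | hm2
  · exact Or.inl (key m hm0 hm2 h3)
  · exact Or.inr (key (w * w - m) (by linarith) (by linarith) (by linarith))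

variable [DecidableEq Ω]

theorem ThreeCycles.alternatingGroup_le_of_sorted {H : Subgroup (Equiv.Perm Ω)}
    (hH : MulAction.IsPreprimitive H Ω) {g : Equiv.Perm Ω} (hg : g ∈ H) {A B C : Finset Ω}
    (h : ThreeCycles g A B C) (hw : 95 ≤ Real.sqrt (Fintype.card Ω))
    (hAC : A.card ≤ C.card) (hBC : B.card ≤ C.card)
    (gAB : LowGcd (Fintype.card Ω) A.card B.card) (gAC : LowGcd (Fintype.card Ω) A.card C.card)
    (gBC : LowGcd (Fintype.card Ω) B.card C.card)
    (hA : (A.card : ℝ) < Fintype.card Ω / 3 - 3 * Real.sqrt (Fintype.card Ω)) :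
    alternatingGroup Ω ≤ H := by
  have hs := h.smallSpectrum hH hg hw hAC hBC gAC gBC
  have hsub : (g ^ (B.card.lcm C.card)).support ⊆ A := by
    intro x hx
    rw [Equiv.Perm.mem_support] at hx
    rcases h.cover x with hx' | hx' | hx'
    · exact hx'
    · exact absurd ((h.mid.pow_apply_eq hx').2 (Nat.dvd_lcm_left _ _)) hx
    · exact absurd ((h.right.pow_apply_eq hx').2 (Nat.dvd_lcm_right _ _)) hx
  refine alternatingGroup_le_of_small_support hH hs hw (H.pow_mem hg (B.card.lcm C.card)) ?_
    (lt_of_le_of_lt (by exact_mod_cast Finset.card_le_card hsub) hA)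
  intro h1
  obtain ⟨x, hx⟩ := h.left_nonempty
  refine not_dvd_lcm_of_lowGcd (Finset.card_pos.2 h.left_nonempty) gAB gAC hw
    ((h.left.pow_apply_eq hx).1 ?_)
  rw [h1, Equiv.Perm.one_apply]

theorem ThreeCycles.alternatingGroup_le {H : Subgroup (Equiv.Perm Ω)}
    (hH : MulAction.IsPreprimitive H Ω) {g : Equiv.Perm Ω} (hg : g ∈ H) {A B C : Finset Ω}
    (h : ThreeCycles g A B C) (hw : 95 ≤ Real.sqrt (Fintype.card Ω))
    (gAB : LowGcd (Fintype.card Ω) A.card B.card) (gAC : LowGcd (Fintype.card Ω) A.card C.card)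
    (gBC : LowGcd (Fintype.card Ω) B.card C.card)
    (hA : (A.card : ℝ) < Fintype.card Ω / 3 - 3 * Real.sqrt (Fintype.card Ω) ∨
      (B.card : ℝ) < Fintype.card Ω / 3 - 3 * Real.sqrt (Fintype.card Ω) ∨
      (C.card : ℝ) < Fintype.card Ω / 3 - 3 * Real.sqrt (Fintype.card Ω)) :
    alternatingGroup Ω ≤ H := by
  wlog hAB : A.card ≤ B.card generalizing A B C
  · exact this h.swap_left gAB.symm gBC gAC (by tauto) (le_of_not_ge hAB)
  wlog hBC : B.card ≤ C.card generalizing A B C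
  · rcases le_total A.card C.card with hAC | hAC
    · exact this h.swap_right gAC gAB gBC.symm (by tauto) hAC (le_of_not_ge hBC)
    · exact this h.swap_right.swap_left gAC.symm gBC.symm gAB (by tauto) hAC hAB
  refine h.alternatingGroup_le_of_sorted hH hg hw (hAB.trans hBC) hBC gAB gAC gBC ?_
  have h1 : (A.card : ℝ) ≤ B.card := by exact_mod_cast hAB
  have h2 : (B.card : ℝ) ≤ C.card := by exact_mod_cast hBC
  rcases hA with h | h | h <;> linarith

end Primitive

section Classification

open scoped Pointwise

/-- A multiple of `m` is a sum of two of the numbers `a`, `b`, `c`, in the way that a block system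
with blocks of size `m` forces. -/
def BlockSum (m a b c : ℕ) : Prop :=
  ∃ t, (t * m = a + b ∧ t ∣ a) ∨ (t * m = a + c ∧ t ∣ a) ∨ (t * m = b + c ∧ t ∣ b)

variable {Ω : Type*} [Fintype Ω]

omit [Fintype Ω] in
theorem isCycleOn_subset_or_disjoint {g : Equiv.Perm Ω} {A S : Finset Ω} (hA : g.IsCycleOn A)
    (hS : ∀ x, g x ∈ S ↔ x ∈ S) : A ⊆ S ∨ Disjoint A S := by
  by_cases h : Disjoint A S
  · exact Or.inr h
  obtain ⟨x, hxA, hxS⟩ := Finset.not_disjoint_iff.1 h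
  refine Or.inl fun y hy => ?_
  obtain ⟨k, -, rfl⟩ := hA.exists_pow_eq hxA hy
  clear hy
  induction k with
  | zero => simpa using hxS
  | succ k ih => rw [pow_succ', Equiv.Perm.mul_apply, hS]; exact ih

theorem ThreeCycles.card_eq_inter [DecidableEq Ω] {g : Equiv.Perm Ω} {A B C : Finset Ω}
    (h : ThreeCycles g A B C) (S : Finset Ω) :
    S.card = (A ∩ S).card + (B ∩ S).card + (C ∩ S).card := by
  have := h.sum_eq fun x => if x ∈ S then 1 else 0
  simpa [Finset.sum_boole, Finset.filter_mem_eq_inter] using this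

/-- A proper nonempty union of cycles has the size of a cycle or of its complement. -/
theorem ThreeCycles.card_of_invariant {g : Equiv.Perm Ω} {A B C : Finset Ω}
    (h : ThreeCycles g A B C) {S : Finset Ω} (hS : ∀ x, g x ∈ S ↔ x ∈ S) (hne : S.Nonempty)
    (hproper : S.card ≠ Fintype.card Ω) :
    S.card = A.card ∨ S.card = B.card ∨ S.card = C.card ∨ S.card + A.card = Fintype.card Ω ∨
      S.card + B.card = Fintype.card Ω ∨ S.card + C.card = Fintype.card Ω := by
  classical
  have h1 := h.card_eq_inter S
  have h2 := h.card_add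
  have hpos := Finset.card_pos.2 hne
  have key : ∀ {X : Finset Ω}, g.IsCycleOn X → (X ∩ S).card = X.card ∨ (X ∩ S).card = 0 := by
    intro X hX
    rcases isCycleOn_subset_or_disjoint hX hS with h | h
    · left; rw [Finset.inter_eq_left.2 h]
    · right; rw [Finset.disjoint_iff_inter_eq_empty.1 h, Finset.card_empty]
  rcases key h.left with hA | hA <;> rcases key h.mid with hB | hB <;>
    rcases key h.right with hC | hC <;> omega

/-- The union of the translates of a block under a permutation. -/
theorem exists_block_union {H : Subgroup (Equiv.Perm Ω)} {g : Equiv.Perm Ω} (hg : g ∈ H)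
    {D : Set Ω} (hD : MulAction.IsBlock H D) :
    ∃ (t : ℕ) (U : Finset Ω), D ⊆ U ∧ (∀ x, g x ∈ U ↔ x ∈ U) ∧ U.card = t * D.ncard ∧
      ∀ X : Finset Ω, g.IsCycleOn X → ¬ Disjoint X U → t ∣ X.card := by
  classical
  let γ : H := ⟨g, hg⟩
  set t := MulAction.period γ D with ht
  have htpos : 0 < t := MulAction.period_pos_of_orderOf_pos (orderOf_pos γ) D
  have hγ : ∀ (k : ℕ) (x : Ω), (γ ^ k) • x = (g ^ k) x := fun k x => by
    simp [γ, Subgroup.smul_def]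
  have hmem : ∀ (k : ℕ) (x : Ω), (g ^ k) x ∈ (γ ^ k) • D ↔ x ∈ D := fun k x => by
    rw [← hγ, Set.smul_mem_smul_set_iff]
  let U : Finset Ω := (Finset.range t).biUnion fun i => ((γ ^ i) • D).toFinset
  have hU : ∀ x, x ∈ U ↔ ∃ i, i < t ∧ x ∈ (γ ^ i) • D := by
    intro x
    simp only [U, Finset.mem_biUnion, Finset.mem_range, Set.mem_toFinset]
  have hU' : ∀ (i : ℕ) (x : Ω), x ∈ D → (g ^ i) x ∈ U := by
    intro i x hx
    refine (hU _).2 ⟨i % t, Nat.mod_lt _ htpos, ?_⟩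
    rw [ht, MulAction.pow_mod_period_smul, hmem]
    exact hx
  refine ⟨t, U, ?_, ?_, ?_, ?_⟩
  · intro x hx
    simpa using hU' 0 x hx
  · have hfwd : ∀ x ∈ U, g x ∈ U := by
      intro x hx
      obtain ⟨i, -, y, hy, rfl⟩ := (hU x).1 hx
      have := hU' (i + 1) y hy
      rw [pow_succ', Equiv.Perm.mul_apply] at this
      simpa [hγ] using this
    have himg : U.map g.toEmbedding = U :=
      Finset.eq_of_subset_of_card_le (fun x hx => by
        obtain ⟨y, hy, rfl⟩ := Finset.mem_map.1 hx
        exact hfwd y hy) (by simp)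
    intro x
    refine ⟨fun hx => ?_, hfwd x⟩
    rw [← himg, Finset.mem_map] at hx
    obtain ⟨y, hy, hxy⟩ := hx
    rwa [← g.injective hxy]
  · rw [Finset.card_biUnion]
    · rw [Finset.sum_congr rfl (g := fun _ => D.ncard)]
      · simp
      · intro i _
        rw [← Set.ncard_eq_toFinset_card', Set.ncard_smul_set]
    · intro i hi j hj hij
      simp only [Function.onFun, Set.disjoint_toFinset]
      apply hD
      intro heq
      apply hij
      rw [Finset.mem_coe, Finset.mem_range] at hi hj
      wlog hlt : i < j generalizing i j
      · exact (this hj hi hij.symm heq.symm (by omega)).symm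
      exfalso
      have h1 : (γ ^ (j - i)) • D = D := by
        have : γ ^ j = γ ^ i * γ ^ (j - i) := by rw [← pow_add]; congr 1; omega
        rw [this, mul_smul] at heq
        exact (smul_left_cancel _ heq).symm
      rw [MulAction.pow_smul_eq_iff_period_dvd] at h1
      have := Nat.le_of_dvd (by omega) h1
      omega
  · intro X hX hdis
    obtain ⟨x, hxX, hxU⟩ := Finset.not_disjoint_iff.1 hdis
    obtain ⟨i, -, y, hy, rfl⟩ := (hU x).1 hxU
    have hyX : y ∈ X := by
      have : (g ^ i) y ∈ X := by simpa [hγ] using hxX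
      exact (isCycleOn_pow_mem hX i).1 this
    have hfix : (g ^ X.card) y = y := hX.pow_card_apply hyX
    rw [ht, ← MulAction.pow_smul_eq_iff_period_dvd]
    by_contra hne
    have := (MulAction.isBlock_iff_smul_eq_or_disjoint.1 hD (γ ^ X.card)).resolve_left hne
    refine Set.disjoint_left.1 this ?_ hy
    rw [← hfix, hmem]
    exact hy

theorem ThreeCycles.blockSum_of_imprimitive {H : Subgroup (Equiv.Perm Ω)} {g : Equiv.Perm Ω}
    (hg : g ∈ H) {A B C : Finset Ω} (h : ThreeCycles g A B C)
    (hgcd : (A.card.gcd B.card).gcd C.card = 1) (htrans : MulAction.IsPretransitive H Ω)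
    (hprim : ¬ MulAction.IsPreprimitive H Ω) :
    ∃ m, m ∣ Fintype.card Ω ∧ 1 < m ∧ m < Fintype.card Ω ∧ BlockSum m A.card B.card C.card := by
  classical
  have hex : ∃ D : Set Ω, MulAction.IsBlock H D ∧ ¬ MulAction.IsTrivialBlock D := by
    by_contra! hcon
    exact hprim { toIsPretransitive := htrans, isTrivialBlock_of_isBlock := fun {D} hD => hcon D hD }
  obtain ⟨D, hD, hDt⟩ := hex
  rw [MulAction.IsTrivialBlock, not_or] at hDt
  have hDn := Set.not_subsingleton_iff.1 hDt.1
  obtain ⟨o, ho⟩ := hDn.nonempty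
  have hlt : D.ncard < Fintype.card Ω := by
    rw [← Nat.card_eq_fintype_card]
    exact Set.ncard_lt_card hDt.2
  have hgt : 1 < D.ncard := (Set.one_lt_ncard_iff_nontrivial).2 hDn
  have hdvd : D.ncard ∣ Fintype.card Ω := by
    rw [← Nat.card_eq_fintype_card]
    exact hD.ncard_dvd_card ⟨o, ho⟩
  by_contra! hbad
  have hbad' := hbad _ hdvd hgt hlt
  simp only [BlockSum, not_exists, not_or, not_and] at hbad'
  have hadd := h.card_add
  have hU : ∀ x : Ω, ∃ (t : ℕ) (U : Finset Ω), x ∈ U ∧ (∀ y, g y ∈ U ↔ y ∈ U) ∧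
      U.card = t * D.ncard ∧ ∀ X : Finset Ω, g.IsCycleOn X → ¬ Disjoint X U → t ∣ X.card := by
    intro x
    obtain ⟨k, hk⟩ := htrans.exists_smul_eq o x
    obtain ⟨t, U, h1, h2, h3, h4⟩ := exists_block_union hg (hD.translate k)
    refine ⟨t, U, h1 ?_, h2, ?_, h4⟩
    · rw [← hk, Set.smul_mem_smul_set_iff]; exact ho
    · rw [h3, Set.ncard_smul_set]
  have key : ∀ {X : Finset Ω} {U : Finset Ω}, g.IsCycleOn X → (∀ y, g y ∈ U ↔ y ∈ U) →
      ((X ∩ U).card = X.card ∧ X ⊆ U) ∨ ((X ∩ U).card = 0) := by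
    intro X U hX hS
    rcases isCycleOn_subset_or_disjoint hX hS with h | h
    · left; exact ⟨by rw [Finset.inter_eq_left.2 h], h⟩
    · right; rw [Finset.disjoint_iff_inter_eq_empty.1 h, Finset.card_empty]
  have hnd : ∀ {X U : Finset Ω} {x : Ω}, x ∈ X → x ∈ U → ¬ Disjoint X U :=
    fun hx hu hd => Finset.disjoint_left.1 hd hx hu
  have hall : ∀ t : ℕ, t * D.ncard = Fintype.card Ω → t ∣ A.card → t ∣ B.card → t ∣ C.card →
      False := by
    intro t ht h1 h2 h3
    have := Nat.dvd_gcd (Nat.dvd_gcd h1 h2) h3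
    rw [hgcd, Nat.dvd_one] at this
    rw [this, one_mul] at ht
    omega
  have hdiv : D.ncard ∣ A.card ∧ D.ncard ∣ B.card ∧ D.ncard ∣ C.card := by
    obtain ⟨a, ha⟩ := h.left_nonempty
    obtain ⟨b, hb⟩ := h.mid_nonempty
    obtain ⟨c, hc⟩ := h.right_nonempty
    have main : ∀ x, (x = a ∨ x = b ∨ x = c) → ∃ t U, x ∈ U ∧ U.card = t * D.ncard ∧
        (U.card = (A ∩ U).card + (B ∩ U).card + (C ∩ U).card) ∧
        (((A ∩ U).card = A.card ∧ t ∣ A.card) ∨ (A ∩ U).card = 0) ∧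
        (((B ∩ U).card = B.card ∧ t ∣ B.card) ∨ (B ∩ U).card = 0) ∧
        (((C ∩ U).card = C.card ∧ t ∣ C.card) ∨ (C ∩ U).card = 0) := by
      intro x _
      obtain ⟨t, U, h1, h2, h3, h4⟩ := hU x
      exact ⟨t, U, h1, h3, h.card_eq_inter U,
        (key h.left h2).imp_left (fun k => ⟨k.1, h4 A h.left (hnd ha (k.2 ha))⟩),
        (key h.mid h2).imp_left (fun k => ⟨k.1, h4 B h.mid (hnd hb (k.2 hb))⟩),
        (key h.right h2).imp_left (fun k => ⟨k.1, h4 C h.right (hnd hc (k.2 hc))⟩)⟩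
    refine ⟨?_, ?_, ?_⟩
    · obtain ⟨t, U, hxU, h1, h2, h3, h4, h5⟩ := main a (by tauto)
      have h0 : (A ∩ U).card ≠ 0 :=
        (Finset.card_pos.2 ⟨a, Finset.mem_inter.2 ⟨ha, hxU⟩⟩).ne'
      rcases h3 with h3 | h3
      · rcases h4 with h4 | h4 <;> rcases h5 with h5 | h5
        · exact (hall t (by omega) h3.2 h4.2 h5.2).elim
        · exact ((hbad' t).1 (by omega) h3.2).elim
        · exact ((hbad' t).2.1 (by omega) h3.2).elim
        · exact ⟨t, by rw [mul_comm]; omega⟩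
      · exact absurd h3 h0
    · obtain ⟨t, U, hxU, h1, h2, h3, h4, h5⟩ := main b (by tauto)
      have h0 : (B ∩ U).card ≠ 0 :=
        (Finset.card_pos.2 ⟨b, Finset.mem_inter.2 ⟨hb, hxU⟩⟩).ne'
      rcases h4 with h4 | h4
      · rcases h3 with h3 | h3 <;> rcases h5 with h5 | h5
        · exact (hall t (by omega) h3.2 h4.2 h5.2).elim
        · exact ((hbad' t).1 (by omega) h3.2).elim
        · exact ((hbad' t).2.2 (by omega) h4.2).elim
        · exact ⟨t, by rw [mul_comm]; omega⟩
      · exact absurd h4 h0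
    · obtain ⟨t, U, hxU, h1, h2, h3, h4, h5⟩ := main c (by tauto)
      have h0 : (C ∩ U).card ≠ 0 :=
        (Finset.card_pos.2 ⟨c, Finset.mem_inter.2 ⟨hc, hxU⟩⟩).ne'
      rcases h5 with h5 | h5
      · rcases h3 with h3 | h3 <;> rcases h4 with h4 | h4
        · exact (hall t (by omega) h3.2 h4.2 h5.2).elim
        · exact ((hbad' t).2.1 (by omega) h3.2).elim
        · exact ((hbad' t).2.2 (by omega) h4.2).elim
        · exact ⟨t, by rw [mul_comm]; omega⟩
      · exact absurd h5 h0
  have := Nat.dvd_gcd (Nat.dvd_gcd hdiv.1 hdiv.2.1) hdiv.2.2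
  rw [hgcd, Nat.dvd_one] at this
  omega

/-- The size of an orbit of `H`. -/
theorem ThreeCycles.card_orbit {H : Subgroup (Equiv.Perm Ω)} {g : Equiv.Perm Ω}
    (hg : g ∈ H) {A B C : Finset Ω} (h : ThreeCycles g A B C)
    (htrans : ¬ MulAction.IsPretransitive H Ω) (o : Ω) :
    let k := (MulAction.orbit H o).ncard
    k = A.card ∨ k = B.card ∨ k = C.card ∨ k + A.card = Fintype.card Ω ∨
      k + B.card = Fintype.card Ω ∨ k + C.card = Fintype.card Ω := by
  classical
  intro k
  have hk : k = (MulAction.orbit H o).toFinset.card := Set.ncard_eq_toFinset_card' _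
  rw [hk]
  refine h.card_of_invariant ?_ ⟨o, by simp⟩ ?_
  · intro x
    rw [Set.mem_toFinset, Set.mem_toFinset]
    rw [← MulAction.orbit_eq_iff, ← MulAction.orbit_eq_iff,
      show g x = (⟨g, hg⟩ : H) • x from rfl, MulAction.orbit_smul]
  · intro hcard
    rw [Finset.card_eq_iff_eq_univ] at hcard
    apply htrans
    rw [MulAction.isPretransitive_iff_base o]
    intro y
    have : y ∈ (MulAction.orbit H o).toFinset := by simp [hcard]
    simpa [MulAction.mem_orbit_iff] using this

end Classification

section Covering

theorem exists_threeCycles_of_cycleType {Ω : Type*} [Fintype Ω] [DecidableEq Ω]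
    {g : Equiv.Perm Ω} {a b c : ℕ} (hg : g.cycleType = {a, b, c})
    (hsum : a + b + c = Fintype.card Ω) :
    ∃ A B C : Finset Ω, ThreeCycles g A B C ∧ A.card = a ∧ B.card = b ∧ C.card = c := by
  have hnd := g.cycleFactorsFinset.nodup
  rw [Equiv.Perm.cycleType_def, show ({a, b, c} : Multiset ℕ) = a ::ₘ b ::ₘ {c} from rfl,
    ← Multiset.map_eq_cons] at hg
  obtain ⟨f₁, hf₁, h₁, hg⟩ := hg
  rw [← Multiset.map_eq_cons] at hg
  obtain ⟨f₂, hf₂, h₂, hg⟩ := hg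
  obtain ⟨f₃, hf₃, h₃⟩ := Multiset.map_eq_singleton.1 hg
  have hf₃' : f₃ ∈ (g.cycleFactorsFinset.val.erase f₁).erase f₂ := by rw [hf₃]; simp
  rw [(hnd.erase f₁).mem_erase_iff, hnd.mem_erase_iff] at hf₃'
  rw [hnd.mem_erase_iff] at hf₂
  have hdisj : ∀ {u v : Equiv.Perm Ω}, u ∈ g.cycleFactorsFinset.val →
      v ∈ g.cycleFactorsFinset.val → v ≠ u → Disjoint u.support v.support := fun hu hv huv =>
    (g.cycleFactorsFinset_pairwise_disjoint hu hv huv.symm).disjoint_support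
  have hne : ∀ {u : Equiv.Perm Ω}, u ∈ g.cycleFactorsFinset.val → u.support.Nonempty := fun hu =>
    (Equiv.Perm.mem_cycleFactorsFinset_iff.1 hu).1.nonempty_support
  have h12 := hdisj hf₁ hf₂.2 hf₂.1
  have h13 := hdisj hf₁ hf₃'.2.2 hf₃'.2.1
  have h23 := hdisj hf₂.2 hf₃'.2.2 hf₃'.1
  simp only [Function.comp_apply] at h₁ h₂ h₃
  refine ⟨f₁.support, f₂.support, f₃.support,
    ⟨Equiv.Perm.isCycleOn_support_of_mem_cycleFactorsFinset hf₁,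
      Equiv.Perm.isCycleOn_support_of_mem_cycleFactorsFinset hf₂.2,
      Equiv.Perm.isCycleOn_support_of_mem_cycleFactorsFinset hf₃'.2.2, h12, h13, h23,
      hne hf₁, hne hf₂.2, hne hf₃'.2.2, fun x => ?_⟩, h₁, h₂, h₃⟩
  have hcard : (f₁.support ∪ (f₂.support ∪ f₃.support)).card = Fintype.card Ω := by
    rw [Finset.card_union_of_disjoint (Finset.disjoint_union_right.2 ⟨h12, h13⟩),
      Finset.card_union_of_disjoint h23]
    omega
  have := (Finset.card_eq_iff_eq_univ _).1 hcard ▸ Finset.mem_univ x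
  simpa using this

/-- The cycle lengths `a`, `b`, `c` force a group containing such a permutation to be intransitive
or to contain the alternating group. -/
structure GenericParts (n a b c : ℕ) : Prop where
  sum_eq : a + b + c = n
  gcd_eq_one : (a.gcd b).gcd c = 1
  two_le : 2 ≤ a ∧ 2 ≤ b ∧ 2 ≤ c
  lowGcd : LowGcd n a b ∧ LowGcd n a c ∧ LowGcd n b c
  short : (a : ℝ) < n / 3 - 3 * Real.sqrt n ∨ (b : ℝ) < n / 3 - 3 * Real.sqrt n ∨
    (c : ℝ) < n / 3 - 3 * Real.sqrt n
  not_blockSum : ∀ m, m ∣ n → 1 < m → m < n → ¬ BlockSum m a b c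

theorem GenericParts.orbit_size {n a b c : ℕ} (h : GenericParts n a b c)
    (hw : 95 ≤ Real.sqrt n) {H : Subgroup (Equiv.Perm (Fin n))}
    (hH : ¬ alternatingGroup (Fin n) ≤ H) {g : Equiv.Perm (Fin n)} (hg : g ∈ H)
    (hgc : g.cycleType = {a, b, c}) (o : Fin n) :
    let k := (MulAction.orbit H o).ncard
    k = a ∨ k = b ∨ k = c ∨ k + a = n ∨ k + b = n ∨ k + c = n := by
  obtain ⟨A, B, C, h3, rfl, rfl, rfl⟩ :=
    exists_threeCycles_of_cycleType hgc (by rw [Fintype.card_fin]; exact h.sum_eq)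
  by_cases htrans : MulAction.IsPretransitive H (Fin n)
  · exfalso
    by_cases hprim : MulAction.IsPreprimitive H (Fin n)
    · have := h3.alternatingGroup_le hprim hg
      rw [Fintype.card_fin] at this
      exact hH (this hw h.lowGcd.1 h.lowGcd.2.1 h.lowGcd.2.2 h.short)
    · obtain ⟨m, h1, h2, h4, h5⟩ := h3.blockSum_of_imprimitive hg h.gcd_eq_one htrans hprim
      rw [Fintype.card_fin] at h1 h4
      exact h.not_blockSum m h1 h2 h4 h5
  · have := h3.card_orbit hg htrans o
    rwa [Fintype.card_fin] at this

/-- The orbit sizes of the components of a normal covering hit every generic triple of parts. -/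
theorem exists_hitting_set {n s : ℕ} (hw : 95 ≤ Real.sqrt n)
    (H : Fin s → Subgroup (Equiv.Perm (Fin n)))
    (hcov : ∀ g : Equiv.Perm (Fin n), ∀ a b c, g.cycleType = {a, b, c} → a + b + c = n →
      ∃ i, ¬ alternatingGroup (Fin n) ≤ H i ∧ ∃ x, x * g * x⁻¹ ∈ H i) :
    ∃ K : Finset ℕ, K ⊆ Finset.Ioo 0 n ∧ K.card ≤ 2 * s ∧ (∀ x ∈ K, n - x ∈ K) ∧
      ∀ a b c, GenericParts n a b c → a ∈ K ∨ b ∈ K ∨ c ∈ K := by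
  have hn : 0 < n := by
    rcases Nat.eq_zero_or_pos n with rfl | h
    · norm_num at hw
    · exact h
  let o : Fin n := ⟨0, hn⟩
  let k : Fin s → ℕ := fun i => (MulAction.orbit (H i) o).ncard
  let L : Finset ℕ := Finset.univ.image k
  have hL : L.card ≤ s := Finset.card_image_le.trans (by simp)
  refine ⟨(L ∪ L.image (n - ·)) ∩ Finset.Ioo 0 n, Finset.inter_subset_right, ?_, ?_, ?_⟩
  · refine (Finset.card_le_card Finset.inter_subset_left).trans ?_
    have := Finset.card_union_le L (L.image (n - ·))
    have : (L.image (n - ·)).card ≤ L.card := Finset.card_image_le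
    omega
  · intro x hx
    rw [Finset.mem_inter, Finset.mem_union, Finset.mem_image (s := L), Finset.mem_Ioo] at hx ⊢
    obtain ⟨hx | ⟨y, hy, rfl⟩, h1, h2⟩ := hx
    · exact ⟨Or.inr ⟨x, hx, rfl⟩, by omega, by omega⟩
    · refine ⟨Or.inl ?_, by omega, by omega⟩
      rwa [show n - (n - y) = y by omega]
  · intro a b c h
    have hsum := h.sum_eq
    have h2 := h.two_le
    obtain ⟨g, hg⟩ := (Equiv.Perm.exists_with_cycleType_iff (Fin n) (m := {a, b, c})).2 (by
      constructor
      · simp; omega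
      · simp; omega)
    obtain ⟨i, hi, x, hx⟩ := hcov g a b c hg hsum
    have := h.orbit_size hw hi hx (by rw [Equiv.Perm.cycleType_conj, hg]) o
    have hk : k i ∈ L := Finset.mem_image_of_mem _ (Finset.mem_univ _)
    have hmem : ∀ y, 2 ≤ y → y < n → (k i = y ∨ k i + y = n) →
        y ∈ (L ∪ L.image (n - ·)) ∩ Finset.Ioo 0 n := by
      intro y hy hy' hky
      rw [Finset.mem_inter, Finset.mem_union, Finset.mem_image (s := L), Finset.mem_Ioo]
      refine ⟨?_, by omega, by omega⟩
      rcases hky with h | h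
      · exact Or.inl (h ▸ hk)
      · exact Or.inr ⟨k i, hk, by omega⟩
    change k i = a ∨ k i = b ∨ k i = c ∨ k i + a = n ∨ k i + b = n ∨ k i + c = n at this
    have ha := hmem a (by omega) (by omega)
    have hb := hmem b (by omega) (by omega)
    have hc := hmem c (by omega) (by omega)
    tauto

theorem sign_eq_of_cycleType_three {n : ℕ} {g : Equiv.Perm (Fin n)} {a b c : ℕ}
    (hg : g.cycleType = {a, b, c}) (hsum : a + b + c = n) :
    Equiv.Perm.sign g = (-1) ^ (n + 3) := by
  rw [Equiv.Perm.sign_of_cycleType, hg]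
  simp [← hsum, add_assoc]

theorem normalCoveringNumber_spec {G : Type*} [Group G] [Finite G] (hG : ¬ IsCyclic G) :
    ∃ H : Fin (normalCoveringNumber G) → Subgroup G, (∀ i, H i ≠ ⊤) ∧
      ∀ g : G, ∃ i, ∃ x : G, x * g * x⁻¹ ∈ H i := by
  refine Nat.sInf_mem (s := {s : ℕ | ∃ H : Fin s → Subgroup G, (∀ i, H i ≠ ⊤) ∧
    ∀ g : G, ∃ i : Fin s, ∃ x : G, x * g * x⁻¹ ∈ H i}) ?_
  have := Fintype.ofFinite G
  let e := Fintype.equivFin G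
  refine ⟨Fintype.card G, fun i => Subgroup.zpowers (e.symm i), fun i hi => hG ?_, fun g => ?_⟩
  · exact ⟨e.symm i, fun x => (Subgroup.eq_top_iff' _).1 hi x⟩
  · exact ⟨e g, 1, by simp⟩

theorem three_lt_of_sqrt {n : ℕ} (hw : 95 ≤ Real.sqrt n) : 3 < n := by
  by_contra! h
  have : Real.sqrt n ≤ Real.sqrt (2 ^ 2) :=
    Real.sqrt_le_sqrt (by norm_num; exact_mod_cast (by omega : n ≤ 4))
  rw [Real.sqrt_sq (by norm_num)] at this
  linarith

theorem not_isCyclic_alternatingGroup_fin {n : ℕ} (hn : 3 < n) :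
    ¬ IsCyclic (alternatingGroup (Fin n)) := by
  rw [alternatingGroup.isCyclic_iff_card_le_three, Nat.card_eq_fintype_card, Fintype.card_fin]
  omega

theorem exists_hitting_set_perm {n : ℕ} (hn : Even n) (hw : 95 ≤ Real.sqrt n) :
    ∃ K : Finset ℕ, K ⊆ Finset.Ioo 0 n ∧
      K.card ≤ 2 * normalCoveringNumber (Equiv.Perm (Fin n)) ∧ (∀ x ∈ K, n - x ∈ K) ∧
      ∀ a b c, GenericParts n a b c → a ∈ K ∨ b ∈ K ∨ c ∈ K := by
  obtain ⟨H, hH, hcov⟩ := normalCoveringNumber_spec (G := Equiv.Perm (Fin n)) fun h =>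
    not_isCyclic_alternatingGroup_fin (three_lt_of_sqrt hw) inferInstance
  refine exists_hitting_set hw H fun g a b c hg hsum => ?_
  obtain ⟨i, x, hx⟩ := hcov g
  refine ⟨i, fun hle => hH i ?_, x, hx⟩
  have hsign : Equiv.Perm.sign (x * g * x⁻¹) = -1 := by
    have := sign_eq_of_cycleType_three hg hsum
    rw [(hn.add_odd (by decide : Odd 3)).neg_one_pow] at this
    simp [this, mul_comm]
  rw [eq_top_iff]
  intro y _
  rcases Int.units_eq_one_or (Equiv.Perm.sign y) with h | h
  · exact hle (Equiv.Perm.mem_alternatingGroup.2 h)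
  · have : y * (x * g * x⁻¹)⁻¹ ∈ H i := hle (Equiv.Perm.mem_alternatingGroup.2 (by
      rw [Equiv.Perm.sign_mul, Equiv.Perm.sign_inv, hsign, h]; rfl))
    exact (Subgroup.mul_mem_cancel_right _ ((H i).inv_mem hx)).1 this

theorem exists_hitting_set_alternatingGroup {n : ℕ} (hn : Odd n) (hw : 95 ≤ Real.sqrt n) :
    ∃ K : Finset ℕ, K ⊆ Finset.Ioo 0 n ∧
      K.card ≤ 2 * normalCoveringNumber (alternatingGroup (Fin n)) ∧ (∀ x ∈ K, n - x ∈ K) ∧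
      ∀ a b c, GenericParts n a b c → a ∈ K ∨ b ∈ K ∨ c ∈ K := by
  obtain ⟨H, hH, hcov⟩ := normalCoveringNumber_spec (G := alternatingGroup (Fin n))
    (not_isCyclic_alternatingGroup_fin (three_lt_of_sqrt hw))
  refine exists_hitting_set hw (fun i => (H i).map (alternatingGroup (Fin n)).subtype)
    fun g a b c hg hsum => ?_
  have hsign : Equiv.Perm.sign g = 1 := by
    rw [sign_eq_of_cycleType_three hg hsum, (hn.add_odd (by decide : Odd 3)).neg_one_pow]
  obtain ⟨i, x, hx⟩ := hcov ⟨g, Equiv.Perm.mem_alternatingGroup.2 hsign⟩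
  refine ⟨i, fun hle => hH i ?_, x, ?_⟩
  · rw [eq_top_iff]
    intro y _
    obtain ⟨z, hz, hzy⟩ := Subgroup.mem_map.1 (hle y.2)
    rwa [← Subtype.ext hzy]
  · exact Subgroup.mem_map.2 ⟨_, hx, by simp⟩

end Covering

section EulerFactor

/-- The Euler factors of `ζ(2)⁻¹` at finitely many primes multiply to at least `6 / π²`. -/
theorem six_div_pi_sq_le_prod (n : ℕ) :
    6 / Real.pi ^ 2 ≤ ∏ p ∈ n.primeFactors, (1 - 1 / (p : ℝ) ^ 2) := by
  let f : ℕ →* ℝ :=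
    { toFun := fun m => 1 / (m : ℝ) ^ 2
      map_one' := by simp
      map_mul' := fun a b => by push_cast; ring }
  have hf : ∀ m, f m = 1 / (m : ℝ) ^ 2 := fun _ => rfl
  have hlt : ∀ {p : ℕ}, p.Prime → f p < 1 := fun {p} hp => by
    rw [hf, div_lt_one (by have := hp.pos; positivity)]
    exact one_lt_pow₀ (by exact_mod_cast hp.one_lt) two_ne_zero
  have hnn : ∀ m, 0 ≤ f m := fun m => by rw [hf]; positivity
  have hsum := (EulerProduct.summable_and_hasSum_factoredNumbers_prod_filter_prime_geometric
    (f := f) (fun {p} hp => by rw [Real.norm_of_nonneg (hnn p)]; exact hlt hp) n.primeFactors).2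
  have hz : HasSum f (Real.pi ^ 2 / 6) := by
    convert hasSum_zeta_two using 1
    exact funext hf
  have hle : ∏ p ∈ n.primeFactors, (1 - f p)⁻¹ ≤ Real.pi ^ 2 / 6 := by
    rw [Finset.filter_true_of_mem fun p hp => Nat.prime_of_mem_primeFactors hp] at hsum
    exact hasSum_le_inj _ Subtype.val_injective (fun c _ => hnn c) (fun _ => le_rfl) hsum hz
  rw [Finset.prod_inv_distrib] at hle
  have hpos : 0 < ∏ p ∈ n.primeFactors, (1 - f p) :=
    Finset.prod_pos fun p hp => sub_pos.2 (hlt (Nat.prime_of_mem_primeFactors hp))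
  simp only [← hf]
  have := (inv_le_inv₀ (by positivity) (inv_pos.2 hpos)).2 hle
  rwa [inv_inv, inv_div] at this

theorem prod_le_one (n : ℕ) : ∏ p ∈ n.primeFactors, (1 - 1 / (p : ℝ) ^ 2) ≤ 1 := by
  refine Finset.prod_le_one (fun p hp => ?_) fun p _ => sub_le_self _ (by positivity)
  rw [sub_nonneg]
  have := (Nat.prime_of_mem_primeFactors hp).one_le
  exact div_le_one_of_le₀ (one_le_pow₀ (by exact_mod_cast this)) (by positivity)

theorem zeta2_le (n : ℕ) : zeta2 n ≤ 1 / 12 := by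
  have := prod_le_one n
  unfold zeta2
  linarith

theorem le_zeta2 (n : ℕ) : 1 / (2 * Real.pi ^ 2) ≤ zeta2 n := by
  have := six_div_pi_sq_le_prod n
  unfold zeta2
  calc 1 / (2 * Real.pi ^ 2) = 1 / 12 * (6 / Real.pi ^ 2) := by field_simp; norm_num
    _ ≤ _ := by gcongr

end EulerFactor

section PrimitivePairs

open Finset

theorem card_pairs_coprime (n : ℕ) (S : Finset ℕ) :
    ∀ D : ℕ, 0 < D → (∀ p ∈ S, p.Prime) → (∀ p ∈ S, ¬ p ∣ D) → D * ∏ p ∈ S, p ∣ n →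
      (#{z ∈ Ioc 0 n ×ˢ Ioc 0 n | (D ∣ z.1 ∧ D ∣ z.2) ∧ ∀ p ∈ S, ¬ (p ∣ z.1 ∧ p ∣ z.2)} : ℝ) =
        (n / D) ^ 2 * ∏ p ∈ S, (1 - 1 / (p : ℝ) ^ 2) := by
  induction S using Finset.induction_on with
  | empty =>
    intro D hD _ _ hdvd
    simp only [prod_empty, mul_one] at hdvd ⊢
    simp only [notMem_empty, IsEmpty.forall_iff, implies_true, and_true]
    rw [filter_product, card_product, Nat.Ioc_filter_dvd_card_eq_div]
    push_cast [Nat.cast_div hdvd (by positivity : (D : ℝ) ≠ 0)]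
    ring
  | insert q S hq ih =>
    intro D hD hprime hD' hdvd
    rw [prod_insert hq] at hdvd ⊢
    have hqp := hprime q (mem_insert_self _ _)
    have hcop : Nat.Coprime D q := ((Nat.Prime.coprime_iff_not_dvd hqp).2
      (hD' q (mem_insert_self _ _))).symm
    have hS : ∀ p ∈ S, p.Prime := fun p hp => hprime p (mem_insert_of_mem hp)
    have h1 := ih D hD hS (fun p hp => hD' p (mem_insert_of_mem hp))
      ((Dvd.intro_left q (by ring)).trans hdvd)
    have h2 := ih (D * q) (Nat.mul_pos hD hqp.pos) hS (fun p hp h => by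
      rcases (hS p hp).dvd_mul.1 h with h | h
      · exact hD' p (mem_insert_of_mem hp) h
      · rw [Nat.prime_dvd_prime_iff_eq (hS p hp) hqp] at h
        exact hq (h ▸ hp)) (by rwa [mul_assoc])
    have hsplit := card_filter_add_card_filter_not (s := {z ∈ Ioc 0 n ×ˢ Ioc 0 n |
      (D ∣ z.1 ∧ D ∣ z.2) ∧ ∀ p ∈ S, ¬ (p ∣ z.1 ∧ p ∣ z.2)}) (fun z => q ∣ z.1 ∧ q ∣ z.2)
    rw [filter_filter, filter_filter] at hsplit
    have e1 : ∀ z : ℕ × ℕ, (((D ∣ z.1 ∧ D ∣ z.2) ∧ ∀ p ∈ S, ¬ (p ∣ z.1 ∧ p ∣ z.2)) ∧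
        (q ∣ z.1 ∧ q ∣ z.2)) ↔
        ((D * q ∣ z.1 ∧ D * q ∣ z.2) ∧ ∀ p ∈ S, ¬ (p ∣ z.1 ∧ p ∣ z.2)) := by
      intro z
      have hmul : ∀ x, D * q ∣ x ↔ D ∣ x ∧ q ∣ x := fun x =>
        ⟨fun h => ⟨dvd_of_mul_right_dvd h, dvd_of_mul_left_dvd h⟩,
          fun h => hcop.mul_dvd_of_dvd_of_dvd h.1 h.2⟩
      rw [hmul, hmul]
      tauto
    have e2 : ∀ z : ℕ × ℕ, (((D ∣ z.1 ∧ D ∣ z.2) ∧ ∀ p ∈ S, ¬ (p ∣ z.1 ∧ p ∣ z.2)) ∧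
        ¬ (q ∣ z.1 ∧ q ∣ z.2)) ↔
        ((D ∣ z.1 ∧ D ∣ z.2) ∧ ∀ p ∈ insert q S, ¬ (p ∣ z.1 ∧ p ∣ z.2)) := by
      intro z
      rw [forall_mem_insert]
      tauto
    rw [filter_congr fun z _ => e1 z, filter_congr fun z _ => e2 z] at hsplit
    have hsplit' := congrArg (Nat.cast : ℕ → ℝ) hsplit
    rw [Nat.cast_add, h1, h2] at hsplit'
    have hq0 : (q : ℝ) ≠ 0 := by exact_mod_cast hqp.ne_zero
    have hD0 : (D : ℝ) ≠ 0 := by positivity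
    rw [← sub_eq_iff_eq_add'.2 hsplit'.symm]
    push_cast
    field_simp

/-- The pairs of positive integers of sum less than `n`, that is, the compositions of `n` into three
parts. -/
def triangle (n : ℕ) : Finset (ℕ × ℕ) :=
  {z ∈ Ioo 0 n ×ˢ Ioo 0 n | z.1 + z.2 < n}

theorem mem_triangle {n : ℕ} {z : ℕ × ℕ} :
    z ∈ triangle n ↔ 0 < z.1 ∧ 0 < z.2 ∧ z.1 + z.2 < n := by
  simp only [triangle, mem_filter, mem_product, mem_Ioo]
  omega

theorem le_card_primitive_triangle {n : ℕ} (hn : 0 < n) :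
    6 * zeta2 n * n ^ 2 - 1.5 * n ≤
      #{z ∈ triangle n | ∀ p ∈ n.primeFactors, ¬ (p ∣ z.1 ∧ p ∣ z.2)} := by
  set P : ℕ × ℕ → Prop := fun z => ∀ p ∈ n.primeFactors, ¬ (p ∣ z.1 ∧ p ∣ z.2) with hP
  have hJ := card_pairs_coprime n n.primeFactors 1 one_pos
    (fun p hp => Nat.prime_of_mem_primeFactors hp)
    (fun p hp h => (Nat.prime_of_mem_primeFactors hp).one_lt.ne' (Nat.dvd_one.1 h))
    (by rw [one_mul]; exact Nat.prod_primeFactors_dvd n)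
  simp only [one_dvd, and_self, true_and, Nat.cast_one, div_one] at hJ
  set T := {z ∈ triangle n | P z} with hT
  have hsub : {z ∈ Ioc 0 n ×ˢ Ioc 0 n | P z} ⊆ T ∪ T.image (fun z => (n - z.1, n - z.2)) ∪
      ((Ioc 0 n).image (fun x => (x, n)) ∪ (Ioc 0 n).image (fun y => (n, y)) ∪
        (Ioc 0 n).image (fun x => (x, n - x))) := by
    rintro ⟨x, y⟩ hz
    simp only [mem_filter, mem_product, mem_Ioc] at hz
    obtain ⟨⟨⟨h1, h2⟩, h3, h4⟩, h5⟩ := hz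
    simp only [mem_union, mem_image, hT, mem_filter, mem_triangle, Prod.mk.injEq, mem_Ioc,
      Prod.exists]
    rcases h2.eq_or_lt with rfl | h2
    · exact Or.inr (Or.inl (Or.inr ⟨y, ⟨h3, h4⟩, rfl, rfl⟩))
    rcases h4.eq_or_lt with rfl | h4
    · exact Or.inr (Or.inl (Or.inl ⟨x, ⟨h1, h2.le⟩, rfl, rfl⟩))
    rcases lt_trichotomy (x + y) n with h | h | h
    · exact Or.inl (Or.inl ⟨⟨h1, h3, h⟩, h5⟩)
    · exact Or.inr (Or.inr ⟨x, ⟨h1, h2.le⟩, rfl, by omega⟩)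
    · refine Or.inl (Or.inr ⟨n - x, n - y, ⟨⟨by omega, by omega, by omega⟩, ?_⟩, by omega,
        by omega⟩)
      intro p hp hpd
      have hpn := Nat.dvd_of_mem_primeFactors hp
      exact h5 p hp ⟨(Nat.dvd_sub_iff_right h2.le hpn).1 hpd.1,
        (Nat.dvd_sub_iff_right h4.le hpn).1 hpd.2⟩
  have hcard : ∀ f : ℕ → ℕ × ℕ, #((Ioc 0 n).image f) ≤ n := fun f =>
    card_image_le.trans (by simp)
  have h6 := (card_le_card hsub).trans (card_union_le _ _)
  have h7 := card_union_le T (T.image (fun z => (n - z.1, n - z.2)))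
  have h8 : #(T.image (fun z => (n - z.1, n - z.2))) ≤ #T := card_image_le
  have h9 := card_union_le ((Ioc 0 n).image (fun x => (x, n)) ∪ (Ioc 0 n).image (fun y => (n, y)))
    ((Ioc 0 n).image (fun x => (x, n - x)))
  have h10 := card_union_le ((Ioc 0 n).image (fun x => (x, n)))
    ((Ioc 0 n).image (fun y => (n, y)))
  have h11 := hcard (fun x => (x, n))
  have h12 := hcard (fun y => (n, y))
  have h13 := hcard (fun x => (x, n - x))
  have h14 : #{z ∈ Ioc 0 n ×ˢ Ioc 0 n | P z} ≤ 2 * #T + 3 * n := by omega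
  have h15 : (#{z ∈ Ioc 0 n ×ˢ Ioc 0 n | P z} : ℝ) ≤ 2 * #T + 3 * n := by exact_mod_cast h14
  rw [hJ] at h15
  unfold zeta2
  linarith

end PrimitivePairs

section Hits

open Finset

theorem two_mul_card_lt_pairs (K : Finset ℕ) :
    2 * #{z ∈ K ×ˢ K | z.1 < z.2} + #K = #K ^ 2 := by
  have h1 : #{z ∈ K ×ˢ K | z.2 < z.1} = #{z ∈ K ×ˢ K | z.1 < z.2} := by
    refine card_nbij' Prod.swap Prod.swap ?_ ?_ (fun _ _ => rfl) (fun _ _ => rfl) <;>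
    · intro z hz
      simp only [coe_filter, mem_product, Set.mem_ofPred_eq, Prod.fst_swap, Prod.snd_swap] at hz ⊢
      tauto
  have h2 : #{z ∈ K ×ˢ K | z.1 = z.2} = #K := by
    rw [← diag_eq_filter, diag_card]
  have h3 := card_filter_add_card_filter_not (s := K ×ˢ K) (fun z => z.1 < z.2)
  have h4 := card_filter_add_card_filter_not (s := {z ∈ K ×ˢ K | ¬ z.1 < z.2}) (fun z => z.1 = z.2)
  have h5 : ∀ z ∈ K ×ˢ K, (¬ z.1 < z.2 ∧ z.1 = z.2) ↔ z.1 = z.2 := fun z _ => by omega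
  have h6 : ∀ z ∈ K ×ˢ K, (¬ z.1 < z.2 ∧ ¬ z.1 = z.2) ↔ z.2 < z.1 := fun z _ => by omega
  rw [filter_filter, filter_filter, filter_congr h5, filter_congr h6, h1, h2] at h4
  rw [card_product] at h3
  rw [sq]
  omega

theorem two_mul_card_triangle_fst {n : ℕ} {K : Finset ℕ} (hK : K ⊆ Ioo 0 n)
    (hsymm : ∀ x ∈ K, n - x ∈ K) :
    2 * #{z ∈ triangle n | z.1 ∈ K} + 2 * #K = #K * n := by
  have h1 : #{z ∈ triangle n | z.1 ∈ K} = ∑ x ∈ K, (n - x - 1) := by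
    rw [card_eq_sum_card_fiberwise (f := Prod.fst) (t := K) (by
      intro z hz
      exact (mem_filter.1 hz).2)]
    refine sum_congr rfl fun x hx => ?_
    have hx' := mem_Ioo.1 (hK hx)
    rw [show n - x - 1 = #(Ioo 0 (n - x)) by simp]
    refine card_nbij' Prod.snd (fun y => (x, y)) ?_ ?_ ?_ ?_
    · rintro ⟨a, b⟩ hz
      simp only [coe_filter, mem_filter, mem_triangle, Set.mem_ofPred_eq] at hz
      simp only [coe_Ioo, Set.mem_Ioo]
      omega
    · intro y hy
      simp only [coe_Ioo, Set.mem_Ioo] at hy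
      simp only [coe_filter, mem_filter, mem_triangle, Set.mem_ofPred_eq]
      exact ⟨⟨by omega, hx⟩, trivial⟩
    · rintro ⟨a, b⟩ hz
      simp only [coe_filter, mem_filter, mem_triangle, Set.mem_ofPred_eq] at hz
      rw [hz.2]
    · intro y _
      rfl
  have h2 : ∑ x ∈ K, (n - x - 1) = ∑ x ∈ K, (x - 1) := by
    refine sum_nbij' (n - ·) (n - ·) hsymm hsymm ?_ ?_ (fun x _ => rfl) <;>
    · intro x hx
      have := mem_Ioo.1 (hK hx)
      omega
  have h3 : ∑ x ∈ K, (n - x - 1) + ∑ x ∈ K, (x - 1) + 2 * #K = #K * n := by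
    rw [← sum_add_distrib, mul_comm 2, ← smul_eq_mul, ← sum_const, ← sum_add_distrib,
      ← smul_eq_mul, ← sum_const]
    refine sum_congr rfl fun x hx => ?_
    have := mem_Ioo.1 (hK hx)
    omega
  omega

/-- Permuting the parts of a composition. -/
theorem card_triangle_rotate {n : ℕ} (P : ℕ → ℕ → ℕ → Prop)
    [DecidablePred fun z : ℕ × ℕ => P z.1 z.2 (n - z.1 - z.2)]
    [DecidablePred fun z : ℕ × ℕ => P (n - z.1 - z.2) z.1 z.2] :
    #{z ∈ triangle n | P (n - z.1 - z.2) z.1 z.2} =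
      #{z ∈ triangle n | P z.1 z.2 (n - z.1 - z.2)} := by
  refine card_nbij' (fun z => (n - z.1 - z.2, z.1)) (fun z => (z.2, n - z.1 - z.2)) ?_ ?_ ?_ ?_
  · rintro ⟨x, y⟩ hz
    simp only [coe_filter, mem_triangle, Set.mem_ofPred_eq] at hz ⊢
    obtain ⟨⟨h1, h2, h3⟩, h4⟩ := hz
    rw [show n - (n - x - y) - x = y by omega]
    exact ⟨by omega, h4⟩
  · rintro ⟨x, y⟩ hz
    simp only [coe_filter, mem_triangle, Set.mem_ofPred_eq] at hz ⊢
    obtain ⟨⟨h1, h2, h3⟩, h4⟩ := hz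
    rw [show n - y - (n - x - y) = x by omega]
    exact ⟨by omega, h4⟩
  · rintro ⟨x, y⟩ hz
    have := mem_triangle.1 (mem_filter.1 (mem_coe.1 hz)).1
    refine Prod.ext rfl ?_
    dsimp only at *
    omega
  · rintro ⟨x, y⟩ hz
    have := mem_triangle.1 (mem_filter.1 (mem_coe.1 hz)).1
    refine Prod.ext ?_ rfl
    dsimp only at *
    omega

theorem card_triangle_swap {n : ℕ} (P : ℕ → ℕ → ℕ → Prop)
    [DecidablePred fun z : ℕ × ℕ => P z.1 z.2 (n - z.1 - z.2)]
    [DecidablePred fun z : ℕ × ℕ => P z.2 z.1 (n - z.1 - z.2)] :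
    #{z ∈ triangle n | P z.2 z.1 (n - z.1 - z.2)} =
      #{z ∈ triangle n | P z.1 z.2 (n - z.1 - z.2)} := by
  refine card_nbij' Prod.swap Prod.swap ?_ ?_ (fun _ _ => rfl) (fun _ _ => rfl) <;>
  · rintro ⟨x, y⟩ hz
    simp only [coe_filter, mem_triangle, Set.mem_ofPred_eq, Prod.swap_prod_mk] at hz ⊢
    obtain ⟨⟨h1, h2, h3⟩, h4⟩ := hz
    rw [show n - y - x = n - x - y by omega]
    exact ⟨by omega, h4⟩

/-- Upper bound for the number of compositions with a part in a symmetric set. -/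
theorem two_mul_card_hits_le {n : ℕ} {K : Finset ℕ} (hK : K ⊆ Ioo 0 n)
    (hsymm : ∀ x ∈ K, n - x ∈ K) :
    2 * #{z ∈ triangle n | z.1 ∈ K ∨ z.2 ∈ K ∨ n - z.1 - z.2 ∈ K} + 2 * #K ^ 2 ≤
      3 * (#K * n) := by
  set X := {z ∈ triangle n | z.1 ∈ K} with hX
  set Y := {z ∈ triangle n | z.2 ∈ K} with hY
  set Z := {z ∈ triangle n | n - z.1 - z.2 ∈ K} with hZ
  have hXc : 2 * #X + 2 * #K = #K * n := two_mul_card_triangle_fst hK hsymm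
  have hYX : #Y = #X := card_triangle_swap (n := n) fun a _ _ => a ∈ K
  have hZX : #Z = #X := card_triangle_rotate (n := n) fun a _ _ => a ∈ K
  have hpairs := two_mul_card_lt_pairs K
  have hXY : #{z ∈ K ×ˢ K | z.1 < z.2} ≤ #(Y ∩ X) := by
    refine card_le_card_of_injOn (fun z => (z.1, n - z.2)) ?_ ?_
    · rintro ⟨x, y⟩ hz
      simp only [coe_filter, mem_product, Set.mem_ofPred_eq] at hz
      have h1 := mem_Ioo.1 (hK hz.1.1)
      have h2 := mem_Ioo.1 (hK hz.1.2)
      simp only [hX, hY, coe_inter, coe_filter, mem_triangle, Set.mem_inter_iff, Set.mem_ofPred_eq]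
      exact ⟨⟨by omega, hsymm _ hz.1.2⟩, by omega, hz.1.1⟩
    · rintro ⟨x, y⟩ hz ⟨x', y'⟩ hz' h
      simp only [coe_filter, mem_product, Set.mem_ofPred_eq] at hz hz'
      have h1 := mem_Ioo.1 (hK hz.1.2)
      have h2 := mem_Ioo.1 (hK hz'.1.2)
      simp only [Prod.mk.injEq] at h ⊢
      omega
  have hXZ : #{z ∈ K ×ˢ K | z.1 < z.2} ≤ #(Z ∩ X) := by
    refine card_le_card_of_injOn (fun z => (z.1, z.2 - z.1)) ?_ ?_
    · rintro ⟨x, y⟩ hz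
      simp only [coe_filter, mem_product, Set.mem_ofPred_eq] at hz
      have h1 := mem_Ioo.1 (hK hz.1.1)
      have h2 := mem_Ioo.1 (hK hz.1.2)
      simp only [hX, hZ, coe_inter, coe_filter, mem_triangle, Set.mem_inter_iff, Set.mem_ofPred_eq]
      refine ⟨⟨by omega, ?_⟩, by omega, hz.1.1⟩
      rw [show n - x - (y - x) = n - y by omega]
      exact hsymm _ hz.1.2
    · rintro ⟨x, y⟩ hz ⟨x', y'⟩ hz' h
      simp only [coe_filter, mem_product, Set.mem_ofPred_eq] at hz hz'
      simp only [Prod.mk.injEq] at h ⊢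
      omega
  have hsub : {z ∈ triangle n | z.1 ∈ K ∨ z.2 ∈ K ∨ n - z.1 - z.2 ∈ K} ⊆
      X ∪ (Y \ X) ∪ (Z \ X) := by
    intro z hz
    simp only [mem_filter, mem_union, mem_sdiff, hX, hY, hZ] at hz ⊢
    tauto
  have h1 := (card_le_card hsub).trans (card_union_le _ _)
  have h2 := card_union_le X (Y \ X)
  have h3 := card_sdiff_add_card_inter Y X
  have h4 := card_sdiff_add_card_inter Z X
  omega

end Hits

section Exceptional

open Finset

open scoped Classical in
theorem card_triangle_pairs_le {n : ℕ} (Q : ℕ → ℕ → Prop) :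
    #{z ∈ triangle n | Q z.1 z.2 ∨ Q z.1 (n - z.1 - z.2) ∨ Q z.2 (n - z.1 - z.2)} ≤
      3 * #{z ∈ triangle n | Q z.1 z.2} := by
  have h1 : #{z ∈ triangle n | Q z.1 z.2} = #{z ∈ triangle n | Q z.2 (n - z.1 - z.2)} :=
    card_triangle_rotate (n := n) fun _ b c => Q b c
  have h2 : #{z ∈ triangle n | Q z.1 (n - z.1 - z.2)} =
      #{z ∈ triangle n | Q z.2 (n - z.1 - z.2)} :=
    card_triangle_swap (n := n) fun _ b c => Q b c
  rw [filter_or, filter_or]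
  have h3 := card_union_le {z ∈ triangle n | Q z.1 z.2}
    ({z ∈ triangle n | Q z.1 (n - z.1 - z.2)} ∪ {z ∈ triangle n | Q z.2 (n - z.1 - z.2)})
  have h4 := card_union_le {z ∈ triangle n | Q z.1 (n - z.1 - z.2)}
    {z ∈ triangle n | Q z.2 (n - z.1 - z.2)}
  omega

theorem card_divisors_le_two_mul_sqrt {n : ℕ} : #n.divisors ≤ 2 * Nat.sqrt n := by
  have hsub : n.divisors ⊆ Ioc 0 (Nat.sqrt n) ∪ (Ioc 0 (Nat.sqrt n)).image (n / ·) := by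
    intro d hd
    obtain ⟨⟨e, he⟩, hn⟩ := Nat.mem_divisors.1 hd
    have hd0 : 0 < d := Nat.pos_of_mem_divisors hd
    have he0 : 0 < e := Nat.pos_of_ne_zero fun h => hn (by rw [he, h, mul_zero])
    rw [mem_union, mem_image, mem_Ioc]
    by_cases h : d ≤ Nat.sqrt n
    · exact Or.inl ⟨hd0, h⟩
    · refine Or.inr ⟨e, mem_Ioc.2 ⟨he0, ?_⟩, by rw [he]; exact Nat.mul_div_cancel _ he0⟩
      by_contra! h'
      have h1 := Nat.sqrt_lt'.1 (not_le.1 h)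
      have h2 := Nat.sqrt_lt'.1 h'
      have h3 : n * n < d ^ 2 * e ^ 2 := Nat.mul_lt_mul_of_lt_of_lt h1 h2
      have h4 : d ^ 2 * e ^ 2 = n * n := by rw [he]; ring
      omega
  have h1 := (card_le_card hsub).trans (card_union_le _ _)
  have h2 : #((Ioc 0 (Nat.sqrt n)).image (n / ·)) ≤ #(Ioc 0 (Nat.sqrt n)) := card_image_le
  rw [Nat.card_Ioc] at h1 h2
  omega

open scoped Classical in
theorem card_blockSum_le (n : ℕ) :
    #{z ∈ triangle n | ∃ m, m ∣ n ∧ 1 < m ∧ m < n ∧ BlockSum m z.1 z.2 (n - z.1 - z.2)} ≤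
      6 * (n * Nat.sqrt n) := by
  obtain ⟨Q, hQ⟩ : ∃ Q : ℕ → ℕ → Prop,
    ∀ x y, Q x y ↔ ∃ m ∈ n.divisors, ∃ t, t * m = x + y ∧ t ∣ x := ⟨_, fun _ _ => Iff.rfl⟩
  have h1 : #{z ∈ triangle n | Q z.1 z.2} ≤ 2 * (n * Nat.sqrt n) := by
    have hsub : {z ∈ triangle n | Q z.1 z.2} ⊆ n.divisors.biUnion fun m =>
        (Ioc 0 (n / m) ×ˢ range m).image fun w => (w.1 * w.2, w.1 * (m - w.2)) := by
      rintro ⟨x, y⟩ hz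
      rw [mem_filter, hQ] at hz
      obtain ⟨hz, m, hm, t, ht, j, rfl⟩ := hz
      obtain ⟨h1, h2, h3⟩ := mem_triangle.1 hz
      dsimp only at *
      have hm0 := Nat.pos_of_mem_divisors hm
      have ht0 : 0 < t := Nat.pos_of_mul_pos_right h1
      have hjm : j < m := by
        have : t * j < t * m := by omega
        exact Nat.lt_of_mul_lt_mul_left this
      refine mem_biUnion.2 ⟨m, hm, mem_image.2 ⟨(t, j), ?_, ?_⟩⟩
      · rw [mem_product, mem_Ioc, mem_range]
        refine ⟨⟨ht0, ?_⟩, hjm⟩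
        rw [Nat.le_div_iff_mul_le hm0]
        dsimp only
        omega
      · rw [Nat.mul_sub]
        refine Prod.ext rfl ?_
        dsimp only
        omega
    refine (card_le_card hsub).trans (card_biUnion_le.trans ?_)
    calc _ ≤ ∑ _m ∈ n.divisors, n := by
          refine sum_le_sum fun m _ => card_image_le.trans ?_
          rw [card_product, Nat.card_Ioc, card_range, Nat.sub_zero]
          exact Nat.div_mul_le_self n m
      _ ≤ _ := by
          rw [sum_const, smul_eq_mul]
          calc _ ≤ 2 * Nat.sqrt n * n := Nat.mul_le_mul_right _ card_divisors_le_two_mul_sqrt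
            _ = _ := by ring
  have h2 : {z ∈ triangle n | ∃ m, m ∣ n ∧ 1 < m ∧ m < n ∧
      BlockSum m z.1 z.2 (n - z.1 - z.2)} ⊆
      {z ∈ triangle n | Q z.1 z.2 ∨ Q z.1 (n - z.1 - z.2) ∨ Q z.2 (n - z.1 - z.2)} := by
    intro z hz
    obtain ⟨hz, m, hm, -, hmn, t, ht⟩ := mem_filter.1 hz
    have hm' := Nat.mem_divisors.2 ⟨hm, by omega⟩
    refine mem_filter.2 ⟨hz, ?_⟩
    rcases ht with ht | ht | ht
    · exact Or.inl ((hQ _ _).2 ⟨m, hm', t, ht⟩)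
    · exact Or.inr (Or.inl ((hQ _ _).2 ⟨m, hm', t, ht⟩))
    · exact Or.inr (Or.inr ((hQ _ _).2 ⟨m, hm', t, ht⟩))
  have h3 := card_le_card h2
  have h4 := card_triangle_pairs_le (n := n) Q
  omega

open scoped Classical in
theorem card_balanced_le {n : ℕ} (hw : 95 ≤ Real.sqrt n) :
    (#{z ∈ triangle n | (n : ℝ) / 3 - 3 * Real.sqrt n ≤ z.1 ∧
      (n : ℝ) / 3 - 3 * Real.sqrt n ≤ z.2 ∧
      (n : ℝ) / 3 - 3 * Real.sqrt n ≤ (n - z.1 - z.2 : ℕ)} : ℝ) ≤ 100 * n := by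
  set w := Real.sqrt n with hwdef
  have hww : (n : ℝ) = w * w := (Real.mul_self_sqrt (Nat.cast_nonneg _)).symm
  set I := Icc ⌈(n : ℝ) / 3 - 3 * w⌉₊ ⌊(n : ℝ) / 3 + 6 * w⌋₊ with hI
  have hIcard : (#I : ℝ) ≤ 10 * w := by
    have h1 : ⌈(n : ℝ) / 3 - 3 * w⌉₊ ≤ ⌊(n : ℝ) / 3 + 6 * w⌋₊ + 1 := by
      rw [Nat.ceil_le]
      push_cast
      have := Nat.lt_floor_add_one ((n : ℝ) / 3 + 6 * w)
      linarith
    have h2 := Nat.le_ceil ((n : ℝ) / 3 - 3 * w)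
    have h3 := Nat.floor_le (show 0 ≤ (n : ℝ) / 3 + 6 * w by
      have : (0 : ℝ) ≤ n := Nat.cast_nonneg n
      linarith only [this, hw])
    rw [hI, Nat.card_Icc, Nat.cast_sub h1]
    push_cast
    linarith
  have hsub : {z ∈ triangle n | (n : ℝ) / 3 - 3 * w ≤ z.1 ∧ (n : ℝ) / 3 - 3 * w ≤ z.2 ∧
      (n : ℝ) / 3 - 3 * w ≤ (n - z.1 - z.2 : ℕ)} ⊆ I ×ˢ I := by
    intro z hz
    obtain ⟨hz, h1, h2, h3⟩ := mem_filter.1 hz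
    have hz' := mem_triangle.1 hz
    have h4 : (z.1 : ℝ) + z.2 + (n - z.1 - z.2 : ℕ) = n := by
      exact_mod_cast (by omega : z.1 + z.2 + (n - z.1 - z.2) = n)
    rw [mem_product, mem_Icc, mem_Icc, Nat.ceil_le, Nat.ceil_le]
    have h5 : (z.1 : ℝ) ≤ n / 3 + 6 * w := by linarith only [h2, h3, h4]
    have h6 : (z.2 : ℝ) ≤ n / 3 + 6 * w := by linarith only [h1, h3, h4]
    exact ⟨⟨h1, Nat.le_floor h5⟩, h2, Nat.le_floor h6⟩
  have h1 : (#(I ×ˢ I) : ℝ) ≤ 100 * n := by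
    rw [card_product, Nat.cast_mul]
    calc (#I : ℝ) * #I ≤ (10 * w) * (10 * w) := mul_self_le_mul_self (Nat.cast_nonneg _) hIcard
      _ = 100 * (w * w) := by ring
      _ = _ := by rw [← hww]
  exact le_trans (by exact_mod_cast card_le_card hsub) h1

end Exceptional

section GcdCount

open Finset

theorem sum_range_odd (M h : ℕ) :
    ∑ a ∈ Ioc 0 h, ((M : ℝ) + 1 - 2 * a) = h * (M - h) := by
  induction h with
  | zero => simp
  | succ h ih =>
    rw [sum_Ioc_succ_top (Nat.zero_le h), ih]
    push_cast
    ring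

open scoped Classical in
theorem card_gcd_fiber_le_sq (n d : ℕ) (hd : 0 < d) :
    (#{z ∈ triangle n | z.1 ≤ z.2 ∧ z.1.gcd z.2 = d} : ℝ) ≤ ((n : ℝ) / d) ^ 2 / 4 := by
  set M := n / d with hM
  set h := M / 2 with hh
  have h1 : #{z ∈ triangle n | z.1 ≤ z.2 ∧ z.1.gcd z.2 = d} ≤
      #((Ioc 0 h).sigma fun a => Icc a (M - a)) := by
    refine card_le_card_of_injOn (fun z => ⟨z.1 / d, z.2 / d⟩) ?_ ?_
    · rintro ⟨x, y⟩ hz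
      obtain ⟨hz, hle, hg⟩ := mem_filter.1 (mem_coe.1 hz)
      obtain ⟨h1, h2, h3⟩ := mem_triangle.1 hz
      dsimp only at *
      obtain ⟨a, rfl⟩ : d ∣ x := hg ▸ Nat.gcd_dvd_left x y
      obtain ⟨b, rfl⟩ : d ∣ y := hg ▸ Nat.gcd_dvd_right _ y
      rw [Nat.mul_div_cancel_left _ hd, Nat.mul_div_cancel_left _ hd]
      have hab : a ≤ b := Nat.le_of_mul_le_mul_left hle hd
      have ha : 0 < a := Nat.pos_of_mul_pos_left h1
      have hsum : a + b ≤ M := by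
        rw [hM, Nat.le_div_iff_mul_le hd, mul_comm, mul_add]
        omega
      rw [mem_coe, mem_sigma, mem_Ioc, mem_Icc]
      dsimp only
      omega
    · rintro ⟨x, y⟩ hz ⟨x', y'⟩ hz' heq
      obtain ⟨-, -, hg⟩ := mem_filter.1 (mem_coe.1 hz)
      obtain ⟨-, -, hg'⟩ := mem_filter.1 (mem_coe.1 hz')
      dsimp only at *
      obtain ⟨a, rfl⟩ : d ∣ x := hg ▸ Nat.gcd_dvd_left x y
      obtain ⟨b, rfl⟩ : d ∣ y := hg ▸ Nat.gcd_dvd_right _ y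
      obtain ⟨a', rfl⟩ : d ∣ x' := hg' ▸ Nat.gcd_dvd_left x' y'
      obtain ⟨b', rfl⟩ : d ∣ y' := hg' ▸ Nat.gcd_dvd_right _ y'
      simp only [Nat.mul_div_cancel_left _ hd, Sigma.mk.injEq, heq_eq_eq] at heq
      rw [heq.1, heq.2]
  have h2 : (#((Ioc 0 h).sigma fun a => Icc a (M - a)) : ℝ) = h * (M - h) := by
    rw [card_sigma, ← sum_range_odd, Nat.cast_sum]
    refine sum_congr rfl fun a ha => ?_
    rw [mem_Ioc] at ha
    rw [Nat.card_Icc, show M - a + 1 - a = M + 1 - 2 * a by omega, Nat.cast_sub (by omega)]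
    push_cast
    ring
  have h3 : (M : ℝ) ≤ n / d := Nat.cast_div_le
  calc _ ≤ (#((Ioc 0 h).sigma fun a => Icc a (M - a)) : ℝ) := by exact_mod_cast h1
    _ ≤ (M : ℝ) ^ 2 / 4 := by rw [h2]; nlinarith [sq_nonneg ((M : ℝ) - 2 * h)]
    _ ≤ _ := by gcongr

open scoped Classical in
theorem card_gcd_fiber_le (n d : ℕ) (hd : 0 < d) {w : ℝ} (hw : 0 ≤ w) :
    (#{z ∈ triangle n | (z.1.gcd z.2 = d) ∧ 4 * (z.1 : ℝ) < (d : ℝ) ^ 2 * w} : ℝ) ≤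
      w * n / 4 := by
  set M := n / d with hM
  set h := ⌊(d : ℝ) * w / 4⌋₊ with hh
  have hd' : (0 : ℝ) < d := by exact_mod_cast hd
  have h1 : #{z ∈ triangle n | (z.1.gcd z.2 = d) ∧ 4 * (z.1 : ℝ) < (d : ℝ) ^ 2 * w} ≤
      #((Ioc 0 h) ×ˢ Ioc 0 M) := by
    refine card_le_card_of_injOn (fun z => (z.1 / d, z.2 / d)) ?_ ?_
    · rintro ⟨x, y⟩ hz
      obtain ⟨hz, hg, hlt⟩ := mem_filter.1 (mem_coe.1 hz)
      obtain ⟨h1, h2, h3⟩ := mem_triangle.1 hz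
      dsimp only at *
      obtain ⟨a, rfl⟩ : d ∣ x := hg ▸ Nat.gcd_dvd_left x y
      obtain ⟨b, rfl⟩ : d ∣ y := hg ▸ Nat.gcd_dvd_right _ y
      rw [Nat.mul_div_cancel_left _ hd, Nat.mul_div_cancel_left _ hd]
      rw [mem_coe, mem_product, mem_Ioc, mem_Ioc]
      refine ⟨⟨Nat.pos_of_mul_pos_left h1, Nat.le_floor ?_⟩, Nat.pos_of_mul_pos_left h2, ?_⟩
      · push_cast at hlt
        have : (d : ℝ) * (4 * a) < d * (d * w) := by linarith
        have := lt_of_mul_lt_mul_left this hd'.le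
        linarith
      · rw [hM, Nat.le_div_iff_mul_le hd, mul_comm]
        dsimp only
        omega
    · rintro ⟨x, y⟩ hz ⟨x', y'⟩ hz' heq
      obtain ⟨-, hg, -⟩ := mem_filter.1 (mem_coe.1 hz)
      obtain ⟨-, hg', -⟩ := mem_filter.1 (mem_coe.1 hz')
      dsimp only at *
      obtain ⟨a, rfl⟩ : d ∣ x := hg ▸ Nat.gcd_dvd_left x y
      obtain ⟨b, rfl⟩ : d ∣ y := hg ▸ Nat.gcd_dvd_right _ y
      obtain ⟨a', rfl⟩ : d ∣ x' := hg' ▸ Nat.gcd_dvd_left x' y'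
      obtain ⟨b', rfl⟩ : d ∣ y' := hg' ▸ Nat.gcd_dvd_right _ y'
      simp only [Nat.mul_div_cancel_left _ hd, Prod.mk.injEq] at heq
      rw [heq.1, heq.2]
  have h3 : (M : ℝ) ≤ n / d := Nat.cast_div_le
  have h4 : (h : ℝ) ≤ d * w / 4 := Nat.floor_le (by positivity)
  calc _ ≤ (#((Ioc 0 h) ×ˢ Ioc 0 M) : ℝ) := by exact_mod_cast h1
    _ = (h : ℝ) * M := by
      rw [card_product, Nat.card_Ioc, Nat.card_Ioc, Nat.sub_zero, Nat.sub_zero, Nat.cast_mul]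
    _ ≤ (d * w / 4) * (n / d) := mul_le_mul h4 h3 (Nat.cast_nonneg _) (by positivity)
    _ = _ := by field_simp

open scoped Classical in
theorem card_large_gcd_le (n k : ℕ) (hk : 0 < k) {w : ℝ} (hw : 0 ≤ w) :
    (#{z ∈ triangle n | z.1 ≤ z.2 ∧ 4 * (z.1 : ℝ) < ((z.1.gcd z.2 : ℕ) : ℝ) ^ 2 * w} : ℝ) ≤
      k * (w * n / 4) + (n : ℝ) ^ 2 / (4 * k) := by
  set B := {z ∈ triangle n | z.1 ≤ z.2 ∧ 4 * (z.1 : ℝ) < ((z.1.gcd z.2 : ℕ) : ℝ) ^ 2 * w} with hB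
  have hsub : B ⊆ ((Ioc 0 k).biUnion fun d =>
        {z ∈ triangle n | (z.1.gcd z.2 = d) ∧ 4 * (z.1 : ℝ) < (d : ℝ) ^ 2 * w}) ∪
      (Ioc k (max k n)).biUnion fun d => {z ∈ triangle n | z.1 ≤ z.2 ∧ z.1.gcd z.2 = d} := by
    intro z hz
    obtain ⟨hz, h1, h2⟩ := mem_filter.1 hz
    obtain ⟨h3, h4, h5⟩ := mem_triangle.1 hz
    have hg := Nat.gcd_pos_of_pos_left z.2 h3
    have hg' := Nat.le_of_dvd h3 (Nat.gcd_dvd_left z.1 z.2)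
    rw [mem_union, mem_biUnion, mem_biUnion]
    by_cases h : z.1.gcd z.2 ≤ k
    · exact Or.inl ⟨_, mem_Ioc.2 ⟨hg, h⟩, mem_filter.2 ⟨hz, rfl, h2⟩⟩
    · exact Or.inr ⟨_, mem_Ioc.2 ⟨not_le.1 h, le_max_of_le_right (by omega)⟩,
        mem_filter.2 ⟨hz, h1, rfl⟩⟩
  have h1 := (card_le_card hsub).trans ((card_union_le _ _).trans
    (add_le_add card_biUnion_le card_biUnion_le))
  have h2 : (#B : ℝ) ≤ _ := Nat.cast_le.2 h1
  rw [Nat.cast_add, Nat.cast_sum, Nat.cast_sum] at h2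
  refine h2.trans (add_le_add ?_ ?_)
  · refine (sum_le_sum fun d hd => card_gcd_fiber_le n d (mem_Ioc.1 hd).1 hw).trans ?_
    rw [sum_const, Nat.card_Ioc, Nat.sub_zero, nsmul_eq_mul]
  · refine (sum_le_sum fun d hd => card_gcd_fiber_le_sq n d
      (hk.trans (mem_Ioc.1 hd).1)).trans ?_
    have h3 : ∑ i ∈ Ioc k (max k n), ((i : ℝ) ^ 2)⁻¹ ≤ (k : ℝ)⁻¹ :=
      (sum_Ioc_inv_sq_le_sub hk.ne' (le_max_left _ _)).trans (sub_le_self _ (by positivity))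
    calc _ = (n : ℝ) ^ 2 / 4 * ∑ i ∈ Ioc k (max k n), ((i : ℝ) ^ 2)⁻¹ := by
          rw [mul_sum]
          refine sum_congr rfl fun d _ => ?_
          rw [div_pow, div_eq_mul_inv ((n : ℝ) ^ 2)]
          ring
      _ ≤ (n : ℝ) ^ 2 / 4 * (k : ℝ)⁻¹ := by gcongr
      _ = _ := by rw [← div_eq_mul_inv, div_div]

open scoped Classical in
/-- The number of compositions with two parts whose common divisor is large. -/
theorem card_not_lowGcd_le {n : ℕ} {v : ℝ} (hv : 0 < v) (hvn : v ^ 2 = Real.sqrt n) :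
    (#{z ∈ triangle n | ¬ LowGcd n z.1 z.2 ∨ ¬ LowGcd n z.1 (n - z.1 - z.2) ∨
      ¬ LowGcd n z.2 (n - z.1 - z.2)} : ℝ) ≤ 6 * ((n : ℝ) ^ 2 / 4 * (2 / v + 1 / v ^ 2)) := by
  have h1 : #{z ∈ triangle n | ¬ LowGcd n z.1 z.2 ∨ ¬ LowGcd n z.1 (n - z.1 - z.2) ∨
      ¬ LowGcd n z.2 (n - z.1 - z.2)} ≤ 3 * #{z ∈ triangle n | ¬ LowGcd n z.1 z.2} := by
    convert card_triangle_pairs_le (n := n) fun x y => ¬ LowGcd n x y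
  set B := {z ∈ triangle n |
    z.1 ≤ z.2 ∧ 4 * (z.1 : ℝ) < ((z.1.gcd z.2 : ℕ) : ℝ) ^ 2 * Real.sqrt n} with hB
  have hsub : {z ∈ triangle n | ¬ LowGcd n z.1 z.2} ⊆ B ∪ B.image Prod.swap := by
    rintro ⟨x, y⟩ hz
    obtain ⟨hz, hl⟩ := mem_filter.1 hz
    obtain ⟨h3, h4, h5⟩ := mem_triangle.1 hz
    rw [LowGcd, not_and_or, not_le, not_le] at hl
    dsimp only at *
    rw [mem_union, mem_image]
    rcases le_total x y with hxy | hxy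
    · refine Or.inl (mem_filter.2 ⟨hz, hxy, ?_⟩)
      have : (x : ℝ) ≤ y := by exact_mod_cast hxy
      dsimp only
      rcases hl with h | h <;> linarith
    · refine Or.inr ⟨(y, x), mem_filter.2 ⟨mem_triangle.2 ⟨h4, h3, ?_⟩, hxy, ?_⟩, rfl⟩
      · dsimp only
        omega
      have : (y : ℝ) ≤ x := by exact_mod_cast hxy
      dsimp only
      rw [Nat.gcd_comm]
      rcases hl with h | h <;> linarith
  have h2 := (card_le_card hsub).trans (card_union_le _ _)
  have h3 : #(B.image Prod.swap) ≤ #B := card_image_le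
  have h4 : #{z ∈ triangle n | ¬ LowGcd n z.1 z.2 ∨ ¬ LowGcd n z.1 (n - z.1 - z.2) ∨
      ¬ LowGcd n z.2 (n - z.1 - z.2)} ≤ 6 * #B := by omega
  have hk : 0 < ⌈v⌉₊ := Nat.ceil_pos.2 hv
  have h5 : (#B : ℝ) ≤ _ := card_large_gcd_le n ⌈v⌉₊ hk (Real.sqrt_nonneg n)
  have h6 : ((⌈v⌉₊ : ℕ) : ℝ) ≤ v + 1 := (Nat.ceil_lt_add_one hv.le).le
  have h7 : v ≤ ((⌈v⌉₊ : ℕ) : ℝ) := Nat.le_ceil v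
  have hn : (n : ℝ) = v ^ 2 * v ^ 2 := by
    rw [hvn, Real.mul_self_sqrt (Nat.cast_nonneg n)]
  have h8 : (#B : ℝ) ≤ (n : ℝ) ^ 2 / 4 * (2 / v + 1 / v ^ 2) := by
    refine h5.trans ?_
    calc _ ≤ (v + 1) * (Real.sqrt n * n / 4) + (n : ℝ) ^ 2 / (4 * v) := by gcongr
      _ = _ := by
        rw [← hvn, hn]
        field_simp
        ring
  calc _ ≤ ((6 * #B : ℕ) : ℝ) := Nat.cast_le.2 h4
    _ = 6 * (#B : ℝ) := by push_cast; rfl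
    _ ≤ _ := by gcongr

end GcdCount

section Main

open Finset

open scoped Classical in
/-- A symmetric set that meets every generic composition is large. -/
theorem primitive_count_le_of_hitting {n s : ℕ} {v : ℝ} (hw : 95 ≤ Real.sqrt n) (hv : 0 < v)
    (hvn : v ^ 2 = Real.sqrt n) (hs : 2 * s ≤ n) {K : Finset ℕ} (hK : K ⊆ Ioo 0 n)
    (hcard : #K ≤ 2 * s) (hsymm : ∀ x ∈ K, n - x ∈ K)
    (hit : ∀ a b c, GenericParts n a b c → a ∈ K ∨ b ∈ K ∨ c ∈ K) :
    6 * zeta2 n * n ^ 2 - 1.5 * n ≤ 3 * s * n - 3 * s ^ 2 +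
      6 * ((n : ℝ) ^ 2 / 4 * (2 / v + 1 / v ^ 2)) + 100 * n + 6 * (n * Real.sqrt n) := by
  have hn : 0 < n := by have := three_lt_of_sqrt hw; omega
  set F := {z ∈ triangle n | ∀ p ∈ n.primeFactors, ¬ (p ∣ z.1 ∧ p ∣ z.2)} with hF
  set E₁ := {z ∈ triangle n | z.1 ∈ K ∨ z.2 ∈ K ∨ n - z.1 - z.2 ∈ K} with hE₁
  set E₂ := {z ∈ triangle n | ¬ LowGcd n z.1 z.2 ∨ ¬ LowGcd n z.1 (n - z.1 - z.2) ∨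
    ¬ LowGcd n z.2 (n - z.1 - z.2)} with hE₂
  set E₃ := {z ∈ triangle n | (n : ℝ) / 3 - 3 * Real.sqrt n ≤ z.1 ∧
      (n : ℝ) / 3 - 3 * Real.sqrt n ≤ z.2 ∧
      (n : ℝ) / 3 - 3 * Real.sqrt n ≤ (n - z.1 - z.2 : ℕ)} with hE₃
  set E₄ := {z ∈ triangle n | ∃ m, m ∣ n ∧ 1 < m ∧ m < n ∧ BlockSum m z.1 z.2 (n - z.1 - z.2)}
    with hE₄
  have hsub : F ⊆ E₁ ∪ E₂ ∪ (E₃ ∪ E₄) := by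
    intro z hz
    obtain ⟨hz, hP⟩ := mem_filter.1 hz
    obtain ⟨h1, h2, h3⟩ := mem_triangle.1 hz
    by_contra hcon
    simp only [mem_union, not_or] at hcon
    obtain ⟨⟨c1, c2⟩, c3, c4⟩ := hcon
    rw [hE₂, mem_filter] at c2
    rw [hE₃, mem_filter] at c3
    rw [hE₄, mem_filter] at c4
    have hlow : LowGcd n z.1 z.2 ∧ LowGcd n z.1 (n - z.1 - z.2) ∧
        LowGcd n z.2 (n - z.1 - z.2) := by
      by_contra hl
      exact c2 ⟨hz, by tauto⟩
    have htwo : ∀ {x y : ℕ}, 0 < x → LowGcd n x y → 2 ≤ x ∧ (0 < y → 2 ≤ y) := by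
      intro x y hx hxy
      have hg : (1 : ℝ) ≤ ((x.gcd y : ℕ) : ℝ) := by
        exact_mod_cast Nat.gcd_pos_of_pos_left y hx
      have hg2 : Real.sqrt n ≤ ((x.gcd y : ℕ) : ℝ) ^ 2 * Real.sqrt n :=
        le_mul_of_one_le_left (Real.sqrt_nonneg n) (one_le_pow₀ hg)
      have hx' : (2 : ℝ) ≤ x := by linarith [hxy.1]
      have hy' : (2 : ℝ) ≤ y := by linarith [hxy.2]
      exact ⟨by exact_mod_cast hx', fun _ => by exact_mod_cast hy'⟩
    refine c1 (mem_filter.2 ⟨hz, hit _ _ _ ⟨by omega, ?_, ?_, hlow, ?_, ?_⟩⟩)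
    · rw [Nat.eq_one_iff_not_exists_prime_dvd]
      intro p hp hpd
      have hd1 := hpd.trans ((Nat.gcd_dvd_left _ _).trans (Nat.gcd_dvd_left _ _))
      have hd2 := hpd.trans ((Nat.gcd_dvd_left _ _).trans (Nat.gcd_dvd_right _ _))
      have hd3 := hpd.trans (Nat.gcd_dvd_right _ _)
      refine hP p (Nat.mem_primeFactors.2 ⟨hp, ?_, hn.ne'⟩) ⟨hd1, hd2⟩
      rw [show n = z.1 + z.2 + (n - z.1 - z.2) by omega]
      exact dvd_add (dvd_add hd1 hd2) hd3
    · exact ⟨(htwo h1 hlow.1).1, (htwo h2 hlow.2.2).1, (htwo h1 hlow.2.1).2 (by omega)⟩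
    · by_contra! hl
      exact c3 ⟨hz, hl⟩
    · intro m hm1 hm2 hm3 hm4
      exact c4 ⟨hz, m, hm1, hm2, hm3, hm4⟩
  have hFle := le_card_primitive_triangle hn
  have h1 : 2 * #E₁ + 2 * #K ^ 2 ≤ 3 * (#K * n) := two_mul_card_hits_le hK hsymm
  have h2 : (#E₂ : ℝ) ≤ _ := card_not_lowGcd_le hv hvn
  have h3 : (#E₃ : ℝ) ≤ _ := card_balanced_le hw
  have h4 : #E₄ ≤ 6 * (n * Nat.sqrt n) := card_blockSum_le n
  have h5 : #F ≤ #E₁ + #E₂ + (#E₃ + #E₄) :=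
    (card_le_card hsub).trans ((card_union_le _ _).trans
      (add_le_add (card_union_le _ _) (card_union_le _ _)))
  have h1' : 2 * (#E₁ : ℝ) + 2 * (#K : ℝ) ^ 2 ≤ 3 * (#K * n) := by exact_mod_cast h1
  have h4' : (#E₄ : ℝ) ≤ 6 * (n * Real.sqrt n) := by
    have : (#E₄ : ℝ) ≤ 6 * (n * (Nat.sqrt n : ℝ)) := by exact_mod_cast h4
    refine this.trans ?_
    gcongr
    exact Real.nat_sqrt_le_real_sqrt
  have h5' : (#F : ℝ) ≤ #E₁ + #E₂ + (#E₃ + #E₄) := by exact_mod_cast h5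
  have hs' : 2 * (s : ℝ) ≤ n := by exact_mod_cast hs
  have hcard' : (#K : ℝ) ≤ 2 * s := by exact_mod_cast hcard
  have hE₁' : (#E₁ : ℝ) ≤ 3 * s * n - 3 * s ^ 2 := by
    have hK0 : (0 : ℝ) ≤ #K := Nat.cast_nonneg _
    nlinarith [mul_nonneg (sub_nonneg.2 hcard') (sub_nonneg.2 hs'),
      mul_nonneg (sub_nonneg.2 hcard') (sub_nonneg.2 hcard'), mul_nonneg hK0 hK0]
  linarith

theorem count_lt_of_lt {v t z s : ℝ} (hv : 0 < v) (ht : t = Real.sqrt (1 - 8 * z))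
    (hz : z ≤ 1 / 12) (hs0 : 0 ≤ s)
    (hs : s < v ^ 4 / 2 * (1 - t) - Real.sqrt 17 / 2 * v ^ 3) :
    95 ≤ v ^ 2 ∧ 2 * s ≤ v ^ 4 ∧ 3 * s * v ^ 4 - 3 * s ^ 2 +
      6 * ((v ^ 4) ^ 2 / 4 * (2 / v + 1 / v ^ 2)) + 100 * v ^ 4 + 6 * (v ^ 4 * v ^ 2) <
        6 * z * (v ^ 4) ^ 2 - 1.5 * v ^ 4 := by
  set q := Real.sqrt 17 with hq
  have hq2 : q ^ 2 = 17 := Real.sq_sqrt (by norm_num)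
  have hq1 : 4.1231 ≤ q := Real.le_sqrt_of_sq_le (by norm_num)
  have ht2 : t ^ 2 = 1 - 8 * z := by rw [ht]; exact Real.sq_sqrt (by linarith)
  have ht1 : 0.57734 ≤ t := by rw [ht]; exact Real.le_sqrt_of_sq_le (by linarith)
  have hv3 : 0 < v ^ 3 := by positivity
  have hvq : q < v * (1 - t) := by
    have : 0 < v ^ 3 * (v * (1 - t) - q) := by linarith
    linarith [(mul_pos_iff_of_pos_left hv3).1 this]
  have hv9 : 9.75 ≤ v := by nlinarith
  have hv2 : 95 ≤ v ^ 2 := by nlinarith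
  set S := v ^ 4 / 2 * (1 - t) - q / 2 * v ^ 3 with hS
  have hv4 : 0 < v ^ 4 := by positivity
  have hS2 : 2 * S ≤ v ^ 4 := by
    have : 0 ≤ v ^ 4 * t := by positivity
    have : 0 ≤ q * v ^ 3 := by positivity
    linarith
  have hmono : s * v ^ 4 - s ^ 2 ≤ S * v ^ 4 - S ^ 2 := by
    nlinarith [mul_nonneg (sub_nonneg.2 hs.le) (by linarith : 0 ≤ v ^ 4 - s - S)]
  have hSval : S * v ^ 4 - S ^ 2 = 2 * z * v ^ 8 - v ^ 7 * (t * q) / 2 - 17 / 4 * v ^ 6 := by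
    have hz' : z = (1 - t ^ 2) / 8 := by linarith
    rw [hS, hz', ← hq2]
    ring
  have htq : 2.38 ≤ t * q := by nlinarith
  have hdiv : (v ^ 4) ^ 2 / 4 * (2 / v + 1 / v ^ 2) = v ^ 7 / 2 + v ^ 6 / 4 := by
    field_simp
    ring
  have h7 : v ^ 7 * 2.38 ≤ v ^ 7 * (t * q) := by gcongr
  have h6 : v ^ 4 * 95 ≤ v ^ 4 * v ^ 2 := by gcongr
  have h7' : 0 < v ^ 7 := by positivity
  refine ⟨hv2, by linarith, ?_⟩
  rw [hdiv]
  linarith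

theorem gamma_lower_bound_aux {n s : ℕ} (h : 95 ≤ Real.sqrt n → ∃ K : Finset ℕ, K ⊆ Ioo 0 n ∧
      #K ≤ 2 * s ∧ (∀ x ∈ K, n - x ∈ K) ∧
      ∀ a b c, GenericParts n a b c → a ∈ K ∨ b ∈ K ∨ c ∈ K) (hn : 0 < n) :
    (n / 2) * (1 - Real.sqrt (1 - 8 * zeta2 n)) -
      (Real.sqrt 17 / 2) * (n : ℝ) ^ ((3 : ℝ) / 4) ≤ s := by
  by_contra! hlt
  have hn' : (0 : ℝ) < n := by exact_mod_cast hn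
  set v := (n : ℝ) ^ ((1 : ℝ) / 4) with hv
  have hv0 : 0 < v := Real.rpow_pos_of_pos hn' _
  have hpow : ∀ k : ℕ, (n : ℝ) ^ ((1 : ℝ) / 4 * k) = v ^ k := fun k => by
    rw [hv, Real.rpow_mul hn'.le, Real.rpow_natCast]
  have hv4 : (n : ℝ) = v ^ 4 := by rw [← hpow]; norm_num
  have hv3 : (n : ℝ) ^ ((3 : ℝ) / 4) = v ^ 3 := by rw [← hpow]; norm_num
  have hv2 : v ^ 2 = Real.sqrt n := by
    rw [hv4, show v ^ 4 = (v ^ 2) ^ 2 by ring, Real.sqrt_sq (by positivity)]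
  rw [hv3, hv4] at hlt
  obtain ⟨h1, h2, h3⟩ := count_lt_of_lt hv0 rfl (zeta2_le n) (Nat.cast_nonneg s) (by
    simpa using hlt)
  rw [hv2] at h1
  obtain ⟨K, hK, hcard, hsymm, hit⟩ := h h1
  rw [← hv4] at h2 h3
  have := primitive_count_le_of_hitting h1 hv0 hv2 (by exact_mod_cast h2) hK hcard hsymm hit
  rw [← hv2] at this
  linarith

end Main

theorem gamma_lower_bound_sqrt17 (n : ℕ) (hn : 20 ≤ n) :
    (Even n →
      (normalCoveringNumber (Equiv.Perm (Fin n)) : ℝ) ≥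
        (n / 2) * (1 - Real.sqrt (1 - 8 * zeta2 n)) -
          (Real.sqrt 17 / 2) * (n : ℝ) ^ ((3 : ℝ) / 4)) ∧
    (Odd n →
      (normalCoveringNumber (alternatingGroup (Fin n)) : ℝ) ≥
        (n / 2) * (1 - Real.sqrt (1 - 8 * zeta2 n)) -
          (Real.sqrt 17 / 2) * (n : ℝ) ^ ((3 : ℝ) / 4)) ∧
    ((n / 2) * (1 - Real.sqrt (1 - 8 * zeta2 n)) -
        (Real.sqrt 17 / 2) * (n : ℝ) ^ ((3 : ℝ) / 4) ≥
      (n / 2) * (1 - Real.sqrt (1 - 4 / Real.pi ^ 2)) -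
        (Real.sqrt 17 / 2) * (n : ℝ) ^ ((3 : ℝ) / 4)) := by
  refine ⟨fun h => gamma_lower_bound_aux (exists_hitting_set_perm h) (by omega),
    fun h => gamma_lower_bound_aux (exists_hitting_set_alternatingGroup h) (by omega), ?_⟩
  have hz := le_zeta2 n
  have : 1 - 8 * zeta2 n ≤ 1 - 4 / Real.pi ^ 2 := by
    have : 8 * (1 / (2 * Real.pi ^ 2)) = 4 / Real.pi ^ 2 := by field_simp; norm_num
    linarith
  have := Real.sqrt_le_sqrt this
  gcongr
end

section
/- For every natural number n ≥ 4, the number p₃(n)' of coprime 3-partitions of n equals (n²/12)·∏_{p | n, p prime} (1 − 1/p²). Moreover, for every n ≥ 3, p₃(n)' > n²/(2π²). -/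
/-- The set of `k`-partitions of `n`: multisets of `k` positive integers summing to `n`. -/
def kPartitions (k n : ℕ) : Set (Multiset ℕ) :=
  {m | Multiset.card m = k ∧ (∀ x ∈ m, 0 < x) ∧ m.sum = n}

/-- The set of coprime `k`-partitions of `n`: `k`-partitions whose terms have gcd `1`. -/
def kPartitionsCoprime (k n : ℕ) : Set (Multiset ℕ) :=
  {m | m ∈ kPartitions k n ∧ m.gcd = 1}

open Finset in
lemma card_filter_dvd_range {d n : ℕ} (hn : 0 < n) (hd : d ∣ n) :
    #{a ∈ range n | d ∣ a} = n / d := by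
  obtain ⟨k, rfl⟩ := hd
  have hd : 0 < d := Nat.pos_of_mul_pos_right hn
  rw [Nat.mul_div_cancel_left _ hd]
  have : {a ∈ range (d * k) | d ∣ a} = (range k).image (d * ·) := by
    ext a
    simp only [mem_filter, mem_range, mem_image]
    constructor
    · rintro ⟨h, c, rfl⟩
      exact ⟨c, Nat.lt_of_mul_lt_mul_left h, rfl⟩
    · rintro ⟨c, h, rfl⟩
      exact ⟨Nat.mul_lt_mul_of_pos_left h hd, dvd_mul_right _ _⟩
  rw [this, card_image_of_injective _ (fun x y h => Nat.eq_of_mul_eq_mul_left hd h), card_range]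

open Finset in
/-- A product formula for the number of pairs modulo `n` that are coprime together with `n`. -/
lemma card_coprime_pairs_mod {n : ℕ} (hn : 0 < n) :
    (#{x ∈ range n ×ˢ range n | (x.1.gcd x.2).gcd n = 1} : ℝ) =
      (n : ℝ) ^ 2 * ∏ p ∈ n.primeFactors, (1 - 1 / (p : ℝ) ^ 2) := by
  have key : ∀ x : ℕ × ℕ, (if (x.1.gcd x.2).gcd n = 1 then (1 : ℝ) else 0) =
      ∏ p ∈ n.primeFactors, (1 + -(if p ∣ x.1 ∧ p ∣ x.2 then (1 : ℝ) else 0)) := by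
    intro x
    split_ifs with h
    · refine (prod_eq_one fun p hp => ?_).symm
      have hp' := Nat.mem_primeFactors.1 hp
      rw [if_neg]
      · simp
      · rintro ⟨h1, h2⟩
        exact hp'.1.one_lt.ne' (Nat.dvd_one.1 (h ▸ Nat.dvd_gcd (Nat.dvd_gcd h1 h2) hp'.2.1))
    · obtain ⟨p, hp, hpd⟩ := Nat.exists_prime_and_dvd h
      have h2 := hpd.trans (Nat.gcd_dvd_left _ _)
      refine (prod_eq_zero (i := p)
        (Nat.mem_primeFactors.2 ⟨hp, hpd.trans (Nat.gcd_dvd_right _ _), hn.ne'⟩) ?_).symm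
      rw [if_pos ⟨h2.trans (Nat.gcd_dvd_left _ _), h2.trans (Nat.gcd_dvd_right _ _)⟩]
      simp
  have hprod : ∀ s ∈ n.primeFactors.powerset, ∀ a : ℕ,
      (∏ p ∈ s, p) ∣ a ↔ ∀ p ∈ s, p ∣ a := by
    intro s hs a
    refine ⟨fun h p hp => (dvd_prod_of_mem _ hp).trans h, fun h => ?_⟩
    exact prod_primes_dvd a
      (fun p hp => (Nat.prime_of_mem_primeFactors (mem_powerset.1 hs hp)).prime) h
  have hcount : ∀ s ∈ n.primeFactors.powerset,
      (∑ x ∈ range n ×ˢ range n, ∏ p ∈ s, (if p ∣ x.1 ∧ p ∣ x.2 then (1 : ℝ) else 0)) =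
        (n : ℝ) ^ 2 * ∏ p ∈ s, (1 / (p : ℝ) ^ 2) := by
    intro s hs
    have hdn : (∏ p ∈ s, p) ∣ n :=
      (hprod s hs n).2 fun p hp => Nat.dvd_of_mem_primeFactors (mem_powerset.1 hs hp)
    have hd0 : ((∏ p ∈ s, p : ℕ) : ℝ) ≠ 0 := by
      exact_mod_cast (Nat.pos_of_dvd_of_pos hdn hn).ne'
    have h1 : ∀ x : ℕ × ℕ, (∏ p ∈ s, (if p ∣ x.1 ∧ p ∣ x.2 then (1 : ℝ) else 0)) =
        if (∏ p ∈ s, p) ∣ x.1 ∧ (∏ p ∈ s, p) ∣ x.2 then 1 else 0 := by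
      intro x
      rw [prod_ite_zero]
      simp only [hprod s hs, prod_const_one, forall_and]
    simp only [h1]
    have h2 : {x ∈ range n ×ˢ range n | (∏ p ∈ s, p) ∣ x.1 ∧ (∏ p ∈ s, p) ∣ x.2} =
        {a ∈ range n | (∏ p ∈ s, p) ∣ a} ×ˢ {a ∈ range n | (∏ p ∈ s, p) ∣ a} :=
      filter_product _ _
    rw [sum_boole, h2, card_product, card_filter_dvd_range hn hdn, Nat.cast_mul,
      Nat.cast_div hdn hd0]
    simp only [one_div, prod_inv_distrib, prod_pow]
    push_cast
    field_simp
  rw [← sum_boole]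
  simp only [key, prod_one_add]
  rw [sum_comm]
  simp only [sub_eq_add_neg, prod_one_add, mul_sum]
  refine sum_congr rfl fun s hs => ?_
  simp only [prod_neg, ← mul_sum]
  rw [hcount s hs]
  ring

/-- Finite partial products of the Euler product of `1 / ζ(2)` exceed `6 / π ^ 2`. -/
lemma six_div_pi_sq_lt_prod_one_sub {s : Finset ℕ} (hs : ∀ p ∈ s, p.Prime) :
    6 / Real.pi ^ 2 < ∏ p ∈ s, (1 - 1 / (p : ℝ) ^ 2) := by
  let f : ℕ →* ℝ :=
    { toFun := fun n => 1 / (n : ℝ) ^ 2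
      map_one' := by simp
      map_mul' := fun a b => by push_cast; field_simp }
  have hf : ∀ n : ℕ, f n = 1 / (n : ℝ) ^ 2 := fun _ => rfl
  have hz := hasSum_zeta_two
  have hsum : Summable (fun n => f n) := hz.summable
  have h := (EulerProduct.summable_and_hasSum_factoredNumbers_prod_filter_prime_geometric
    (f := f) (fun {p} hp => by
      rw [hf, Real.norm_of_nonneg (by positivity), div_lt_one (by have := hp.pos; positivity)]
      have : (1 : ℝ) < p := by exact_mod_cast hp.one_lt
      nlinarith) s).2
  rw [Finset.filter_true_of_mem hs] at h
  obtain ⟨q, hq, hqp⟩ := Nat.exists_infinite_primes (∑ p ∈ s, p + 1)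
  have hqs : q ∉ Nat.factoredNumbers s := by
    intro hmem
    have : q ∈ s := (Nat.mem_factoredNumbers'.1 hmem) q hqp dvd_rfl
    have := Finset.single_le_sum (f := fun p : ℕ => p) (fun _ _ => Nat.zero_le _) this
    lia
  have hlt : ∏ p ∈ s, (1 - f p)⁻¹ < Real.pi ^ 2 / 6 := by
    have hind := (hasSum_subtype_iff_indicator (f := fun n => f n)).1 h
    refine hasSum_lt (i := q) (fun n => ?_) ?_ hind hz
    · by_cases hn : n ∈ Nat.factoredNumbers s
      · simp [hn, hf]
      · simp only [Set.indicator_of_notMem hn]; positivity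
    · simp only [Set.indicator_of_notMem hqs]
      have := hqp.pos
      positivity
  have hpos : 0 < ∏ p ∈ s, (1 - 1 / (p : ℝ) ^ 2) := by
    refine Finset.prod_pos fun p hp => ?_
    have : (1 : ℝ) < p := by exact_mod_cast (hs p hp).one_lt
    rw [sub_pos, div_lt_one (by positivity)]
    nlinarith
  rw [Finset.prod_inv_distrib] at hlt
  have := inv_strictAnti₀ (inv_pos.2 hpos) hlt
  simpa using this

open Finset in
/-- Ordered triples with a symmetric property `T` that excludes constant triples, counted
according to whether two of their terms agree. -/
lemma card_ordered_triples (R : Finset ℕ) (T : ℕ → ℕ → ℕ → Prop) [∀ a b c, Decidable (T a b c)]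
    (h₁ : ∀ a b c, T a b c → T b a c) (h₂ : ∀ a b c, T a b c → T a c b) (h₃ : ∀ a, ¬ T a a a) :
    #{x ∈ R ×ˢ R ×ˢ R | T x.1 x.2.1 x.2.2} =
      6 * #{x ∈ R ×ˢ R ×ˢ R | x.1 < x.2.1 ∧ x.2.1 < x.2.2 ∧ T x.1 x.2.1 x.2.2} +
      3 * #{x ∈ R ×ˢ R ×ˢ R | x.1 = x.2.1 ∧ T x.1 x.2.1 x.2.2} := by
  set S := {x ∈ R ×ˢ R ×ˢ R | T x.1 x.2.1 x.2.2}
  set L := {x ∈ R ×ˢ R ×ˢ R | x.1 < x.2.1 ∧ x.2.1 < x.2.2 ∧ T x.1 x.2.1 x.2.2}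
  set D := {x ∈ R ×ˢ R ×ˢ R | x.1 = x.2.1 ∧ T x.1 x.2.1 x.2.2}
  have hperm : ∀ a b c, T a b c → T b a c ∧ T a c b ∧ T b c a ∧ T c a b ∧ T c b a := by grind
  have e1 : #{x ∈ S | x.1 < x.2.1 ∧ x.2.1 < x.2.2} = #L := by
    refine card_nbij' (fun x => x) (fun x => x) ?_ ?_ ?_ ?_ <;> rintro ⟨a, b, c⟩ <;>
      simp only [mem_coe, S, L, mem_filter, mem_product] <;> grind
  have e2 : #{x ∈ S | x.2.1 < x.1 ∧ x.1 < x.2.2} = #L := by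
    refine card_nbij' (fun x => (x.2.1, x.1, x.2.2)) (fun x => (x.2.1, x.1, x.2.2))
      ?_ ?_ ?_ ?_ <;> rintro ⟨a, b, c⟩ <;>
      simp only [mem_coe, S, L, mem_filter, mem_product] <;> grind
  have e3 : #{x ∈ S | x.1 < x.2.2 ∧ x.2.2 < x.2.1} = #L := by
    refine card_nbij' (fun x => (x.1, x.2.2, x.2.1)) (fun x => (x.1, x.2.2, x.2.1))
      ?_ ?_ ?_ ?_ <;> rintro ⟨a, b, c⟩ <;>
      simp only [mem_coe, S, L, mem_filter, mem_product] <;> grind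
  have e4 : #{x ∈ S | x.2.2 < x.2.1 ∧ x.2.1 < x.1} = #L := by
    refine card_nbij' (fun x => (x.2.2, x.2.1, x.1)) (fun x => (x.2.2, x.2.1, x.1))
      ?_ ?_ ?_ ?_ <;> rintro ⟨a, b, c⟩ <;>
      simp only [mem_coe, S, L, mem_filter, mem_product] <;> grind
  have e5 : #{x ∈ S | x.2.1 < x.2.2 ∧ x.2.2 < x.1} = #L := by
    refine card_nbij' (fun x => (x.2.1, x.2.2, x.1)) (fun x => (x.2.2, x.1, x.2.1))
      ?_ ?_ ?_ ?_ <;> rintro ⟨a, b, c⟩ <;>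
      simp only [mem_coe, S, L, mem_filter, mem_product] <;> grind
  have e6 : #{x ∈ S | x.2.2 < x.1 ∧ x.1 < x.2.1} = #L := by
    refine card_nbij' (fun x => (x.2.2, x.1, x.2.1)) (fun x => (x.2.1, x.2.2, x.1))
      ?_ ?_ ?_ ?_ <;> rintro ⟨a, b, c⟩ <;>
      simp only [mem_coe, S, L, mem_filter, mem_product] <;> grind
  have e7 : #{x ∈ S | x.1 = x.2.1} = #D := by
    refine card_nbij' (fun x => x) (fun x => x) ?_ ?_ ?_ ?_ <;> rintro ⟨a, b, c⟩ <;>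
      simp only [mem_coe, S, D, mem_filter, mem_product] <;> grind
  have e8 : #{x ∈ S | x.1 = x.2.2} = #D := by
    refine card_nbij' (fun x => (x.1, x.2.2, x.2.1)) (fun x => (x.1, x.2.2, x.2.1))
      ?_ ?_ ?_ ?_ <;> rintro ⟨a, b, c⟩ <;>
      simp only [mem_coe, S, D, mem_filter, mem_product] <;> grind
  have e9 : #{x ∈ S | x.2.1 = x.2.2} = #D := by
    refine card_nbij' (fun x => (x.2.2, x.2.1, x.1)) (fun x => (x.2.2, x.2.1, x.1))
      ?_ ?_ ?_ ?_ <;> rintro ⟨a, b, c⟩ <;>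
      simp only [mem_coe, S, D, mem_filter, mem_product] <;> grind
  have hsplit : #S = #{x ∈ S | x.1 < x.2.1 ∧ x.2.1 < x.2.2} +
      #{x ∈ S | x.2.1 < x.1 ∧ x.1 < x.2.2} + #{x ∈ S | x.1 < x.2.2 ∧ x.2.2 < x.2.1} +
      #{x ∈ S | x.2.2 < x.2.1 ∧ x.2.1 < x.1} + #{x ∈ S | x.2.1 < x.2.2 ∧ x.2.2 < x.1} +
      #{x ∈ S | x.2.2 < x.1 ∧ x.1 < x.2.1} +
      #{x ∈ S | x.1 = x.2.1} + #{x ∈ S | x.1 = x.2.2} + #{x ∈ S | x.2.1 = x.2.2} := by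
    simp only [card_filter _ S, ← sum_add_distrib]
    rw [card_eq_sum_ones]
    refine sum_congr rfl fun ⟨a, b, c⟩ hx => ?_
    have hT : T a b c := (mem_filter.1 hx).2
    have hne : ¬ (a = b ∧ b = c) := by
      rintro ⟨rfl, rfl⟩
      exact h₃ a hT
    clear * - hne
    split_ifs <;> lia
  lia

/-- Coprimality of three naturals is unchanged when one term is replaced by the sum. -/
lemma gcd_gcd_sum_eq_one {a b c n : ℕ} (h : a + b + c = n) :
    (a.gcd b).gcd n = 1 ↔ (a.gcd b).gcd c = 1 := by
  have hd : a.gcd b ∣ a + b := dvd_add (Nat.gcd_dvd_left a b) (Nat.gcd_dvd_right a b)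
  obtain ⟨k, hk⟩ := hd
  rw [← h, hk, Nat.gcd_mul_left_add_right]

/-- Coprimality with `n` is invariant under negation modulo `n`. -/
lemma gcd_gcd_sub_eq_one {a b n : ℕ} (ha : a ≤ n) (hb : b ≤ n) (h : (a.gcd b).gcd n = 1) :
    ((n - a).gcd (n - b)).gcd n = 1 := by
  rw [← Nat.dvd_one, ← h]
  have hn := Nat.gcd_dvd_right ((n - a).gcd (n - b)) n
  have hab := Nat.gcd_dvd_left ((n - a).gcd (n - b)) n
  refine Nat.dvd_gcd (Nat.dvd_gcd ?_ ?_) hn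
  · exact (Nat.dvd_sub_iff_right ha hn).1 (hab.trans (Nat.gcd_dvd_left _ _))
  · exact (Nat.dvd_sub_iff_right hb hn).1 (hab.trans (Nat.gcd_dvd_right _ _))

open Finset in
/-- Coprime pairs modulo `n` in terms of ordered coprime triples of positive integers with
sum `n`. -/
lemma card_coprime_pairs_eq {n : ℕ} (hn : 2 ≤ n) :
    #{x ∈ range n ×ˢ range n | (x.1.gcd x.2).gcd n = 1} =
      2 * #{x ∈ Ico 1 n ×ˢ Ico 1 n ×ˢ Ico 1 n |
        x.1 + x.2.1 + x.2.2 = n ∧ (x.1.gcd x.2.1).gcd x.2.2 = 1} + 3 * n.totient := by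
  rw [Nat.totient_eq_card_coprime]
  set A := {x ∈ range n ×ˢ range n | (x.1.gcd x.2).gcd n = 1}
  set S := {x ∈ Ico 1 n ×ˢ Ico 1 n ×ˢ Ico 1 n |
        x.1 + x.2.1 + x.2.2 = n ∧ (x.1.gcd x.2.1).gcd x.2.2 = 1}
  set U := {x ∈ range n | n.Coprime x}
  have e1 : #{x ∈ A | 0 < x.1 ∧ 0 < x.2 ∧ x.1 + x.2 < n} = #S := by
    refine card_nbij' (fun x => (x.1, x.2, n - x.1 - x.2)) (fun x => (x.1, x.2.1)) ?_ ?_ ?_ ?_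
    · rintro ⟨a, b⟩
      simp only [mem_coe, A, S, mem_filter, mem_product, mem_range, mem_Ico]
      rintro ⟨⟨_, h⟩, _, _, _⟩
      have hsum : a + b + (n - a - b) = n := by lia
      exact ⟨by lia, hsum, (gcd_gcd_sum_eq_one hsum).1 h⟩
    · rintro ⟨a, b, c⟩
      simp only [mem_coe, A, S, mem_filter, mem_product, mem_range, mem_Ico]
      rintro ⟨_, hsum, h⟩
      exact ⟨⟨by lia, (gcd_gcd_sum_eq_one hsum).2 h⟩, by lia⟩
    · rintro ⟨a, b⟩ _
      rfl
    · rintro ⟨a, b, c⟩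
      simp only [mem_coe, S, mem_filter, mem_product, mem_Ico, Prod.mk.injEq, true_and]
      lia
  have e2 : #{x ∈ A | n < x.1 + x.2} = #{x ∈ A | 0 < x.1 ∧ 0 < x.2 ∧ x.1 + x.2 < n} := by
    refine card_nbij' (fun x => (n - x.1, n - x.2)) (fun x => (n - x.1, n - x.2))
      ?_ ?_ ?_ ?_ <;> rintro ⟨a, b⟩ <;>
      simp only [mem_coe, A, mem_filter, mem_product, mem_range, Prod.mk.injEq]
    · rintro ⟨⟨_, h⟩, _⟩
      exact ⟨⟨by lia, gcd_gcd_sub_eq_one (by lia) (by lia) h⟩, by lia⟩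
    · rintro ⟨⟨_, h⟩, _⟩
      exact ⟨⟨by lia, gcd_gcd_sub_eq_one (by lia) (by lia) h⟩, by lia⟩
    · lia
    · lia
  have e3 : #{x ∈ A | x.1 = 0} = #U := by
    refine card_nbij' (fun x => x.2) (fun x => (0, x)) ?_ ?_ ?_ ?_
    · rintro ⟨a, b⟩
      simp only [mem_coe, A, U, mem_filter, mem_product, mem_range]
      rintro ⟨⟨_, h⟩, rfl⟩
      rw [Nat.gcd_zero_left] at h
      exact ⟨by lia, Nat.Coprime.symm h⟩
    · intro b
      simp only [mem_coe, A, U, mem_filter, mem_product, mem_range]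
      rintro ⟨_, h⟩
      exact ⟨⟨by lia, by rw [Nat.gcd_zero_left]; exact h.symm⟩, trivial⟩
    · rintro ⟨a, b⟩
      simp only [mem_coe, mem_filter, Prod.mk.injEq]
      lia
    · intro b _
      rfl
  have e4 : #{x ∈ A | x.2 = 0} = #U := by
    refine card_nbij' (fun x => x.1) (fun x => (x, 0)) ?_ ?_ ?_ ?_
    · rintro ⟨a, b⟩
      simp only [mem_coe, A, U, mem_filter, mem_product, mem_range]
      rintro ⟨⟨_, h⟩, rfl⟩
      rw [Nat.gcd_zero_right] at h
      exact ⟨by lia, Nat.Coprime.symm h⟩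
    · intro b
      simp only [mem_coe, A, U, mem_filter, mem_product, mem_range]
      rintro ⟨_, h⟩
      exact ⟨⟨by lia, by rw [Nat.gcd_zero_right]; exact h.symm⟩, trivial⟩
    · rintro ⟨a, b⟩
      simp only [mem_coe, mem_filter, Prod.mk.injEq]
      lia
    · intro b _
      rfl
  have hdiag : ∀ a b, a + b = n → ((a.gcd b).gcd n = 1 ↔ n.Coprime a) := by
    rintro a b rfl
    rw [gcd_gcd_sum_eq_one (c := 0) (add_zero (a + b)), Nat.gcd_zero_right, Nat.coprime_comm,
      Nat.coprime_self_add_right, Nat.Coprime]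
  have e5 : #{x ∈ A | x.1 + x.2 = n} = #U := by
    refine card_nbij' (fun x => x.1) (fun x => (x, n - x)) ?_ ?_ ?_ ?_
    · rintro ⟨a, b⟩
      simp only [mem_coe, A, U, mem_filter, mem_product, mem_range]
      rintro ⟨⟨_, h⟩, hab⟩
      exact ⟨by lia, (hdiag a b hab).1 h⟩
    · intro a
      simp only [mem_coe, A, U, mem_filter, mem_product, mem_range]
      rintro ⟨han, h⟩
      have ha : a ≠ 0 := by
        rintro rfl
        rw [Nat.coprime_zero_right] at h
        lia
      exact ⟨⟨by lia, (hdiag a (n - a) (by lia)).2 h⟩, by lia⟩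
    · rintro ⟨a, b⟩
      simp only [mem_coe, mem_filter, Prod.mk.injEq]
      lia
    · intro b _
      rfl
  have hsplit : #A = #{x ∈ A | 0 < x.1 ∧ 0 < x.2 ∧ x.1 + x.2 < n} + #{x ∈ A | n < x.1 + x.2} +
      #{x ∈ A | x.1 = 0} + #{x ∈ A | x.2 = 0} + #{x ∈ A | x.1 + x.2 = n} := by
    simp only [card_filter _ A, ← sum_add_distrib]
    rw [card_eq_sum_ones]
    refine sum_congr rfl fun ⟨a, b⟩ hx => ?_
    simp only [A, mem_filter, mem_product, mem_range] at hx
    obtain ⟨hx', hx⟩ := hx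
    have h0 : ¬ (a = 0 ∧ b = 0) := by
      rintro ⟨rfl, rfl⟩
      simp at hx
      lia
    clear * - h0 hx'
    split_ifs <;> lia
  lia

open Finset in
/-- Coprime triples `(a, a, c)` with sum `n` correspond to half of the units modulo `n`. -/
lemma two_mul_card_isosceles {n : ℕ} (hn : 3 ≤ n) :
    2 * #{x ∈ Ico 1 n ×ˢ Ico 1 n ×ˢ Ico 1 n | x.1 = x.2.1 ∧
        x.1 + x.2.1 + x.2.2 = n ∧ (x.1.gcd x.2.1).gcd x.2.2 = 1} = n.totient := by
  rw [Nat.totient_eq_card_coprime]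
  set D := {x ∈ Ico 1 n ×ˢ Ico 1 n ×ˢ Ico 1 n | x.1 = x.2.1 ∧
        x.1 + x.2.1 + x.2.2 = n ∧ (x.1.gcd x.2.1).gcd x.2.2 = 1}
  set U := {x ∈ range n | n.Coprime x}
  have e1 : #{x ∈ U | 2 * x < n} = #D := by
    refine card_nbij' (fun x => (x, x, n - x - x)) (fun x => x.1) ?_ ?_ ?_ ?_
    · intro a
      simp only [mem_coe, D, U, mem_filter, mem_product, mem_range, mem_Ico]
      rintro ⟨⟨_, h⟩, _⟩
      have ha : a ≠ 0 := by
        rintro rfl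
        rw [Nat.coprime_zero_right] at h
        lia
      have hsum : a + a + (n - a - a) = n := by lia
      refine ⟨by lia, trivial, hsum, (gcd_gcd_sum_eq_one hsum).1 ?_⟩
      rw [Nat.gcd_self]
      exact h.symm
    · rintro ⟨a, b, c⟩
      simp only [mem_coe, D, U, mem_filter, mem_product, mem_range, mem_Ico]
      rintro ⟨_, rfl, hsum, h⟩
      have h' := (gcd_gcd_sum_eq_one hsum).2 h
      rw [Nat.gcd_self] at h'
      exact ⟨⟨by lia, Nat.Coprime.symm h'⟩, by lia⟩
    · intro a _
      rfl
    · rintro ⟨a, b, c⟩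
      simp only [mem_coe, D, mem_filter, mem_product, mem_Ico, Prod.mk.injEq]
      lia
  have hneg : ∀ a, a ≤ n → n.Coprime a → n.Coprime (n - a) := fun a ha h =>
    (Nat.coprime_self_sub_right ha).2 h
  have hzero : ∀ a, n.Coprime a → a ≠ 0 := by
    rintro a h rfl
    rw [Nat.coprime_zero_right] at h
    lia
  have e2 : #{x ∈ U | n < 2 * x} = #{x ∈ U | 2 * x < n} := by
    refine card_nbij' (fun x => n - x) (fun x => n - x) ?_ ?_ ?_ ?_ <;> intro a <;>
      simp only [mem_coe, U, mem_filter, mem_range]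
    · rintro ⟨⟨_, h⟩, _⟩
      exact ⟨⟨by lia, hneg a (by lia) h⟩, by lia⟩
    · rintro ⟨⟨_, h⟩, _⟩
      have := hzero a h
      exact ⟨⟨by lia, hneg a (by lia) h⟩, by lia⟩
    · lia
    · lia
  have hsplit : #U = #{x ∈ U | 2 * x < n} + #{x ∈ U | n < 2 * x} := by
    simp only [card_filter _ U, ← sum_add_distrib]
    rw [card_eq_sum_ones]
    refine sum_congr rfl fun a hx => ?_
    have hx : n.Coprime a := (mem_filter.1 hx).2
    have h2 : 2 * a ≠ n := by
      rintro rfl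
      have : a = 1 := Nat.eq_one_of_dvd_coprimes hx (dvd_mul_left a 2) dvd_rfl
      lia
    clear * - h2
    split_ifs <;> lia
  lia

open Finset in
/-- Coprime `3`-partitions are the nondecreasing coprime triples. -/
lemma ncard_kPartitionsCoprime_three (n : ℕ) :
    (kPartitionsCoprime 3 n).ncard =
      #{x ∈ Ico 1 n ×ˢ Ico 1 n ×ˢ Ico 1 n | x.1 ≤ x.2.1 ∧ x.2.1 ≤ x.2.2 ∧
        x.1 + x.2.1 + x.2.2 = n ∧ (x.1.gcd x.2.1).gcd x.2.2 = 1} := by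
  rw [← Set.ncard_coe_finset]
  symm
  refine Set.ncard_congr (fun x _ => ({x.1, x.2.1, x.2.2} : Multiset ℕ)) ?_ ?_ ?_
  · rintro ⟨a, b, c⟩
    simp only [mem_coe, mem_filter, mem_product, mem_Ico]
    rintro ⟨_, _, _, hsum, h⟩
    refine ⟨⟨rfl, ?_, ?_⟩, ?_⟩
    · simp only [Multiset.insert_eq_cons, Multiset.mem_cons, Multiset.mem_singleton]
      lia
    · simp only [Multiset.insert_eq_cons, Multiset.sum_cons, Multiset.sum_singleton]
      lia
    · rw [Nat.gcd_assoc] at h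
      simpa [Multiset.insert_eq_cons, gcd_eq_nat_gcd] using h
  · rintro ⟨a, b, c⟩ ⟨a', b', c'⟩ h h' heq
    simp only [mem_coe, mem_filter, mem_product, mem_Ico] at h h'
    have hp : [a, b, c].Perm [a', b', c'] := Multiset.coe_eq_coe.1 heq
    have hs : [a, b, c] = [a', b', c'] := by
      refine hp.eq_of_pairwise' (r := (· ≤ ·)) ?_ ?_ <;>
        simp only [List.pairwise_cons, List.mem_cons] <;> grind
    simp_all
  · rintro m ⟨⟨hcard, hpos, hsum⟩, hg⟩
    obtain ⟨a, b, c, hab, hbc, rfl⟩ : ∃ a b c : ℕ, a ≤ b ∧ b ≤ c ∧ m = {a, b, c} := by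
      have hlen : (m.sort (· ≤ ·)).length = 3 := by rw [Multiset.length_sort, hcard]
      obtain ⟨a, b, c, habc⟩ := List.length_eq_three.1 hlen
      have hsort := m.pairwise_sort (· ≤ ·)
      rw [habc] at hsort
      refine ⟨a, b, c, ?_, ?_, ?_⟩
      · simp_all
      · simp_all
      · rw [← Multiset.sort_eq m (· ≤ ·), habc]
        rfl
    simp only [Multiset.insert_eq_cons, Multiset.mem_cons, Multiset.mem_singleton] at hpos
    simp only [Multiset.insert_eq_cons, Multiset.sum_cons, Multiset.sum_singleton] at hsum
    have ha := hpos a (by simp)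
    have hb := hpos b (by simp)
    have hc := hpos c (by simp)
    refine ⟨(a, b, c), ?_, rfl⟩
    simp only [mem_coe, mem_filter, mem_product, mem_Ico]
    refine ⟨by lia, hab, hbc, by lia, ?_⟩
    rw [Nat.gcd_assoc]
    simpa [Multiset.insert_eq_cons, gcd_eq_nat_gcd] using hg

open Finset in
/-- Nondecreasing triples, split according to whether two terms agree. -/
lemma card_sorted_triples (R : Finset ℕ) (T : ℕ → ℕ → ℕ → Prop) [∀ a b c, Decidable (T a b c)]
    (h₁ : ∀ a b c, T a b c → T b a c) (h₂ : ∀ a b c, T a b c → T a c b) (h₃ : ∀ a, ¬ T a a a) :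
    #{x ∈ R ×ˢ R ×ˢ R | x.1 ≤ x.2.1 ∧ x.2.1 ≤ x.2.2 ∧ T x.1 x.2.1 x.2.2} =
      #{x ∈ R ×ˢ R ×ˢ R | x.1 < x.2.1 ∧ x.2.1 < x.2.2 ∧ T x.1 x.2.1 x.2.2} +
      #{x ∈ R ×ˢ R ×ˢ R | x.1 = x.2.1 ∧ T x.1 x.2.1 x.2.2} := by
  set W := {x ∈ R ×ˢ R ×ˢ R | x.1 ≤ x.2.1 ∧ x.2.1 ≤ x.2.2 ∧ T x.1 x.2.1 x.2.2}
  set L := {x ∈ R ×ˢ R ×ˢ R | x.1 < x.2.1 ∧ x.2.1 < x.2.2 ∧ T x.1 x.2.1 x.2.2}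
  set D := {x ∈ R ×ˢ R ×ˢ R | x.1 = x.2.1 ∧ T x.1 x.2.1 x.2.2}
  have hperm : ∀ a b c, T a b c → T c b a := by grind
  have e1 : #{x ∈ W | x.1 < x.2.1 ∧ x.2.1 < x.2.2} = #L := by
    refine card_nbij' (fun x => x) (fun x => x) ?_ ?_ ?_ ?_ <;> rintro ⟨a, b, c⟩ <;>
      simp only [mem_coe, W, L, mem_filter, mem_product] <;> grind
  have e2 : #{x ∈ W | x.1 = x.2.1} = #{x ∈ D | x.1 < x.2.2} := by
    refine card_nbij' (fun x => x) (fun x => x) ?_ ?_ ?_ ?_ <;> rintro ⟨a, b, c⟩ <;>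
      simp only [mem_coe, W, D, mem_filter, mem_product] <;> grind
  have e3 : #{x ∈ W | x.2.1 = x.2.2} = #{x ∈ D | x.2.2 < x.1} := by
    refine card_nbij' (fun x => (x.2.2, x.2.1, x.1)) (fun x => (x.2.2, x.2.1, x.1))
      ?_ ?_ ?_ ?_ <;> rintro ⟨a, b, c⟩ <;>
      simp only [mem_coe, W, D, mem_filter, mem_product] <;> grind
  have hW : #W = #{x ∈ W | x.1 < x.2.1 ∧ x.2.1 < x.2.2} + #{x ∈ W | x.1 = x.2.1} +
      #{x ∈ W | x.2.1 = x.2.2} := by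
    simp only [card_filter _ W, ← sum_add_distrib]
    rw [card_eq_sum_ones]
    refine sum_congr rfl fun ⟨a, b, c⟩ hx => ?_
    obtain ⟨hab, hbc, hT⟩ := (mem_filter.1 hx).2
    have hne : ¬ (a = b ∧ b = c) := by
      rintro ⟨rfl, rfl⟩
      exact h₃ a hT
    simp only at hab hbc
    clear * - hne hab hbc
    split_ifs <;> lia
  have hD : #D = #{x ∈ D | x.1 < x.2.2} + #{x ∈ D | x.2.2 < x.1} := by
    simp only [card_filter _ D, ← sum_add_distrib]
    rw [card_eq_sum_ones]
    refine sum_congr rfl fun ⟨a, b, c⟩ hx => ?_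
    obtain ⟨hab, hT⟩ := (mem_filter.1 hx).2
    have hne : a ≠ c := by
      rintro rfl
      simp only at hab hT
      rw [← hab] at hT
      exact h₃ a hT
    clear * - hne
    split_ifs <;> lia
  lia

open Finset in
/-- There are twelve coprime pairs modulo `n` for each coprime `3`-partition of `n`. -/
lemma twelve_mul_ncard_kPartitionsCoprime {n : ℕ} (hn : 4 ≤ n) :
    12 * (kPartitionsCoprime 3 n).ncard =
      #{x ∈ range n ×ˢ range n | (x.1.gcd x.2).gcd n = 1} := by
  let T : ℕ → ℕ → ℕ → Prop := fun a b c => a + b + c = n ∧ (a.gcd b).gcd c = 1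
  have h₁ : ∀ a b c, T a b c → T b a c := fun a b c h =>
    ⟨by have := h.1; lia, by rw [Nat.gcd_comm b a]; exact h.2⟩
  have h₂ : ∀ a b c, T a b c → T a c b := fun a b c h =>
    ⟨by have := h.1; lia, by rw [Nat.gcd_assoc, Nat.gcd_comm c b, ← Nat.gcd_assoc]; exact h.2⟩
  have h₃ : ∀ a, ¬ T a a a := by
    rintro a ⟨h, h'⟩
    rw [Nat.gcd_self, Nat.gcd_self] at h'
    lia
  have hA := card_coprime_pairs_eq (n := n) (by lia)
  have hD := two_mul_card_isosceles (n := n) (by lia)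
  have hS := card_ordered_triples (Ico 1 n) T h₁ h₂ h₃
  have hW := card_sorted_triples (Ico 1 n) T h₁ h₂ h₃
  rw [ncard_kPartitionsCoprime_three]
  simp only [T] at hS hW
  lia

theorem coprime_three_partitions_count (n : ℕ) :
    (4 ≤ n →
      ((kPartitionsCoprime 3 n).ncard : ℝ) =
        (n : ℝ) ^ 2 / 12 * ∏ p ∈ n.primeFactors, (1 - 1 / (p : ℝ) ^ 2)) ∧
    (3 ≤ n → ((kPartitionsCoprime 3 n).ncard : ℝ) > (n : ℝ) ^ 2 / (2 * Real.pi ^ 2)) := by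
  have hformula : 4 ≤ n → ((kPartitionsCoprime 3 n).ncard : ℝ) =
      (n : ℝ) ^ 2 / 12 * ∏ p ∈ n.primeFactors, (1 - 1 / (p : ℝ) ^ 2) := by
    intro hn
    have h := card_coprime_pairs_mod (n := n) (by lia)
    rw [← twelve_mul_ncard_kPartitionsCoprime hn] at h
    push_cast at h
    linarith
  refine ⟨hformula, fun hn => ?_⟩
  obtain rfl | hn : n = 3 ∨ 4 ≤ n := by lia
  · have hcard : (kPartitionsCoprime 3 3).ncard = 1 := by
      rw [ncard_kPartitionsCoprime_three]
      decide
    have hpi := Real.pi_gt_three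
    rw [hcard, gt_iff_lt, div_lt_iff₀ (by positivity)]
    push_cast
    nlinarith
  · rw [hformula hn, gt_iff_lt]
    have hprod := six_div_pi_sq_lt_prod_one_sub (s := n.primeFactors)
      fun p hp => Nat.prime_of_mem_primeFactors hp
    have hn' : (0 : ℝ) < (n : ℝ) ^ 2 / 12 := by
      have : (0 : ℝ) < n := by exact_mod_cast (by lia : 0 < n)
      positivity
    calc (n : ℝ) ^ 2 / (2 * Real.pi ^ 2) = (n : ℝ) ^ 2 / 12 * (6 / Real.pi ^ 2) := by
          field_simp; norm_num
      _ < _ := mul_lt_mul_of_pos_left hprod hn'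
end

section
/- Let q be a prime power and let d, d₁, d₂ be positive integers with d = d₁ + d₂ and gcd(d₁, d₂) = 1. Then the 3-tuple [(q^{d₁}−1)/(q−1), (q^{d₂}−1)/(q−1), (q^{d₁}−1)(q^{d₂}−1)/(q−1)] is a coprime 3-partition of (q^d−1)/(q−1), i.e. its terms are positive integers summing to (q^d−1)/(q−1) with greatest common divisor 1. -/
theorem coprime_three_partition_of_primePow (q d d₁ d₂ : ℕ) (hq : IsPrimePow q)
    (hd₁ : 1 ≤ d₁) (hd₂ : 1 ≤ d₂) (hd : d = d₁ + d₂) (hgcd : Nat.gcd d₁ d₂ = 1) :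
    ({(q ^ d₁ - 1) / (q - 1), (q ^ d₂ - 1) / (q - 1),
        (q ^ d₁ - 1) * (q ^ d₂ - 1) / (q - 1)} : Multiset ℕ) ∈
      kPartitionsCoprime 3 ((q ^ d - 1) / (q - 1)) := by
  have hq2 : 2 ≤ q := hq.two_le
  obtain ⟨c, rfl⟩ : ∃ c, q = c + 1 := ⟨q - 1, by omega⟩
  have hc : 0 < c := by omega
  have hdvd (n : ℕ) : c ∣ (c + 1) ^ n - 1 := by
    simpa using Nat.sub_dvd_pow_sub_pow (c + 1) 1 n
  obtain ⟨a, ha⟩ := hdvd d₁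
  obtain ⟨b, hb⟩ := hdvd d₂
  have hpow₁ : (c + 1) ^ d₁ = c * a + 1 := by
    have := Nat.one_le_pow d₁ (c + 1) (by omega)
    omega
  have hpow₂ : (c + 1) ^ d₂ = c * b + 1 := by
    have := Nat.one_le_pow d₂ (c + 1) (by omega)
    omega
  have ha0 : 0 < a := by
    have := Nat.one_lt_pow (by omega : d₁ ≠ 0) (by omega : 1 < c + 1)
    exact Nat.pos_of_ne_zero (by rintro rfl; omega)
  have hb0 : 0 < b := by
    have := Nat.one_lt_pow (by omega : d₂ ≠ 0) (by omega : 1 < c + 1)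
    exact Nat.pos_of_ne_zero (by rintro rfl; omega)
  have hab : Nat.gcd a b = 1 := by
    have h := Nat.pow_sub_one_gcd_pow_sub_one (c + 1) d₁ d₂
    rw [ha, hb, hgcd, Nat.gcd_mul_left, pow_one, Nat.add_sub_cancel] at h
    exact Nat.eq_of_mul_eq_mul_left hc (by rw [h, mul_one])
  have hprod : c * a * (c * b) = c * (c * a * b) := by ring
  have hsum : (c + 1) ^ d - 1 = c * (a + (b + c * a * b)) := by
    rw [hd, pow_add, hpow₁, hpow₂, Nat.sub_eq_iff_eq_add (by nlinarith)]
    ring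
  rw [hsum, ha, hb, hprod, Nat.add_sub_cancel]
  simp only [Nat.mul_div_cancel_left _ hc]
  refine ⟨⟨by simp, ?_, by simp⟩, ?_⟩
  · simp only [Multiset.insert_eq_cons, Multiset.mem_cons, Multiset.mem_singleton]
    rintro x (rfl | rfl | rfl) <;> positivity
  · simp only [Multiset.insert_eq_cons, Multiset.gcd_cons, Multiset.gcd_singleton]
    rw [← gcd_assoc]
    change Nat.gcd (Nat.gcd a b) _ = 1
    rw [hab, Nat.gcd_one_left]
end

section
/- Let n, x, k be positive integers with n ≥ 2 and 1 ≤ x ≤ n−1. Then p_k(n,x) ≤ Σ_{i=1}^{k−1} p_i(x)·p_{k−i}(n−x), with equality when k ∈ {1, 2}. -/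
/-- The set of `k`-partitions of `n` with an `x`-cluster: some nonempty proper
subcollection of the terms sums to `x`. -/
def kPartitionsCluster (k n x : ℕ) : Set (Multiset ℕ) :=
  {m | m ∈ kPartitions k n ∧ ∃ s : Multiset ℕ, s ≤ m ∧ s ≠ 0 ∧ s ≠ m ∧ s.sum = x}

theorem finite_kPartitions (k n : ℕ) : (kPartitions k n).Finite :=
  (Set.finite_range (Nat.Partition.parts (n := n))).subset fun m hm =>
    ⟨⟨m, fun {_} hi => hm.2.1 _ hi, hm.2.2⟩, rfl⟩

theorem subsingleton_kPartitions_one (n : ℕ) : (kPartitions 1 n).Subsingleton := by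
  rintro s ⟨hs, -, hsn⟩ t ⟨ht, -, htn⟩
  obtain ⟨a, rfl⟩ := Multiset.card_eq_one.mp hs
  obtain ⟨b, rfl⟩ := Multiset.card_eq_one.mp ht
  simp_all

/-- A partition with an `x`-cluster is a sum of a partition of `x` and a partition of `n - x`. -/
theorem kPartitionsCluster_eq_biUnion {n x : ℕ} (k : ℕ) (hx₁ : 1 ≤ x) (hxn : x < n) :
    kPartitionsCluster k n x =
      ⋃ i ∈ Finset.Ico 1 k,
        (fun p : Multiset ℕ × Multiset ℕ => p.1 + p.2) ''
          (kPartitions i x ×ˢ kPartitions (k - i) (n - x)) := by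
  ext m
  simp only [Set.mem_iUnion, Finset.mem_Ico, Set.mem_image, Set.mem_prod, Prod.exists,
    exists_prop]
  constructor
  · rintro ⟨⟨hcard, hpos, hsum⟩, s, hle, hs0, hsm, hsx⟩
    obtain ⟨t, rfl⟩ := Multiset.le_iff_exists_add.mp hle
    have ht0 : t ≠ 0 := by
      rintro rfl
      simp at hsm
    have hs := Multiset.card_pos.mpr hs0
    have ht := Multiset.card_pos.mpr ht0
    rw [Multiset.card_add] at hcard
    rw [Multiset.sum_add] at hsum
    exact ⟨s.card, ⟨hs, by omega⟩, s, t,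
      ⟨⟨rfl, fun y hy => hpos y (Multiset.mem_add.mpr (Or.inl hy)), hsx⟩,
        by omega, fun y hy => hpos y (Multiset.mem_add.mpr (Or.inr hy)), by omega⟩, rfl⟩
  · rintro ⟨i, ⟨hi, hik⟩, s, t, ⟨⟨hsc, hsp, hss⟩, htc, htp, hts⟩, rfl⟩
    refine ⟨⟨by rw [Multiset.card_add]; omega, fun y hy => ?_,
      by rw [Multiset.sum_add]; omega⟩, s, Multiset.le_add_right s t, ?_, ?_, hss⟩
    · exact (Multiset.mem_add.mp hy).elim (hsp y) (htp y)
    · rintro rfl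
      simp at hss
      omega
    · intro h
      have := congrArg Multiset.sum h
      rw [Multiset.sum_add] at this
      omega

theorem cluster_partitions_count_le (n x k : ℕ) (hn : 2 ≤ n) (hk : 1 ≤ k)
    (hx₁ : 1 ≤ x) (hx₂ : x ≤ n - 1) :
    (kPartitionsCluster k n x).ncard ≤
        ∑ i ∈ Finset.Ico 1 k, (kPartitions i x).ncard * (kPartitions (k - i) (n - x)).ncard ∧
    (k = 1 ∨ k = 2 →
      (kPartitionsCluster k n x).ncard =
        ∑ i ∈ Finset.Ico 1 k, (kPartitions i x).ncard * (kPartitions (k - i) (n - x)).ncard) := by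
  rw [kPartitionsCluster_eq_biUnion k hx₁ (by omega)]
  constructor
  · refine (Finset.set_ncard_biUnion_le _ _).trans (Finset.sum_le_sum fun i _ => ?_)
    rw [← Set.ncard_prod]
    exact Set.ncard_image_le ((finite_kPartitions _ _).prod (finite_kPartitions _ _))
  · rintro (rfl | rfl)
    · simp
    · have hinj : Set.InjOn (fun p : Multiset ℕ × Multiset ℕ => p.1 + p.2)
          (kPartitions 1 x ×ˢ kPartitions 1 (n - x)) := fun p hp q hq _ =>
        Prod.ext (subsingleton_kPartitions_one _ hp.1 hq.1)
          (subsingleton_kPartitions_one _ hp.2 hq.2)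
      have hIco : Finset.Ico 1 2 = {1} := rfl
      rw [hIco, Finset.set_biUnion_singleton, Finset.sum_singleton, hinj.ncard_image,
        Set.ncard_prod]
end

section
/- Let n, x be positive integers with n ≥ 2 and 1 ≤ x ≤ n−1. Then p₃(n,x) = ⌊n/4⌋ if n ≥ 4 is even and x = n/2, and p₃(n,x) = ⌊(n−x)/2⌋ + ⌊x/2⌋ otherwise. In particular, p₃(n,x) ≤ n/2. -/
/-- A `3`-partition of `n` has an `x`-cluster iff one of its terms is `x` or `n - x`. -/
theorem kPartitionsCluster_three {n x : ℕ} (hx : x ≤ n) :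
    kPartitionsCluster 3 n x =
      {m ∈ kPartitions 3 n | x ∈ m} ∪ {m ∈ kPartitions 3 n | n - x ∈ m} := by
  ext m
  constructor
  · rintro ⟨hm, s, hs, hs0, hsm, rfl⟩
    obtain ⟨t, rfl⟩ := Multiset.le_iff_exists_add.1 hs
    obtain ⟨hc, hp, hsum⟩ := hm
    have ht0 : t ≠ 0 := by
      rintro rfl
      simp at hsm
    have hsc := Multiset.card_pos.2 hs0
    have htc := Multiset.card_pos.2 ht0
    rw [Multiset.card_add] at hc
    rcases (by omega : Multiset.card s = 1 ∨ Multiset.card t = 1) with h | h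
    · obtain ⟨a, rfl⟩ := Multiset.card_eq_one.1 h
      exact Or.inl ⟨⟨by rwa [Multiset.card_add], hp, hsum⟩, by simp⟩
    · obtain ⟨a, rfl⟩ := Multiset.card_eq_one.1 h
      refine Or.inr ⟨⟨by rwa [Multiset.card_add], hp, hsum⟩, ?_⟩
      rw [Multiset.sum_add, Multiset.sum_singleton] at hsum
      simp [← hsum]
  · rintro (⟨hm, h⟩ | ⟨hm, h⟩)
    · refine ⟨hm, {x}, Multiset.singleton_le.2 h, by simp, ?_, by simp⟩
      rintro rfl
      simpa using hm.1
    · obtain ⟨t, rfl⟩ := Multiset.exists_cons_of_mem h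
      obtain ⟨hc, -, hsum⟩ := id hm
      rw [Multiset.card_cons] at hc
      rw [Multiset.sum_cons] at hsum
      refine ⟨hm, t, Multiset.le_cons_self t _, ?_, ?_, by omega⟩
      · rintro rfl
        simp at hc
      · exact (Multiset.lt_cons_self t _).ne

/-- The `3`-partitions of `n` with a term `a` are the `[a, j, n - a - j]` with `2 * j ≤ n - a`. -/
theorem kPartitions_three_mem {n a : ℕ} (ha : 0 < a) (han : a ≤ n) :
    {m ∈ kPartitions 3 n | a ∈ m} =
      (fun j : ℕ => ({a, j, n - a - j} : Multiset ℕ)) '' Finset.Icc 1 ((n - a) / 2) := by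
  ext m
  constructor
  · rintro ⟨hm, h⟩
    obtain ⟨t, rfl⟩ := Multiset.exists_cons_of_mem h
    obtain ⟨hc, hp, hsum⟩ := hm
    rw [Multiset.card_cons] at hc
    obtain ⟨b, c, rfl⟩ := Multiset.card_eq_two.1 (by omega : Multiset.card t = 2)
    have hb : 0 < b := hp b (by simp)
    have hc' : 0 < c := hp c (by simp)
    have hs : a + (b + c) = n := by simpa using hsum
    rcases le_total b c with hbc | hbc
    · refine ⟨b, by simp; omega, ?_⟩
      simp [show n - a - b = c by omega]
    · refine ⟨c, by simp; omega, ?_⟩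
      simp [show n - a - c = b by omega, ← Multiset.singleton_add, add_comm]
  · rintro ⟨j, hj, rfl⟩
    simp only [Finset.coe_Icc, Set.mem_Icc] at hj
    refine ⟨⟨by simp, ?_, ?_⟩, by simp⟩
    · intro y hy
      simp at hy
      omega
    · simp
      omega

theorem finite_kPartitions_three_mem {n a : ℕ} (ha : 0 < a) (han : a ≤ n) :
    {m ∈ kPartitions 3 n | a ∈ m}.Finite := by
  rw [kPartitions_three_mem ha han]
  exact (Finset.finite_toSet _).image _

theorem ncard_kPartitions_three_mem {n a : ℕ} (ha : 0 < a) (han : a ≤ n) :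
    {m ∈ kPartitions 3 n | a ∈ m}.ncard = (n - a) / 2 := by
  rw [kPartitions_three_mem ha han, Set.InjOn.ncard_image, Set.ncard_coe_finset, Nat.card_Icc]
  · omega
  · intro i hi j hj hij
    simp only [Finset.coe_Icc, Set.mem_Icc] at hi hj
    have h : ({i, n - a - i} : Multiset ℕ) = {j, n - a - j} := (Multiset.cons_inj_right a).1 hij
    have hmem : i ∈ ({j, n - a - j} : Multiset ℕ) := h ▸ by simp
    simp at hmem
    omega

/-- Distinct terms summing to `n` cannot both occur in a `3`-partition of `n`. -/
theorem disjoint_kPartitions_three_mem {n a b : ℕ} (hab : a + b = n) (hne : a ≠ b) :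
    Disjoint {m ∈ kPartitions 3 n | a ∈ m} {m ∈ kPartitions 3 n | b ∈ m} := by
  rw [Set.disjoint_left]
  rintro m ⟨⟨hc, hp, hsum⟩, ha⟩ ⟨-, hb⟩
  obtain ⟨t, rfl⟩ := Multiset.exists_cons_of_mem ha
  obtain ⟨u, rfl⟩ := Multiset.exists_cons_of_mem ((Multiset.mem_cons.1 hb).resolve_left hne.symm)
  simp only [Multiset.card_cons] at hc
  obtain ⟨c, rfl⟩ := Multiset.card_eq_one.1 (by omega : Multiset.card u = 1)
  have hc' : 0 < c := hp c (by simp)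
  simp at hsum
  omega

theorem three_partitions_cluster_count (n x : ℕ) (hn : 2 ≤ n) (hx₁ : 1 ≤ x) (hx₂ : x ≤ n - 1) :
    (if 4 ≤ n ∧ Even n ∧ 2 * x = n then (kPartitionsCluster 3 n x).ncard = n / 4
      else (kPartitionsCluster 3 n x).ncard = (n - x) / 2 + x / 2) ∧
    ((kPartitionsCluster 3 n x).ncard : ℝ) ≤ (n : ℝ) / 2 := by
  have key : if 4 ≤ n ∧ Even n ∧ 2 * x = n then (kPartitionsCluster 3 n x).ncard = n / 4
      else (kPartitionsCluster 3 n x).ncard = (n - x) / 2 + x / 2 := by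
    rw [kPartitionsCluster_three (by omega)]
    by_cases h : 2 * x = n
    · rw [show n - x = x by omega, Set.union_self, ncard_kPartitions_three_mem hx₁ (by omega)]
      split_ifs with h4
      · omega
      · have : ¬ 4 ≤ n := fun h' => h4 ⟨h', ⟨x, by omega⟩, h⟩
        omega
    · rw [if_neg (fun h' => h h'.2.2),
        Set.ncard_union_eq (disjoint_kPartitions_three_mem (by omega) (by omega))
          (finite_kPartitions_three_mem hx₁ (by omega))
          (finite_kPartitions_three_mem (by omega) (by omega)),
        ncard_kPartitions_three_mem hx₁ (by omega),
        ncard_kPartitions_three_mem (by omega) (by omega)]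
      omega
  refine ⟨key, ?_⟩
  have hle : (kPartitionsCluster 3 n x).ncard * 2 ≤ n := by
    split_ifs at key <;> omega
  rw [le_div_iff₀ two_pos]
  exact_mod_cast hle
end

section
/- Let n, x, y be positive integers with 1 ≤ x < y < n/2. Then 𝔓₃(n,x) ∩ 𝔓₃(n,y) = {[x, y, n−x−y], [x, y−x, n−y]}, and this set has exactly 2 elements. -/
/-- A `3`-partition has an `x`-cluster iff one of its terms is `x` or complements `x`. -/
theorem mem_kPartitionsCluster_three_iff {n x : ℕ} {m : Multiset ℕ} :
    m ∈ kPartitionsCluster 3 n x ↔ m ∈ kPartitions 3 n ∧ (x ∈ m ∨ ∃ z ∈ m, z + x = n) := by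
  refine and_congr_right fun hm => ?_
  obtain ⟨hcard, -, hsum⟩ := hm
  constructor
  · rintro ⟨s, hs, hs0, hsm, rfl⟩
    obtain ⟨t, rfl⟩ := Multiset.le_iff_exists_add.1 hs
    have ht0 : t ≠ 0 := by
      rintro rfl
      simp at hsm
    have hspos := Multiset.card_pos.2 hs0
    have htpos := Multiset.card_pos.2 ht0
    rw [Multiset.card_add] at hcard
    obtain h | h : Multiset.card s = 1 ∨ Multiset.card t = 1 := by omega
    · obtain ⟨a, rfl⟩ := Multiset.card_eq_one.1 h
      simp
    · obtain ⟨a, rfl⟩ := Multiset.card_eq_one.1 h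
      refine Or.inr ⟨a, by simp, ?_⟩
      simp only [Multiset.sum_add, Multiset.sum_singleton] at hsum
      omega
  · rintro (hx | ⟨z, hz, hzx⟩)
    · refine ⟨{x}, Multiset.singleton_le.2 hx, by simp, ?_, by simp⟩
      rintro rfl
      simp at hcard
    · obtain ⟨t, rfl⟩ := Multiset.exists_cons_of_mem hz
      rw [Multiset.card_cons] at hcard
      rw [Multiset.sum_cons] at hsum
      refine ⟨t, Multiset.le_cons_self t z, ?_, ?_, by omega⟩
      · rintro rfl
        simp at hcard
      · intro h
        have := congrArg Multiset.card h
        simp at this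

/-- A `3`-partition with two different terms is determined by them. -/
theorem eq_of_mem_kPartitions_three {n a b : ℕ} {m : Multiset ℕ} (hm : m ∈ kPartitions 3 n)
    (ha : a ∈ m) (hb : b ∈ m) (hab : a ≠ b) : ∃ c, a + b + c = n ∧ m = {a, b, c} := by
  obtain ⟨hcard, -, hsum⟩ := hm
  obtain ⟨t, rfl⟩ := Multiset.exists_cons_of_mem ha
  obtain ⟨u, rfl⟩ :=
    Multiset.exists_cons_of_mem ((Multiset.mem_cons.1 hb).resolve_left hab.symm)
  simp only [Multiset.card_cons] at hcard
  obtain ⟨c, rfl⟩ := Multiset.card_eq_one.1 (by omega : Multiset.card u = 1)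
  refine ⟨c, ?_, rfl⟩
  simp only [Multiset.sum_cons, Multiset.sum_singleton] at hsum
  omega

theorem cluster_inter_two (n x y : ℕ) (hx : 1 ≤ x) (hxy : x < y) (hy : 2 * y < n) :
    kPartitionsCluster 3 n x ∩ kPartitionsCluster 3 n y =
      ({({x, y, n - x - y} : Multiset ℕ), ({x, y - x, n - y} : Multiset ℕ)} :
        Set (Multiset ℕ)) ∧
    (kPartitionsCluster 3 n x ∩ kPartitionsCluster 3 n y).ncard = 2 := by
  have heq : kPartitionsCluster 3 n x ∩ kPartitionsCluster 3 n y =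
      ({({x, y, n - x - y} : Multiset ℕ), ({x, y - x, n - y} : Multiset ℕ)} :
        Set (Multiset ℕ)) := by
    ext m
    simp only [Set.mem_inter_iff, mem_kPartitionsCluster_three_iff, Set.mem_insert_iff,
      Set.mem_singleton_iff]
    constructor
    · rintro ⟨⟨hm, hmx⟩, -, hmy⟩
      rcases hmx with hmx | ⟨z, hz, hzx⟩ <;> rcases hmy with hmy | ⟨w, hw, hwy⟩
      · obtain ⟨c, hc, rfl⟩ := eq_of_mem_kPartitions_three hm hmx hmy (by omega)
        obtain rfl : c = n - x - y := by omega
        exact Or.inl rfl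
      · obtain ⟨c, hc, rfl⟩ := eq_of_mem_kPartitions_three hm hmx hw (by omega)
        obtain rfl : c = y - x := by omega
        obtain rfl : w = n - y := by omega
        exact Or.inr (congrArg (x ::ₘ ·) (Multiset.pair_comm _ _))
      · obtain ⟨c, hc, -⟩ := eq_of_mem_kPartitions_three hm hz hmy (by omega)
        omega
      · obtain ⟨c, hc, -⟩ := eq_of_mem_kPartitions_three hm hz hw (by omega)
        omega
    · rintro (rfl | rfl)
      · have hm : ({x, y, n - x - y} : Multiset ℕ) ∈ kPartitions 3 n := by
          refine ⟨by simp, ?_, ?_⟩ <;> simp <;> omega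
        exact ⟨⟨hm, Or.inl (by simp)⟩, hm, Or.inl (by simp)⟩
      · have hm : ({x, y - x, n - y} : Multiset ℕ) ∈ kPartitions 3 n := by
          refine ⟨by simp, ?_, ?_⟩ <;> simp <;> omega
        exact ⟨⟨hm, Or.inl (by simp)⟩, hm, Or.inr ⟨n - y, by simp, by omega⟩⟩
  refine ⟨heq, ?_⟩
  rw [heq]
  refine Set.ncard_pair fun h => ?_
  have hmem : y ∈ ({x, y - x, n - y} : Multiset ℕ) := h ▸ (by simp)
  simp only [Multiset.insert_eq_cons, Multiset.mem_cons, Multiset.mem_singleton] at hmem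
  omega
end

section
/- Let n, x, y, z be positive integers with 1 ≤ x < y < z < n/2. Then 𝔓₃(n,x) ∩ 𝔓₃(n,y) ∩ 𝔓₃(n,z) is empty if z ∉ {x+y, n−x−y}, and equals the singleton {[x, y, n−x−y]} if z ∈ {x+y, n−x−y}. -/
theorem triple_mem_kPartitionsCluster_iff (n x a b c : ℕ) :
    ({a, b, c} : Multiset ℕ) ∈ kPartitionsCluster 3 n x ↔
      (0 < a ∧ 0 < b ∧ 0 < c ∧ a + b + c = n) ∧
        (x = a ∨ x = b ∨ x = c ∨ x + a = n ∨ x + b = n ∨ x + c = n) := by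
  have hpart : ({a, b, c} : Multiset ℕ) ∈ kPartitions 3 n ↔
      0 < a ∧ 0 < b ∧ 0 < c ∧ a + b + c = n := by
    simp [kPartitions, and_assoc, add_assoc]
  have hpow (s : Multiset ℕ) : s ≤ ({a, b, c} : Multiset ℕ) ↔
      s = 0 ∨ s = {c} ∨ s = {b} ∨ s = {b, c} ∨ s = {a} ∨ s = {a, c} ∨ s = {a, b} ∨
        s = {a, b, c} := by
    rw [← Multiset.mem_powerset]
    simp only [Multiset.insert_eq_cons, ← Multiset.cons_zero, Multiset.powerset_cons,
      Multiset.powerset_zero, Multiset.map_add, Multiset.map_cons, Multiset.map_zero,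
      Multiset.mem_add, Multiset.mem_cons, Multiset.notMem_zero, or_false, or_assoc]
  have hne {s : Multiset ℕ} (hs : s.card ≠ 3) : s ≠ {a, b, c} := by
    rintro rfl
    simp at hs
  rw [kPartitionsCluster, Set.mem_ofPred_eq, hpart]
  refine and_congr_right fun h => ⟨?_, ?_⟩
  · rintro ⟨s, hs, h0, h3, rfl⟩
    rcases (hpow s).1 hs with rfl | rfl | rfl | rfl | rfl | rfl | rfl | rfl <;>
      simp_all <;> omega
  · rintro (hx | hx | hx | hx | hx | hx)
    · exact ⟨{a}, (hpow _).2 (by simp), by simp, hne (by simp), by simp [hx]⟩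
    · exact ⟨{b}, (hpow _).2 (by simp), by simp, hne (by simp), by simp [hx]⟩
    · exact ⟨{c}, (hpow _).2 (by simp), by simp, hne (by simp), by simp [hx]⟩
    · exact ⟨{b, c}, (hpow _).2 (by simp), by simp, hne (by simp), by simp; omega⟩
    · exact ⟨{a, c}, (hpow _).2 (by simp), by simp, hne (by simp), by simp; omega⟩
    · exact ⟨{a, b}, (hpow _).2 (by simp), by simp, hne (by simp), by simp; omega⟩

theorem Multiset.triple_rotate {α : Type*} (a b c : α) : ({a, b, c} : Multiset α) = {b, c, a} := by
  simp only [Multiset.insert_eq_cons, ← Multiset.cons_zero]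
  rw [Multiset.cons_swap a b, Multiset.cons_swap a c]

theorem Multiset.triple_swap {α : Type*} (a b c : α) : ({a, b, c} : Multiset α) = {b, a, c} :=
  Multiset.cons_swap a b {c}

theorem eq_triple_of_mem_cluster_inter {n x y z : ℕ} (hxy : x < y) (hyz : y < z)
    (hz : 2 * z < n) {m : Multiset ℕ}
    (hm : m ∈ kPartitionsCluster 3 n x ∩ kPartitionsCluster 3 n y ∩ kPartitionsCluster 3 n z) :
    (z = x + y ∨ z = n - x - y) ∧ m = {x, y, n - x - y} := by
  obtain ⟨a, b, c, rfl⟩ := Multiset.card_eq_three.1 hm.1.1.1.1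
  obtain ⟨⟨hmx, hmy⟩, hmz⟩ := hm
  rw [triple_mem_kPartitionsCluster_iff] at hmx hmy hmz
  obtain ⟨⟨ha, hb, hc, hsum⟩, hx⟩ := hmx
  have hy := hmy.2
  have hz' := hmz.2
  clear hmy hmz
  have key : (z = x + y ∨ z = n - x - y) ∧
      ((a = x ∧ b = y ∧ c = n - x - y) ∨ (a = x ∧ c = y ∧ b = n - x - y) ∨
      (b = x ∧ a = y ∧ c = n - x - y) ∨ (b = x ∧ c = y ∧ a = n - x - y) ∨
      (c = x ∧ a = y ∧ b = n - x - y) ∨ (c = x ∧ b = y ∧ a = n - x - y)) := by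
    rcases hx with hx | hx | hx | hx | hx | hx <;>
      rcases hy with hy | hy | hy | hy | hy | hy <;>
      first
      | (exfalso; omega)
      | rcases hz' with hz' | hz' | hz' | hz' | hz' | hz' <;> first | (exfalso; omega) | omega
  refine ⟨key.1, ?_⟩
  rcases key.2 with ⟨h₁, h₂, h₃⟩ | ⟨h₁, h₂, h₃⟩ | ⟨h₁, h₂, h₃⟩ | ⟨h₁, h₂, h₃⟩ | ⟨h₁, h₂, h₃⟩ |
    ⟨h₁, h₂, h₃⟩ <;> rw [← h₃, ← h₁, ← h₂]
  · rw [Multiset.triple_rotate, Multiset.triple_swap, Multiset.triple_rotate,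
      Multiset.triple_rotate]
  · exact Multiset.triple_swap a b c
  · exact Multiset.triple_rotate a b c
  · rw [Multiset.triple_rotate, Multiset.triple_rotate]
  · rw [Multiset.triple_swap, Multiset.triple_rotate, Multiset.triple_rotate]

theorem cluster_inter_three (n x y z : ℕ) (hx : 1 ≤ x) (hxy : x < y) (hyz : y < z)
    (hz : 2 * z < n) :
    (z ≠ x + y ∧ z ≠ n - x - y →
      kPartitionsCluster 3 n x ∩ kPartitionsCluster 3 n y ∩ kPartitionsCluster 3 n z = ∅) ∧
    (z = x + y ∨ z = n - x - y →
      kPartitionsCluster 3 n x ∩ kPartitionsCluster 3 n y ∩ kPartitionsCluster 3 n z =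
        ({({x, y, n - x - y} : Multiset ℕ)} : Set (Multiset ℕ))) := by
  refine ⟨fun h => Set.eq_empty_of_forall_notMem fun m hm => ?_, fun h => ?_⟩
  · exact (eq_triple_of_mem_cluster_inter hxy hyz hz hm).1.elim h.1 h.2
  · refine Set.Subset.antisymm (fun m hm => (eq_triple_of_mem_cluster_inter hxy hyz hz hm).2) ?_
    rintro m rfl
    simp only [Set.mem_inter_iff, triple_mem_kPartitionsCluster_iff]
    have hc : 0 < n - x - y := by omega
    have hsum : x + y + (n - x - y) = n := by omega
    have hz' : z = n - x - y ∨ z + (n - x - y) = n := by omega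
    have hy : 0 < y := by omega
    tauto
end
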